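/- arXiv:2309.01996 — 6 statements merged into one kernel-verified Lean document; each statement's English description precedes it below -/
import Mathlib

section
/- For every 1 < p < ∞ there exists a constant C_p > 0 depending only on p such that the following holds: for every n ≥ 1, every open set Ω ⊆ ℂⁿ, every z₀ ∈ Ω and r > 0 with the closed ball {z : |z − z₀| ≤ r} contained in Ω, and every holomorphic f = u + iv on Ω with v(z₀) = 0, one has ∫_{S(z₀,r)} |f|^p dσ_{z₀,r} ≤ C_p^p · ∫_{S(z₀,r)} |u|^p dσ_{z₀,r}. -/
open Real MeasureTheory Set

noncomputable instance euclideanCnMeasurableSpace (n : ℕ) :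
    MeasurableSpace (EuclideanSpace ℂ (Fin n)) := borel _

instance euclideanCnBorelSpace (n : ℕ) :
    BorelSpace (EuclideanSpace ℂ (Fin n)) := ⟨rfl⟩

/-- The surface measure on the sphere `S(z₀, r) ⊆ ℂⁿ` (the `(2n−1)`-dimensional Hausdorff
measure restricted to the sphere), normalized to total mass `1`; this is the harmonic measure
of the ball `B(z₀, r)` at its center `z₀`. -/
noncomputable def sphereUnifMeasure (n : ℕ) (z₀ : EuclideanSpace ℂ (Fin n)) (r : ℝ) :
    Measure (EuclideanSpace ℂ (Fin n)) :=
  ((μH[2 * (n : ℝ) - 1] : Measure (EuclideanSpace ℂ (Fin n))) (Metric.sphere z₀ r))⁻¹ •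
    (μH[2 * (n : ℝ) - 1] : Measure (EuclideanSpace ℂ (Fin n))).restrict (Metric.sphere z₀ r)


lemma rs_hasDerivAt_param (F F' : ℝ → ℝ → ℝ) (U : Set ℝ) (hU : IsOpen U)
    (hF : ∀ t ∈ U, ∀ θ, HasDerivAt (fun t => F t θ) (F' t θ) t)
    (hFc : ContinuousOn (fun x : ℝ × ℝ => F x.1 x.2) (U ×ˢ univ))
    (hFc' : ContinuousOn (fun x : ℝ × ℝ => F' x.1 x.2) (U ×ˢ univ)) (t₀ : ℝ) (ht : t₀ ∈ U) :
    HasDerivAt (fun t => ∫ θ in (0:ℝ)..2 * π, F t θ) (∫ θ in (0:ℝ)..2 * π, F' t₀ θ) t₀ := by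
  obtain ⟨δ, hδ, hsub⟩ := Metric.nhds_basis_closedBall.mem_iff.1 (hU.mem_nhds ht)
  have hcF : ∀ t ∈ U, Continuous (F t) := fun t ht => by
    have := hFc.comp_continuous (f := fun θ : ℝ => (t, θ)) (by fun_prop) (fun θ => ⟨ht, trivial⟩)
    exact this
  have hcF' : ∀ t ∈ U, Continuous (F' t) := fun t ht => by
    have := hFc'.comp_continuous (f := fun θ : ℝ => (t, θ)) (by fun_prop) (fun θ => ⟨ht, trivial⟩)
    exact this
  have hK : IsCompact (Metric.closedBall t₀ δ ×ˢ Icc (0:ℝ) (2 * π)) :=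
    (isCompact_closedBall t₀ δ).prod isCompact_Icc
  obtain ⟨C, hC⟩ := hK.exists_bound_of_continuousOn
    (hFc'.mono (Set.prod_mono hsub (subset_univ _)))
  have hpi := Real.pi_pos
  refine (intervalIntegral.hasDerivAt_integral_of_dominated_loc_of_deriv_le (F := F) (F' := F')
    (bound := fun _ => C) (Metric.closedBall_mem_nhds t₀ hδ) ?_ ?_ ?_ ?_ ?_ ?_).2
  · filter_upwards [hU.mem_nhds ht] with t ht using (hcF t ht).aestronglyMeasurable
  · exact (hcF t₀ ht).intervalIntegrable _ _
  · exact (hcF' t₀ ht).aestronglyMeasurable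
  · refine Filter.Eventually.of_forall fun θ hθ t ht => ?_
    rw [uIoc_of_le (by positivity)] at hθ
    exact hC (t, θ) ⟨ht, ⟨hθ.1.le, hθ.2⟩⟩
  · simp
  · refine Filter.Eventually.of_forall fun θ hθ t ht => hF t (hsub ht) θ

lemma rs_bilin (B : ℂ →L[ℝ] ℂ →L[ℝ] ℝ) (a : ℂ) :
    B a a + B (Complex.I * a) (Complex.I * a) =
      (a.re ^ 2 + a.im ^ 2) * (B 1 1 + B Complex.I Complex.I) := by
  have h1 : a = a.re • (1:ℂ) + a.im • Complex.I := by
    apply Complex.ext <;> simp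
  have h2 : Complex.I * a = (-a.im) • (1:ℂ) + a.re • Complex.I := by
    apply Complex.ext <;> simp
  rw [h2]
  nth_rewrite 1 2 [h1]
  simp only [map_add, map_smul, add_apply, smul_apply,
    smul_eq_mul]
  ring

lemma rs_mean (S : ℂ → ℝ) (hS : ContDiff ℝ 2 S)
    (hlap : ∀ z, fderiv ℝ (fderiv ℝ S) z 1 1 + fderiv ℝ (fderiv ℝ S) z Complex.I Complex.I ≤ 0)
    (f : ℂ → ℂ) (R : ℝ) (hR : 1 < R) (hf : DifferentiableOn ℂ f (Metric.ball 0 R)) :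
    ∫ θ in (0:ℝ)..2 * π, S (f (Complex.exp (θ * Complex.I))) ≤ 2 * π * S (f 0) := by
  have hpi := Real.pi_pos
  set c : ℝ → ℂ := fun θ => Complex.exp (θ * Complex.I) with hc
  have hcn : ∀ θ, ‖c θ‖ = 1 := fun θ => Complex.norm_exp_ofReal_mul_I θ
  have hcc : Continuous c := by fun_prop
  have hcd : ∀ θ, HasDerivAt c (c θ * Complex.I) θ := fun θ => by
    have := ((Complex.ofRealCLM.hasDerivAt (x := θ)).mul_const Complex.I).cexp
    simpa using this
  set U : Set ℝ := Ioo (-R) R with hUdef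
  have hU : IsOpen U := isOpen_Ioo
  have hmem : ∀ t ∈ U, ∀ θ, (t : ℂ) * c θ ∈ Metric.ball (0:ℂ) R := fun t ht θ => by
    simp only [mem_ball_zero_iff, norm_mul, hcn, mul_one, Complex.norm_real, Real.norm_eq_abs]
    exact abs_lt.2 ht
  obtain ⟨f', hf'⟩ : ∃ g, g = deriv f := ⟨_, rfl⟩
  have hf'd : DifferentiableOn ℂ f' (Metric.ball 0 R) := hf' ▸ hf.deriv Metric.isOpen_ball
  obtain ⟨h, hh⟩ : ∃ h : ℂ → ℂ, h = fun z => z * f' z := ⟨_, rfl⟩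
  have hhd : DifferentiableOn ℂ h (Metric.ball 0 R) := hh ▸ differentiableOn_id.mul hf'd
  obtain ⟨h', hh'⟩ : ∃ g, g = deriv h := ⟨_, rfl⟩
  have hh'd : DifferentiableOn ℂ h' (Metric.ball 0 R) := hh' ▸ hhd.deriv Metric.isOpen_ball
  have hfat : ∀ z ∈ Metric.ball (0:ℂ) R, HasDerivAt f (f' z) z := fun z hz => hf' ▸
    (hf.differentiableAt (Metric.isOpen_ball.mem_nhds hz)).hasDerivAt
  have hhat : ∀ z ∈ Metric.ball (0:ℂ) R, HasDerivAt h (h' z) z := fun z hz => hh' ▸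
    (hhd.differentiableAt (Metric.isOpen_ball.mem_nhds hz)).hasDerivAt
  have hS1 : ContDiff ℝ 1 (fderiv ℝ S) := hS.fderiv_right (by norm_num)
  have hS2c : Continuous (fderiv ℝ (fderiv ℝ S)) := hS1.continuous_fderiv (by norm_num)
  have hS1c : Continuous (fderiv ℝ S) := hS1.continuous
  have hSat : ∀ z, HasFDerivAt S (fderiv ℝ S z) z := fun z =>
    (hS.differentiable (by norm_num) z).hasFDerivAt
  have hS1at : ∀ z, HasFDerivAt (fderiv ℝ S) (fderiv ℝ (fderiv ℝ S) z) z := fun z =>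
    (hS1.differentiable (by norm_num) z).hasFDerivAt
  have hpt : ∀ t : ℝ, ∀ θ, HasDerivAt (fun t : ℝ => (t:ℂ) * c θ) (c θ) t := fun t θ => by
    simpa using (Complex.ofRealCLM.hasDerivAt (x := t)).mul_const (c θ)
  have hpθ : ∀ t : ℝ, ∀ θ, HasDerivAt (fun θ : ℝ => (t:ℂ) * c θ) (t * (c θ * Complex.I)) θ :=
    fun t θ => (hcd θ).const_mul _
  have hzc : ContinuousOn (fun x : ℝ × ℝ => (x.1 : ℂ) * c x.2) (U ×ˢ univ) := by
    apply Continuous.continuousOn; fun_prop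
  have hcomp : ∀ g : ℂ → ℂ, DifferentiableOn ℂ g (Metric.ball 0 R) →
      ContinuousOn (fun x : ℝ × ℝ => g ((x.1 : ℂ) * c x.2)) (U ×ˢ univ) := fun g hg =>
    hg.continuousOn.comp hzc (fun x hx => hmem x.1 hx.1 x.2)
  have hfc := hcomp f hf
  have hf'c := hcomp f' hf'd
  have hhc := hcomp h hhd
  have hh'c := hcomp h' hh'd
  have hc2 : ContinuousOn (fun x : ℝ × ℝ => c x.2) (U ×ˢ univ) := by
    apply Continuous.continuousOn; fun_prop
  -- chain rules
  have ft : ∀ t ∈ U, ∀ θ, HasDerivAt (fun t : ℝ => f (t * c θ)) (f' (t * c θ) * c θ) t :=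
    fun t ht θ => (hfat _ (hmem t ht θ)).comp t (hpt t θ)
  have hht : ∀ t ∈ U, ∀ θ, HasDerivAt (fun t : ℝ => h (t * c θ)) (h' (t * c θ) * c θ) t :=
    fun t ht θ => (hhat _ (hmem t ht θ)).comp t (hpt t θ)
  have fθ : ∀ t ∈ U, ∀ θ, HasDerivAt (fun θ : ℝ => f (t * c θ))
      (f' (t * c θ) * (t * (c θ * Complex.I))) θ :=
    fun t ht θ => (hfat _ (hmem t ht θ)).comp θ (hpθ t θ)
  have hhθ : ∀ t ∈ U, ∀ θ, HasDerivAt (fun θ : ℝ => h (t * c θ))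
      (h' (t * c θ) * (t * (c θ * Complex.I))) θ :=
    fun t ht θ => (hhat _ (hmem t ht θ)).comp θ (hpθ t θ)
  have hKd : ∀ t ∈ U, HasDerivAt (fun t : ℝ => ∫ θ in (0:ℝ)..2 * π, S (f (t * c θ)))
      (∫ θ in (0:ℝ)..2 * π, fderiv ℝ S (f (t * c θ)) (f' (t * c θ) * c θ)) t := by
    intro t ht
    refine rs_hasDerivAt_param (fun t θ => S (f (t * c θ)))
      (fun t θ => fderiv ℝ S (f (t * c θ)) (f' (t * c θ) * c θ)) U hU ?_ ?_ ?_ t ht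
    · intro t ht θ
      exact (hSat _).comp_hasDerivAt t (ft t ht θ)
    · exact hS.continuous.comp_continuousOn hfc
    · exact (hS1c.comp_continuousOn hfc).clm_apply (hf'c.mul hc2)
  have hLd : ∀ t ∈ U, HasDerivAt
      (fun t : ℝ => ∫ θ in (0:ℝ)..2 * π, fderiv ℝ S (f (t * c θ)) (h (t * c θ)))
      (∫ θ in (0:ℝ)..2 * π, (fderiv ℝ (fderiv ℝ S) (f (t * c θ)) (f' (t * c θ) * c θ) (h (t * c θ))
        + fderiv ℝ S (f (t * c θ)) (h' (t * c θ) * c θ))) t := by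
    intro t ht
    refine rs_hasDerivAt_param (fun t θ => fderiv ℝ S (f (t * c θ)) (h (t * c θ)))
      (fun t θ => fderiv ℝ (fderiv ℝ S) (f (t * c θ)) (f' (t * c θ) * c θ) (h (t * c θ))
        + fderiv ℝ S (f (t * c θ)) (h' (t * c θ) * c θ)) U hU ?_ ?_ ?_ t ht
    · intro t ht θ
      exact ((hS1at _).comp_hasDerivAt t (ft t ht θ)).clm_apply (hht t ht θ)
    · exact (hS1c.comp_continuousOn hfc).clm_apply hhc
    · exact (((hS2c.comp_continuousOn hfc).clm_apply (hf'c.mul hc2)).clm_apply hhc).add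
        ((hS1c.comp_continuousOn hfc).clm_apply (hh'c.mul hc2))
  have hsl : ∀ t ∈ U, ∀ g : ℂ → ℂ, DifferentiableOn ℂ g (Metric.ball 0 R) →
      Continuous (fun θ : ℝ => g (t * c θ)) := fun t ht g hg =>
    (hcomp g hg).comp_continuous (f := fun θ : ℝ => (t, θ)) (by fun_prop)
      (fun θ => ⟨ht, trivial⟩)
  have hL'neg : ∀ t ∈ U, 0 < t →
      (∫ θ in (0:ℝ)..2 * π, (fderiv ℝ (fderiv ℝ S) (f (t * c θ)) (f' (t * c θ) * c θ) (h (t * c θ))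
        + fderiv ℝ S (f (t * c θ)) (h' (t * c θ) * c θ))) ≤ 0 := by
    intro t ht ht0
    have c1 := hsl t ht f hf
    have c2 := hsl t ht f' hf'd
    have c3 := hsl t ht h hhd
    have c4 := hsl t ht h' hh'd
    have hPd : ∀ θ, HasDerivAt (fun θ : ℝ => fderiv ℝ S (f (t * c θ)) (Complex.I * h (t * c θ)))
        (fderiv ℝ (fderiv ℝ S) (f (t * c θ)) (f' (t * c θ) * (t * (c θ * Complex.I)))
          (Complex.I * h (t * c θ)) + fderiv ℝ S (f (t * c θ))
            (Complex.I * (h' (t * c θ) * (t * (c θ * Complex.I))))) θ := fun θ =>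
      ((hS1at _).comp_hasDerivAt θ (fθ t ht θ)).clm_apply ((hhθ t ht θ).const_mul _)
    have hP'c : Continuous (fun θ : ℝ => fderiv ℝ (fderiv ℝ S) (f (t * c θ))
          (f' (t * c θ) * (t * (c θ * Complex.I)))
          (Complex.I * h (t * c θ)) + fderiv ℝ S (f (t * c θ))
            (Complex.I * (h' (t * c θ) * (t * (c θ * Complex.I))))) := by
      have d1 := hS1c.comp c1
      have d2 := hS2c.comp c1
      exact ((d2.clm_apply (c2.mul (continuous_const.mul (hcc.mul continuous_const)))).clm_apply
        (continuous_const.mul c3)).add (d1.clm_apply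
        (continuous_const.mul (c4.mul (continuous_const.mul (hcc.mul continuous_const)))))
    have hF'c : Continuous (fun θ : ℝ =>
        fderiv ℝ (fderiv ℝ S) (f (t * c θ)) (f' (t * c θ) * c θ) (h (t * c θ))
        + fderiv ℝ S (f (t * c θ)) (h' (t * c θ) * c θ)) := by
      have d1 := hS1c.comp c1
      have d2 := hS2c.comp c1
      exact ((d2.clm_apply (c2.mul hcc)).clm_apply c3).add (d1.clm_apply (c4.mul hcc))
    have hz := intervalIntegral.integral_eq_sub_of_hasDerivAt (a := 0) (b := 2 * π)
      (fun θ _ => hPd θ) (hP'c.intervalIntegrable _ _)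
    have hc2pi : c (2 * π) = c 0 := by simp [hc]
    rw [hc2pi, sub_self] at hz
    refine nonpos_of_mul_nonpos_right (a := t) ?_ ht0
    rw [← intervalIntegral.integral_const_mul]
    refine le_of_eq_of_le ((congrArg (_ + ·) hz).trans (add_zero _)).symm ?_
    rw [← intervalIntegral.integral_add ((hF'c.const_mul t).intervalIntegrable _ _)
        (hP'c.intervalIntegrable _ _)]
    rw [← neg_nonneg, ← intervalIntegral.integral_neg]
    apply intervalIntegral.integral_nonneg (by positivity)
    intro θ _
    set z : ℂ := t * c θ with hzdef
    have e1 : f' z * (t * (c θ * Complex.I)) = Complex.I * h z := by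
      simp only [hh, hzdef]; ring
    have e2 : Complex.I * (h' z * (t * (c θ * Complex.I))) = (-t) • (h' z * c θ) := by
      rw [Complex.real_smul]; push_cast
      linear_combination (h' z * t * c θ) * Complex.I_mul_I
    have e3 : h z = t • (f' z * c θ) := by
      rw [Complex.real_smul]; simp only [hh, hzdef]; ring
    have e4 : t * fderiv ℝ (fderiv ℝ S) (f z) (f' z * c θ) (h z)
        = fderiv ℝ (fderiv ℝ S) (f z) (h z) (h z) := by
      have e5 := map_smul (fderiv ℝ (fderiv ℝ S) (f z)) t (f' z * c θ)
      rw [← e3] at e5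
      rw [e5]; rfl
    rw [e1, e2, map_smul, mul_add, e4, smul_eq_mul]
    have := rs_bilin (fderiv ℝ (fderiv ℝ S) (f z)) (h z)
    have h5 : ((h z).re ^ 2 + (h z).im ^ 2) * (fderiv ℝ (fderiv ℝ S) (f z) 1 1
      + fderiv ℝ (fderiv ℝ S) (f z) Complex.I Complex.I) ≤ 0 :=
      mul_nonpos_of_nonneg_of_nonpos (by positivity) (hlap _)
    linarith
  have hsub : Icc (0:ℝ) 1 ⊆ U := fun t ht => ⟨by linarith [ht.1], by linarith [ht.2]⟩
  have hLanti : AntitoneOn (fun t : ℝ => ∫ θ in (0:ℝ)..2 * π,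
      fderiv ℝ S (f (t * c θ)) (h (t * c θ))) (Icc 0 1) := by
    apply antitoneOn_of_deriv_nonpos (convex_Icc 0 1)
    · exact fun t ht => (hLd t (hsub ht)).continuousAt.continuousWithinAt
    · rw [interior_Icc]
      exact fun t ht => (hLd t (hsub (Ioo_subset_Icc_self ht))).differentiableAt.differentiableWithinAt
    · rw [interior_Icc]
      intro t ht
      have ht' := hsub (Ioo_subset_Icc_self ht)
      rw [(hLd t ht').deriv]
      exact hL'neg t ht' ht.1
  have hKanti : AntitoneOn (fun t : ℝ => ∫ θ in (0:ℝ)..2 * π, S (f (t * c θ))) (Icc 0 1) := by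
    apply antitoneOn_of_deriv_nonpos (convex_Icc 0 1)
    · exact fun t ht => (hKd t (hsub ht)).continuousAt.continuousWithinAt
    · rw [interior_Icc]
      exact fun t ht => (hKd t (hsub (Ioo_subset_Icc_self ht))).differentiableAt.differentiableWithinAt
    · rw [interior_Icc]
      intro t ht
      have ht' := hsub (Ioo_subset_Icc_self ht)
      rw [(hKd t ht').deriv]
      refine nonpos_of_mul_nonpos_right (a := t) ?_ ht.1
      have := hLanti (left_mem_Icc.2 zero_le_one) (Ioo_subset_Icc_self ht) ht.1.le
      rw [← intervalIntegral.integral_const_mul]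
      have e : ∀ θ, t * fderiv ℝ S (f (t * c θ)) (f' (t * c θ) * c θ)
          = fderiv ℝ S (f (t * c θ)) (h (t * c θ)) := fun θ => by
        have e3 : h (t * c θ) = t • (f' (t * c θ) * c θ) := by
          rw [Complex.real_smul]; simp only [hh]; ring
        rw [e3, map_smul, smul_eq_mul]
      simp only [e]
      simpa [hh] using this
  have := hKanti (left_mem_Icc.2 zero_le_one) (right_mem_Icc.2 zero_le_one) zero_le_one
  simpa using this

lemma rs_lap (S : ℂ → ℝ) (hS : ContDiff ℝ 2 S) (G Gx Gy Gxx Gyy : ℝ → ℝ → ℝ)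
    (hG : ∀ z, S z = G z.re z.im)
    (hx : ∀ x y, HasDerivAt (fun t => G t y) (Gx x y) x)
    (hy : ∀ x y, HasDerivAt (fun t => G x t) (Gy x y) y)
    (hxx : ∀ x y, HasDerivAt (fun t => Gx t y) (Gxx x y) x)
    (hyy : ∀ x y, HasDerivAt (fun t => Gy x t) (Gyy x y) y) (z : ℂ) :
    fderiv ℝ (fderiv ℝ S) z 1 1 + fderiv ℝ (fderiv ℝ S) z Complex.I Complex.I
      = Gxx z.re z.im + Gyy z.re z.im := by
  have hS1 : ContDiff ℝ 1 (fderiv ℝ S) := hS.fderiv_right (by norm_num)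
  have hSat : ∀ z, HasFDerivAt S (fderiv ℝ S z) z := fun z =>
    (hS.differentiable (by norm_num) z).hasFDerivAt
  have hS1at : ∀ z, HasFDerivAt (fderiv ℝ S) (fderiv ℝ (fderiv ℝ S) z) z := fun z =>
    (hS1.differentiable (by norm_num) z).hasFDerivAt
  have g1 : ∀ z : ℂ, HasDerivAt (fun t : ℝ => (t : ℂ) + z.im * Complex.I) 1 z.re := fun z => by
    simpa using (Complex.ofRealCLM.hasDerivAt (x := z.re)).add_const (z.im * Complex.I)
  have g2 : ∀ z : ℂ, HasDerivAt (fun t : ℝ => (z.re : ℂ) + t * Complex.I) Complex.I z.im :=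
    fun z => by
    simpa using ((Complex.ofRealCLM.hasDerivAt (x := z.im)).mul_const Complex.I).const_add (z.re : ℂ)
  have k1 : ∀ z, fderiv ℝ S z 1 = Gx z.re z.im := fun z => by
    have h1 := (hSat ((z.re : ℂ) + z.im * Complex.I)).comp_hasDerivAt z.re (g1 z)
    have h2 : HasDerivAt (fun t : ℝ => S ((t : ℂ) + z.im * Complex.I)) (Gx z.re z.im) z.re := by
      have := hx z.re z.im
      simpa [hG] using this
    have := h1.unique h2
    rwa [Complex.re_add_im] at this
  have k2 : ∀ z, fderiv ℝ S z Complex.I = Gy z.re z.im := fun z => by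
    have h1 := (hSat ((z.re : ℂ) + z.im * Complex.I)).comp_hasDerivAt z.im (g2 z)
    have h2 : HasDerivAt (fun t : ℝ => S ((z.re : ℂ) + t * Complex.I)) (Gy z.re z.im) z.im := by
      have := hy z.re z.im
      simpa [hG] using this
    have := h1.unique h2
    rwa [Complex.re_add_im] at this
  have hz : HasFDerivAt (fderiv ℝ S) (fderiv ℝ (fderiv ℝ S) z)
      ((z.re : ℂ) + z.im * Complex.I) := by
    rw [Complex.re_add_im]; exact hS1at z
  have a1 : fderiv ℝ (fderiv ℝ S) z 1 1 = Gxx z.re z.im := by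
    have h1 : HasDerivAt (fun t : ℝ => fderiv ℝ S ((t : ℂ) + z.im * Complex.I) 1)
        (fderiv ℝ (fderiv ℝ S) z 1 1) z.re :=
      (ContinuousLinearMap.apply ℝ ℝ (1:ℂ)).hasFDerivAt.comp_hasDerivAt z.re
        (hz.comp_hasDerivAt z.re (g1 z))
    have h3 : (fun t : ℝ => fderiv ℝ S ((t : ℂ) + z.im * Complex.I) 1) = fun t => Gx t z.im := by
      funext t; rw [k1]; simp
    rw [h3] at h1
    exact h1.unique (hxx _ _)
  have a2 : fderiv ℝ (fderiv ℝ S) z Complex.I Complex.I = Gyy z.re z.im := by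
    have h1 : HasDerivAt (fun t : ℝ => fderiv ℝ S ((z.re : ℂ) + t * Complex.I) Complex.I)
        (fderiv ℝ (fderiv ℝ S) z Complex.I Complex.I) z.im :=
      (ContinuousLinearMap.apply ℝ ℝ Complex.I).hasFDerivAt.comp_hasDerivAt z.im
        (hz.comp_hasDerivAt z.im (g2 z))
    have h3 : (fun t : ℝ => fderiv ℝ S ((z.re : ℂ) + t * Complex.I) Complex.I)
        = fun t => Gy z.re t := by
      funext t; rw [k2]; simp
    rw [h3] at h1
    exact h1.unique (hyy _ _)
  rw [a1, a2]

lemma rs_dpow (a : ℝ) (g : ℝ → ℝ) (g' x : ℝ) (hg : HasDerivAt g g' x) (h0 : 0 < g x) :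
    HasDerivAt (fun t => g t ^ a) (a * g x ^ (a - 1) * g') x := by
  convert hg.rpow_const (p := a) (Or.inl h0.ne') using 1
  ring

lemma rs_case1 (p : ℝ) (hp : 1 < p) (hp2 : p ≤ 2) (ε : ℝ) (hε : 0 < ε)
    (f : ℂ → ℂ) (R : ℝ) (hR : 1 < R) (hf : DifferentiableOn ℂ f (Metric.ball 0 R))
    (h0 : (f 0).im = 0) :
    ∫ θ in (0:ℝ)..2 * π, (((f (Complex.exp (θ * Complex.I))).re ^ 2
        + (f (Complex.exp (θ * Complex.I))).im ^ 2 + ε) ^ (p / 2)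
        - (2 / (p - 1)) * ((f (Complex.exp (θ * Complex.I))).re ^ 2 + ε) ^ (p / 2)) ≤ 0 := by
  obtain ⟨a, ha⟩ : ∃ a, a = p / 2 := ⟨_, rfl⟩
  obtain ⟨M, hM⟩ : ∃ M, M = 2 / (p - 1) := ⟨_, rfl⟩
  have hM1 : M * (2 * a - 1) = 2 := by
    rw [hM, ha]; field_simp [show p - 1 ≠ 0 by linarith]
  have hM2 : 1 ≤ M := by rw [hM, le_div_iff₀ (by linarith)]; linarith
  rw [← ha, ← hM]
  set S : ℂ → ℝ := fun z => (z.re ^ 2 + z.im ^ 2 + ε) ^ a - M * (z.re ^ 2 + ε) ^ a with hSdef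
  have hre : ContDiff ℝ 2 Complex.re := Complex.reCLM.contDiff
  have him : ContDiff ℝ 2 Complex.im := Complex.imCLM.contDiff
  have hS : ContDiff ℝ 2 S := by
    refine ContDiff.sub ?_ (contDiff_const.mul ?_)
    · exact ContDiff.rpow_const_of_ne (((hre.pow 2).add (him.pow 2)).add contDiff_const)
        (fun z => by positivity)
    · exact ContDiff.rpow_const_of_ne ((hre.pow 2).add contDiff_const) (fun z => by positivity)
  have dx : ∀ x y : ℝ, HasDerivAt (fun t : ℝ => t ^ 2 + y ^ 2 + ε) (2 * x) x := fun x y => by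
    simpa using (((hasDerivAt_id x).pow 2).add_const (y ^ 2)).add_const ε
  have dy : ∀ x y : ℝ, HasDerivAt (fun t : ℝ => x ^ 2 + t ^ 2 + ε) (2 * y) y := fun x y => by
    simpa using (((hasDerivAt_id y).pow 2).const_add (x ^ 2)).add_const ε
  have dv : ∀ x : ℝ, HasDerivAt (fun t : ℝ => t ^ 2 + ε) (2 * x) x := fun x => by
    simpa using ((hasDerivAt_id x).pow 2).add_const ε
  have d2 : ∀ x : ℝ, HasDerivAt (fun t : ℝ => 2 * t) 2 x := fun x => by
    simpa using (hasDerivAt_id x).const_mul 2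
  have hlap := rs_lap S hS (fun x y => (x ^ 2 + y ^ 2 + ε) ^ a - M * (x ^ 2 + ε) ^ a)
    (fun x y => a * (x ^ 2 + y ^ 2 + ε) ^ (a - 1) * (2 * x)
      - M * (a * (x ^ 2 + ε) ^ (a - 1) * (2 * x)))
    (fun x y => a * (x ^ 2 + y ^ 2 + ε) ^ (a - 1) * (2 * y))
    (fun x y => (a * ((a - 1) * (x ^ 2 + y ^ 2 + ε) ^ (a - 1 - 1) * (2 * x)) * (2 * x)
        + a * (x ^ 2 + y ^ 2 + ε) ^ (a - 1) * 2)
      - M * (a * ((a - 1) * (x ^ 2 + ε) ^ (a - 1 - 1) * (2 * x)) * (2 * x)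
        + a * (x ^ 2 + ε) ^ (a - 1) * 2))
    (fun x y => a * ((a - 1) * (x ^ 2 + y ^ 2 + ε) ^ (a - 1 - 1) * (2 * y)) * (2 * y)
        + a * (x ^ 2 + y ^ 2 + ε) ^ (a - 1) * 2)
    (fun z => rfl)
    (fun x y => (rs_dpow a _ _ x (dx x y) (by positivity)).sub
      ((rs_dpow a _ _ x (dv x) (by positivity)).const_mul M))
    (fun x y => (rs_dpow a _ _ y (dy x y) (by positivity)).sub_const (M * (x ^ 2 + ε) ^ a))
    (fun x y => (((rs_dpow (a-1) _ _ x (dx x y) (by positivity)).const_mul a).mul (d2 x)).sub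
      ((((rs_dpow (a-1) _ _ x (dv x) (by positivity)).const_mul a).mul (d2 x)).const_mul M))
    (fun x y => (((rs_dpow (a-1) _ _ y (dy x y) (by positivity)).const_mul a).mul (d2 y)))
  have key := rs_mean S hS (fun z => by
    rw [hlap]
    obtain ⟨x, y⟩ := z
    simp only
    have ha1 : a - 1 ≤ 0 := by linarith
    have ha0 : 0 < a := by linarith
    have hv : 0 < x ^ 2 + ε := by positivity
    have hw : 0 < x ^ 2 + y ^ 2 + ε := by positivity
    have e1 : (x ^ 2 + ε) ^ (a - 1) = (x ^ 2 + ε) ^ (a - 1 - 1) * (x ^ 2 + ε) := by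
      rw [← Real.rpow_add_one hv.ne']; congr 1; ring
    have m1 : (x ^ 2 + y ^ 2 + ε) ^ (a - 1) ≤ (x ^ 2 + ε) ^ (a - 1) :=
      Real.rpow_le_rpow_of_nonpos hv (by nlinarith [sq_nonneg y]) ha1
    have k1 : 0 < (x ^ 2 + ε) ^ (a - 1 - 1) := by positivity
    have k2 : 0 < (x ^ 2 + y ^ 2 + ε) ^ (a - 1 - 1) := by positivity
    rw [e1] at m1 ⊢
    generalize (x ^ 2 + ε) ^ (a - 1 - 1) = V at *
    generalize (x ^ 2 + y ^ 2 + ε) ^ (a - 1 - 1) = W at *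
    generalize (x ^ 2 + y ^ 2 + ε) ^ (a - 1) = W1 at *
    have t1 : a * (a - 1) * W * (x ^ 2 + y ^ 2) ≤ 0 :=
      mul_nonpos_of_nonpos_of_nonneg (mul_nonpos_of_nonpos_of_nonneg
        (mul_nonpos_of_nonneg_of_nonpos ha0.le ha1) k2.le) (by positivity)
    have t2 : a * W1 ≤ a * (V * (x ^ 2 + ε)) := mul_le_mul_of_nonneg_left m1 ha0.le
    have t3 : 0 ≤ M * a * V * ((1 - a) * ε) := by
      have : 0 ≤ 1 - a := by linarith
      positivity
    have t4 : M * (2 * a - 1) * (a * V * (x ^ 2 + ε)) = 2 * (a * V * (x ^ 2 + ε)) := by rw [hM1]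
    nlinarith [t1, t2, t3, t4]) f R hR hf
  refine key.trans ?_
  simp only [hSdef, h0]
  have : 0 ≤ ((f 0).re ^ 2 + ε) ^ a := by positivity
  have hpi := Real.pi_pos
  have e : (f 0).re ^ 2 + 0 ^ 2 + ε = (f 0).re ^ 2 + ε := by ring
  rw [e]
  refine mul_nonpos_of_nonneg_of_nonpos (by positivity) ?_
  nlinarith

lemma rs_case2 (q : ℝ) (hq : 0 ≤ q) (ε : ℝ) (hε : 0 < ε)
    (f : ℂ → ℂ) (R : ℝ) (hR : 1 < R) (hf : DifferentiableOn ℂ f (Metric.ball 0 R))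
    (h0 : (f 0).im = 0) :
    ∫ θ in (0:ℝ)..2 * π, (((f (Complex.exp (θ * Complex.I))).re ^ 2
        + (f (Complex.exp (θ * Complex.I))).im ^ 2 + ε) ^ (q + 1)
        - (2 * (q + 1) ^ 2) * (((f (Complex.exp (θ * Complex.I))).re ^ 2 + ε) *
        ((f (Complex.exp (θ * Complex.I))).re ^ 2
        + (f (Complex.exp (θ * Complex.I))).im ^ 2 + ε) ^ q)) ≤ 0 := by
  obtain ⟨B, hB⟩ : ∃ B, B = 2 * (q + 1) ^ 2 := ⟨_, rfl⟩
  have hB1 : 1 ≤ B := by rw [hB]; nlinarith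
  rw [← hB]
  set S : ℂ → ℝ := fun z => (z.re ^ 2 + z.im ^ 2 + ε) ^ (q + 1)
    - B * ((z.re ^ 2 + ε) * (z.re ^ 2 + z.im ^ 2 + ε) ^ q) with hSdef
  have hre : ContDiff ℝ 2 Complex.re := Complex.reCLM.contDiff
  have him : ContDiff ℝ 2 Complex.im := Complex.imCLM.contDiff
  have hS : ContDiff ℝ 2 S := by
    refine ContDiff.sub ?_ (contDiff_const.mul (((hre.pow 2).add contDiff_const).mul ?_)) <;>
    · exact ContDiff.rpow_const_of_ne (((hre.pow 2).add (him.pow 2)).add contDiff_const)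
        (fun z => by positivity)
  have dx : ∀ x y : ℝ, HasDerivAt (fun t : ℝ => t ^ 2 + y ^ 2 + ε) (2 * x) x := fun x y => by
    simpa using (((hasDerivAt_id x).pow 2).add_const (y ^ 2)).add_const ε
  have dy : ∀ x y : ℝ, HasDerivAt (fun t : ℝ => x ^ 2 + t ^ 2 + ε) (2 * y) y := fun x y => by
    simpa using (((hasDerivAt_id y).pow 2).const_add (x ^ 2)).add_const ε
  have dv : ∀ x : ℝ, HasDerivAt (fun t : ℝ => t ^ 2 + ε) (2 * x) x := fun x => by
    simpa using ((hasDerivAt_id x).pow 2).add_const ε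
  have d2 : ∀ x : ℝ, HasDerivAt (fun t : ℝ => 2 * t) 2 x := fun x => by
    simpa using (hasDerivAt_id x).const_mul 2
  have hlap := rs_lap S hS
    (fun x y => (x ^ 2 + y ^ 2 + ε) ^ (q + 1) - B * ((x ^ 2 + ε) * (x ^ 2 + y ^ 2 + ε) ^ q))
    (fun x y => (q + 1) * (x ^ 2 + y ^ 2 + ε) ^ q * (2 * x)
      - B * ((2 * x) * (x ^ 2 + y ^ 2 + ε) ^ q
        + (x ^ 2 + ε) * (q * (x ^ 2 + y ^ 2 + ε) ^ (q - 1) * (2 * x))))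
    (fun x y => (q + 1) * (x ^ 2 + y ^ 2 + ε) ^ q * (2 * y)
      - B * ((x ^ 2 + ε) * (q * (x ^ 2 + y ^ 2 + ε) ^ (q - 1) * (2 * y))))
    (fun x y => ((q + 1) * (q * (x ^ 2 + y ^ 2 + ε) ^ (q - 1) * (2 * x)) * (2 * x)
        + (q + 1) * (x ^ 2 + y ^ 2 + ε) ^ q * 2)
      - B * ((2 * (x ^ 2 + y ^ 2 + ε) ^ q + (2 * x) * (q * (x ^ 2 + y ^ 2 + ε) ^ (q - 1) * (2 * x)))
        + ((2 * x) * (q * (x ^ 2 + y ^ 2 + ε) ^ (q - 1) * (2 * x))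
        + (x ^ 2 + ε) * (q * ((q - 1) * (x ^ 2 + y ^ 2 + ε) ^ (q - 1 - 1) * (2 * x)) * (2 * x)
          + q * (x ^ 2 + y ^ 2 + ε) ^ (q - 1) * 2))))
    (fun x y => ((q + 1) * (q * (x ^ 2 + y ^ 2 + ε) ^ (q - 1) * (2 * y)) * (2 * y)
        + (q + 1) * (x ^ 2 + y ^ 2 + ε) ^ q * 2)
      - B * ((x ^ 2 + ε) * (q * ((q - 1) * (x ^ 2 + y ^ 2 + ε) ^ (q - 1 - 1) * (2 * y)) * (2 * y)
          + q * (x ^ 2 + y ^ 2 + ε) ^ (q - 1) * 2)))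
    (fun z => rfl)
    (fun x y => by
      have h1 := rs_dpow (q + 1) _ _ x (dx x y) (by positivity)
      rw [add_sub_cancel_right] at h1
      exact h1.sub (((dv x).mul (rs_dpow q _ _ x (dx x y) (by positivity))).const_mul B))
    (fun x y => by
      have h1 := rs_dpow (q + 1) _ _ y (dy x y) (by positivity)
      rw [add_sub_cancel_right] at h1
      exact h1.sub (((rs_dpow q _ _ y (dy x y) (by positivity)).const_mul (x ^ 2 + ε)).const_mul
        B))
    (fun x y => by
      have h1 := rs_dpow q _ _ x (dx x y) (by positivity)
      have h2 := rs_dpow (q - 1) _ _ x (dx x y) (by positivity)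
      exact ((h1.const_mul (q + 1)).mul (d2 x)).sub
        ((((d2 x).mul h1).add ((dv x).mul ((h2.const_mul q).mul (d2 x)))).const_mul B))
    (fun x y => by
      have h1 := rs_dpow q _ _ y (dy x y) (by positivity)
      have h2 := rs_dpow (q - 1) _ _ y (dy x y) (by positivity)
      exact ((h1.const_mul (q + 1)).mul (d2 y)).sub
        ((((h2.const_mul q).mul (d2 y)).const_mul (x ^ 2 + ε)).const_mul B))
  have key := rs_mean S hS (fun z => by
    rw [hlap]
    obtain ⟨x, y⟩ := z
    simp only
    obtain ⟨w, hwd⟩ : ∃ w, w = x ^ 2 + y ^ 2 + ε := ⟨_, rfl⟩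
    rw [← hwd]
    have hw : 0 < w := by rw [hwd]; positivity
    have e1 : w ^ (q - 1) = w ^ (q - 1 - 1) * w := by
      rw [← Real.rpow_add_one hw.ne']; congr 1; ring
    have e2 : w ^ q = w ^ (q - 1 - 1) * w * w := by
      rw [← e1, ← Real.rpow_add_one hw.ne']; congr 1; ring
    have k1 : 0 < w ^ (q - 1 - 1) := by positivity
    rw [e2, e1]
    generalize w ^ (q - 1 - 1) = k at *
    have t0 : ∀ T : ℝ, T ≤ 0 → k * T ≤ 0 := fun T hT =>
      mul_nonpos_of_nonneg_of_nonpos k1.le hT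
    have hB0 : 0 < B := by linarith
    have hxyw : 0 ≤ w - (x ^ 2 + y ^ 2) := by rw [hwd]; linarith
    have s1 : 0 ≤ B * (q * (x ^ 2 * w)) := by positivity
    have s2 : 0 ≤ B * ((x ^ 2 + ε) * (q * (w - (x ^ 2 + y ^ 2)))) := by positivity
    have s3 : 0 ≤ B * ((x ^ 2 + ε) * (q * (q * (x ^ 2 + y ^ 2)))) := by positivity
    have s4 : 0 ≤ (q + 1) * q * w * (w - (x ^ 2 + y ^ 2)) := by positivity
    refine le_trans (le_of_eq ?_) (t0 ((q + 1) * (4 * w ^ 2 + 4 * q * (x ^ 2 + y ^ 2) * w)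
      - B * (2 * w ^ 2 + 8 * q * x ^ 2 * w
        + (x ^ 2 + ε) * q * (4 * w + 4 * (q - 1) * (x ^ 2 + y ^ 2)))) ?_)
    · ring
    · have : B * (2 * w ^ 2) = 4 * (q + 1) ^ 2 * w ^ 2 := by rw [hB]; ring
      nlinarith [s1, s2, s3, s4, this]) f R hR hf
  refine key.trans ?_
  simp only [hSdef, h0]
  have hv : 0 < (f 0).re ^ 2 + ε := by positivity
  have : 0 ≤ ((f 0).re ^ 2 + ε) ^ (q + 1) := by positivity
  have hpi := Real.pi_pos
  have e : (f 0).re ^ 2 + 0 ^ 2 + ε = (f 0).re ^ 2 + ε := by ring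
  rw [e, mul_comm ((f 0).re ^ 2 + ε), ← Real.rpow_add_one hv.ne']
  refine mul_nonpos_of_nonneg_of_nonpos (by positivity) ?_
  nlinarith

lemma rs_circ_cont (f : ℂ → ℂ) (R : ℝ) (hR : 1 < R)
    (hf : DifferentiableOn ℂ f (Metric.ball 0 R)) :
    Continuous (fun θ : ℝ => f (Complex.exp (θ * Complex.I))) := by
  refine hf.continuousOn.comp_continuous (by fun_prop) (fun θ => ?_)
  rw [mem_ball_zero_iff, Complex.norm_exp_ofReal_mul_I]; exact hR

lemma rs_disc_eps (p : ℝ) (hp : 1 < p) : ∃ K : ℝ, 0 < K ∧ ∀ (f : ℂ → ℂ) (R : ℝ), 1 < R →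
    DifferentiableOn ℂ f (Metric.ball 0 R) → (f 0).im = 0 → ∀ ε : ℝ, 0 < ε →
    ∫ θ in (0:ℝ)..2 * π, ((f (Complex.exp (θ * Complex.I))).re ^ 2
        + (f (Complex.exp (θ * Complex.I))).im ^ 2 + ε) ^ (p / 2) ≤
    K * ∫ θ in (0:ℝ)..2 * π, ((f (Complex.exp (θ * Complex.I))).re ^ 2 + ε) ^ (p / 2) := by
  have hpi := Real.pi_pos
  rcases le_total p 2 with hp2 | hp2
  · refine ⟨2 / (p - 1), div_pos two_pos (by linarith), fun f R hR hf h0 ε hε => ?_⟩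
    have h := rs_case1 p hp hp2 ε hε f R hR hf h0
    have c := rs_circ_cont f R hR hf
    have cre := Complex.continuous_re.comp c
    have cim := Complex.continuous_im.comp c
    have c1 : Continuous (fun θ : ℝ => ((f (Complex.exp (θ * Complex.I))).re ^ 2
        + (f (Complex.exp (θ * Complex.I))).im ^ 2 + ε) ^ (p / 2)) :=
      (((cre.pow 2).add (cim.pow 2)).add continuous_const).rpow_const
        (fun θ => Or.inr (by linarith))
    have c2 : Continuous (fun θ : ℝ => ((f (Complex.exp (θ * Complex.I))).re ^ 2 + ε) ^ (p / 2)) :=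
      ((cre.pow 2).add continuous_const).rpow_const (fun θ => Or.inr (by linarith))
    rw [intervalIntegral.integral_sub (c1.intervalIntegrable _ _)
      ((c2.intervalIntegrable _ _).const_mul _), intervalIntegral.integral_const_mul] at h
    linarith
  · obtain ⟨q, hq⟩ : ∃ q, q = p / 2 - 1 := ⟨_, rfl⟩
    have hq0 : 0 ≤ q := by linarith
    have hpq : p / 2 = q + 1 := by linarith
    obtain ⟨B, hB⟩ : ∃ B, B = 2 * (q + 1) ^ 2 := ⟨_, rfl⟩
    have hB0 : 0 < B := by rw [hB]; positivity
    refine ⟨2 * (B * (2 * B) ^ q), by positivity, fun f R hR hf h0 ε hε => ?_⟩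
    rw [hpq]
    have h := rs_case2 q hq0 ε hε f R hR hf h0
    rw [← hB] at h
    have c := rs_circ_cont f R hR hf
    have cre := Complex.continuous_re.comp c
    have cim := Complex.continuous_im.comp c
    have cw := (((cre.pow 2).add (cim.pow 2)).add (continuous_const (y := ε)))
    have cv := (cre.pow 2).add (continuous_const (y := ε))
    have c1 : Continuous (fun θ : ℝ => ((f (Complex.exp (θ * Complex.I))).re ^ 2
        + (f (Complex.exp (θ * Complex.I))).im ^ 2 + ε) ^ (q + 1)) :=
      cw.rpow_const (fun θ => Or.inr (by linarith))
    have c3 : Continuous (fun θ : ℝ => ((f (Complex.exp (θ * Complex.I))).re ^ 2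
        + (f (Complex.exp (θ * Complex.I))).im ^ 2 + ε) ^ q) :=
      cw.rpow_const (fun θ => Or.inr (by linarith))
    have c2 : Continuous (fun θ : ℝ => ((f (Complex.exp (θ * Complex.I))).re ^ 2 + ε) ^ (q + 1)) :=
      cv.rpow_const (fun θ => Or.inr (by linarith))
    have hmono : ∫ θ in (0:ℝ)..2 * π, ((1 / 2) * ((f (Complex.exp (θ * Complex.I))).re ^ 2
        + (f (Complex.exp (θ * Complex.I))).im ^ 2 + ε) ^ (q + 1)
        - (B * (2 * B) ^ q) * ((f (Complex.exp (θ * Complex.I))).re ^ 2 + ε) ^ (q + 1)) ≤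
        ∫ θ in (0:ℝ)..2 * π, (((f (Complex.exp (θ * Complex.I))).re ^ 2
        + (f (Complex.exp (θ * Complex.I))).im ^ 2 + ε) ^ (q + 1)
        - B * (((f (Complex.exp (θ * Complex.I))).re ^ 2 + ε) *
        ((f (Complex.exp (θ * Complex.I))).re ^ 2
        + (f (Complex.exp (θ * Complex.I))).im ^ 2 + ε) ^ q)) := by
      refine intervalIntegral.integral_mono_on (by positivity) ?_ ?_ ?_
      · exact ((c1.const_mul _).sub (c2.const_mul _)).intervalIntegrable _ _
      · exact (c1.sub ((cv.mul c3).const_mul B)).intervalIntegrable _ _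
      intro θ _
      generalize f (Complex.exp (θ * Complex.I)) = z
      obtain ⟨x, y⟩ := z
      simp only
      have hv : 0 < x ^ 2 + ε := by positivity
      have hw : 0 < x ^ 2 + y ^ 2 + ε := by positivity
      generalize x ^ 2 + y ^ 2 + ε = w at *
      generalize x ^ 2 + ε = v at *
      have e1 : w ^ (q + 1) = w ^ q * w := Real.rpow_add_one hw.ne' q
      have e2 : v ^ (q + 1) = v ^ q * v := Real.rpow_add_one hv.ne' q
      have p1 : 0 < w ^ q := by positivity
      have p2 : 0 < v ^ q := by positivity
      have p3 : 0 < (2 * B) ^ q := by positivity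
      rcases le_total (B * v) (w / 2) with hc | hc
      · have t1 := mul_le_mul_of_nonneg_right hc p1.le
        have t2 : 0 < B * (2 * B) ^ q * v ^ (q + 1) := by positivity
        rw [e1]
        nlinarith
      · have t1 : w ^ q ≤ (2 * B * v) ^ q := Real.rpow_le_rpow hw.le (by linarith) hq0
        rw [Real.mul_rpow (by positivity) hv.le] at t1
        have t2 := mul_le_mul_of_nonneg_left t1 (show 0 ≤ B * v by positivity)
        have t3 : 0 < w ^ (q + 1) := by positivity
        rw [e2]
        nlinarith
    rw [intervalIntegral.integral_sub ((c1.intervalIntegrable _ _).const_mul _)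
      ((c2.intervalIntegrable _ _).const_mul _), intervalIntegral.integral_const_mul,
      intervalIntegral.integral_const_mul] at hmono
    linarith

lemma rs_disc (p : ℝ) (hp : 1 < p) : ∃ K : ℝ, 0 < K ∧ ∀ (f : ℂ → ℂ) (R : ℝ), 1 < R →
    DifferentiableOn ℂ f (Metric.ball 0 R) → (f 0).im = 0 →
    ∫ θ in (0:ℝ)..2 * π, ‖f (Complex.exp (θ * Complex.I))‖ ^ p ≤
    K * ∫ θ in (0:ℝ)..2 * π, |(f (Complex.exp (θ * Complex.I))).re| ^ p := by
  obtain ⟨K, hK, H⟩ := rs_disc_eps p hp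
  refine ⟨K, hK, fun f R hR hf h0 => ?_⟩
  have c := rs_circ_cont f R hR hf
  have cre := Complex.continuous_re.comp c
  have cim := Complex.continuous_im.comp c
  have l1 : Continuous (fun ε : ℝ => ∫ θ in (0:ℝ)..2 * π,
      ((f (Complex.exp (θ * Complex.I))).re ^ 2
        + (f (Complex.exp (θ * Complex.I))).im ^ 2 + ε) ^ (p / 2)) := by
    apply intervalIntegral.continuous_parametric_intervalIntegral_of_continuous'
    exact ((((cre.comp continuous_snd).pow 2).add ((cim.comp continuous_snd).pow 2)).add
      continuous_fst).rpow_const (fun θ => Or.inr (by linarith))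
  have l2 : Continuous (fun ε : ℝ => K * ∫ θ in (0:ℝ)..2 * π,
      ((f (Complex.exp (θ * Complex.I))).re ^ 2 + ε) ^ (p / 2)) := by
    refine Continuous.const_mul ?_ K
    apply intervalIntegral.continuous_parametric_intervalIntegral_of_continuous'
    exact (((cre.comp continuous_snd).pow 2).add
      continuous_fst).rpow_const (fun θ => Or.inr (by linarith))
  have h := le_of_tendsto_of_tendsto ((l1.tendsto 0).mono_left nhdsWithin_le_nhds)
    ((l2.tendsto 0).mono_left nhdsWithin_le_nhds)
    (Filter.eventually_of_mem (self_mem_nhdsWithin (s := Ioi (0:ℝ))) (H f R hR hf h0))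
  have e2 : ∀ a : ℝ, 0 ≤ a → (a ^ 2) ^ (p / 2) = a ^ p := fun a ha => by
    rw [← Real.rpow_natCast, ← Real.rpow_mul ha]; congr 1; push_cast; ring
  have e1 : ∀ z : ℂ, (z.re ^ 2 + z.im ^ 2 + 0) ^ (p / 2) = ‖z‖ ^ p := fun z => by
    rw [← e2 _ (norm_nonneg z), Complex.sq_norm, Complex.normSq_apply]; ring_nf
  have e3 : ∀ z : ℂ, (z.re ^ 2 + 0) ^ (p / 2) = |z.re| ^ p := fun z => by
    rw [← e2 _ (abs_nonneg _), sq_abs, add_zero]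
  simpa only [e1, e3] using h

section sphere
variable {E : Type*} [NormedAddCommGroup E] [NormedSpace ℂ E] [ProperSpace E]
  [MeasurableSpace E] [BorelSpace E]

lemma rs_integrable (μ : Measure E) [IsFiniteMeasure μ] (z₀ : E) (r : ℝ)
    (hsupp : μ.restrict (Metric.sphere z₀ r) = μ)
    (g : E → ℝ) (hg : ContinuousOn g (Metric.sphere z₀ r)) :
    Integrable (fun x : ℝ × E => g (z₀ + Complex.exp (x.1 * Complex.I) • (x.2 - z₀)))
      ((volume.restrict (Ioc 0 (2 * π))).prod μ) := by
  have hK : IsCompact (Icc (0:ℝ) (2 * π) ×ˢ Metric.sphere z₀ r) :=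
    isCompact_Icc.prod (isCompact_sphere z₀ r)
  have hc : ContinuousOn (fun x : ℝ × E => g (z₀ + Complex.exp (x.1 * Complex.I) • (x.2 - z₀)))
      (Icc (0:ℝ) (2 * π) ×ˢ Metric.sphere z₀ r) := by
    refine hg.comp (Continuous.continuousOn (by fun_prop)) ?_
    intro x hx
    have := hx.2
    rw [mem_sphere_iff_norm] at this ⊢
    rw [add_sub_cancel_left, norm_smul, Complex.norm_exp_ofReal_mul_I, one_mul, this]
  have hi : IntegrableOn (fun x : ℝ × E => g (z₀ + Complex.exp (x.1 * Complex.I) • (x.2 - z₀)))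
      (Icc (0:ℝ) (2 * π) ×ˢ Metric.sphere z₀ r) (volume.prod μ) :=
    hc.integrableOn_compact hK
  have hi2 := hi.mono_set (Set.prod_mono (Ioc_subset_Icc_self) (Subset.refl _))
  rw [IntegrableOn, ← Measure.prod_restrict, hsupp] at hi2
  exact hi2

lemma rs_fubini (μ : Measure E) [IsFiniteMeasure μ] (z₀ : E) (r : ℝ)
    (hsupp : μ.restrict (Metric.sphere z₀ r) = μ)
    (hinv : ∀ θ : ℝ, Measure.map (fun z => z₀ + Complex.exp (θ * Complex.I) • (z - z₀)) μ = μ)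
    (g : E → ℝ) (hg : ContinuousOn g (Metric.sphere z₀ r)) :
    ∫ z, (∫ θ in (0:ℝ)..2 * π, g (z₀ + Complex.exp (θ * Complex.I) • (z - z₀))) ∂μ
      = 2 * π * ∫ z, g z ∂μ := by
  have hpi := Real.pi_pos
  have hI := rs_integrable μ z₀ r hsupp g hg
  have hgm : AEStronglyMeasurable g μ := by
    rw [← hsupp]
    exact hg.aestronglyMeasurable Metric.isClosed_sphere.measurableSet
  simp only [intervalIntegral.integral_of_le (show (0:ℝ) ≤ 2 * π by positivity)]
  rw [← integral_integral_swap hI]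
  have : ∀ θ : ℝ, ∫ z, g (z₀ + Complex.exp (θ * Complex.I) • (z - z₀)) ∂μ = ∫ z, g z ∂μ := by
    intro θ
    have hm : Measurable (fun z : E => z₀ + Complex.exp (θ * Complex.I) • (z - z₀)) :=
      Continuous.measurable (by fun_prop)
    conv_rhs => rw [← hinv θ]
    rw [integral_map hm.aemeasurable (by rw [hinv θ]; exact hgm)]
  simp only [this]
  rw [setIntegral_const]
  simp [Measure.real, hpi.le]

lemma rs_map (d : ℝ) (z₀ : E) (r : ℝ) (c : ENNReal) (θ : ℝ) :
    Measure.map (fun z => z₀ + Complex.exp (θ * Complex.I) • (z - z₀))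
      (c • (μH[d] : Measure E).restrict (Metric.sphere z₀ r))
      = c • (μH[d] : Measure E).restrict (Metric.sphere z₀ r) := by
  set φ : E → E := fun z => z₀ + Complex.exp (θ * Complex.I) • (z - z₀) with hφ
  have hn := Complex.norm_exp_ofReal_mul_I θ
  have hiso : Isometry φ := Isometry.of_dist_eq fun x y => by
    have e : φ x - φ y = Complex.exp (θ * Complex.I) • (x - y) := by
      simp only [hφ, add_sub_add_left_eq_sub, ← smul_sub, sub_sub_sub_cancel_right]
    rw [dist_eq_norm, e, norm_smul, hn, one_mul, dist_eq_norm]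
  have hsurj : Function.Surjective φ := fun y =>
    ⟨z₀ + (Complex.exp (θ * Complex.I))⁻¹ • (y - z₀), by
      simp [hφ, smul_smul, Complex.exp_ne_zero]⟩
  have hmp : MeasurePreserving φ (μH[d] : Measure E) μH[d] :=
    ⟨hiso.continuous.measurable, by
      rw [hiso.map_hausdorffMeasure (Or.inr hsurj), hsurj.range_eq, Measure.restrict_univ]⟩
  have hpre : φ ⁻¹' Metric.sphere z₀ r = Metric.sphere z₀ r := by
    ext z
    simp [hφ, mem_sphere_iff_norm, norm_smul, hn]
  have h2 := hmp.restrict_preimage (s := Metric.sphere z₀ r)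
    Metric.isClosed_sphere.measurableSet
  rw [hpre] at h2
  rw [Measure.map_smul, h2.map_eq]

lemma rs_main (p K : ℝ) (hp : 1 < p) (hK : ∀ (f : ℂ → ℂ) (R : ℝ), 1 < R →
    DifferentiableOn ℂ f (Metric.ball 0 R) → (f 0).im = 0 →
    ∫ θ in (0:ℝ)..2 * π, ‖f (Complex.exp (θ * Complex.I))‖ ^ p ≤
    K * ∫ θ in (0:ℝ)..2 * π, |(f (Complex.exp (θ * Complex.I))).re| ^ p)
    (μ : Measure E) [IsFiniteMeasure μ] (z₀ : E) (r : ℝ)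
    (hsupp : μ.restrict (Metric.sphere z₀ r) = μ)
    (hinv : ∀ θ : ℝ, Measure.map (fun z => z₀ + Complex.exp (θ * Complex.I) • (z - z₀)) μ = μ)
    (Ω : Set E) (hΩ : IsOpen Ω) (hsub : Metric.closedBall z₀ r ⊆ Ω)
    (f : E → ℂ) (hf : DifferentiableOn ℂ f Ω) (h0 : (f z₀).im = 0) :
    ∫ z, ‖f z‖ ^ p ∂μ ≤ K * ∫ z, |(f z).re| ^ p ∂μ := by
  have hpi := Real.pi_pos
  have hfc : ContinuousOn f (Metric.sphere z₀ r) :=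
    hf.continuousOn.mono (Metric.sphere_subset_closedBall.trans hsub)
  have hg1 : ContinuousOn (fun z => ‖f z‖ ^ p) (Metric.sphere z₀ r) :=
    hfc.norm.rpow_const (fun z _ => Or.inr (by linarith))
  have hg2 : ContinuousOn (fun z => |(f z).re| ^ p) (Metric.sphere z₀ r) :=
    (Complex.continuous_re.comp_continuousOn hfc).abs.rpow_const (fun z _ => Or.inr (by linarith))
  have F1 := rs_fubini μ z₀ r hsupp hinv _ hg1
  have F2 := rs_fubini μ z₀ r hsupp hinv _ hg2
  have I1 := (rs_integrable μ z₀ r hsupp _ hg1).integral_prod_right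
  have I2 := (rs_integrable μ z₀ r hsupp _ hg2).integral_prod_right
  simp only [← intervalIntegral.integral_of_le (show (0:ℝ) ≤ 2 * π by positivity)] at I1 I2
  have hle := integral_mono_ae I1 (I2.const_mul K) (by
    have hae : ∀ᵐ z ∂μ, z ∈ Metric.sphere z₀ r := by
      rw [← hsupp]
      exact ae_restrict_mem Metric.isClosed_sphere.measurableSet
    filter_upwards [hae] with z hz
    have hcont : Continuous (fun ζ : ℂ => z₀ + ζ • (z - z₀)) := by fun_prop
    have hopen : IsOpen ((fun ζ : ℂ => z₀ + ζ • (z - z₀)) ⁻¹' Ω) := hΩ.preimage hcont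
    have hcb : Metric.closedBall (0:ℂ) 1 ⊆ (fun ζ : ℂ => z₀ + ζ • (z - z₀)) ⁻¹' Ω := by
      intro ζ hζ
      apply hsub
      rw [mem_closedBall_zero_iff] at hζ
      rw [mem_sphere_iff_norm] at hz
      rw [mem_closedBall_iff_norm, add_sub_cancel_left, norm_smul, hz]
      have : 0 ≤ r := hz ▸ norm_nonneg _
      nlinarith
    obtain ⟨δ, hδ, hth⟩ := (isCompact_closedBall (0:ℂ) 1).exists_thickening_subset_open hopen hcb
    rw [thickening_closedBall hδ zero_le_one] at hth
    refine hK (fun ζ => f (z₀ + ζ • (z - z₀))) (δ + 1) (by linarith) ?_ (by simpa using h0)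
    exact hf.comp (Differentiable.differentiableOn (by fun_prop)) hth)
  rw [integral_const_mul, F1, F2] at hle
  have : 0 < 2 * π := by positivity
  nlinarith

end sphere

/-- **Sphere version of M. Riesz's theorem, `1 < p < ∞`** : there is a constant `C_p > 0`
depending only on `p` such that for every `n ≥ 1`, every open `Ω ⊆ ℂⁿ`, every closed ball
`closedBall z₀ r ⊆ Ω` (`r > 0`), and every holomorphic `f = u + iv` on `Ω` with `v z₀ = 0`,
`∫_{S(z₀,r)} |f|^p dσ ≤ C_p^p · ∫_{S(z₀,r)} |u|^p dσ`. -/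
theorem riesz_sphere (p : ℝ) (hp : 1 < p) :
    ∃ C : ℝ, 0 < C ∧
      ∀ (n : ℕ), 1 ≤ n → ∀ (Ω : Set (EuclideanSpace ℂ (Fin n))), IsOpen Ω →
        ∀ (z₀ : EuclideanSpace ℂ (Fin n)) (r : ℝ), 0 < r → Metric.closedBall z₀ r ⊆ Ω →
          ∀ f : EuclideanSpace ℂ (Fin n) → ℂ, DifferentiableOn ℂ f Ω → (f z₀).im = 0 →
            ∫ z, ‖f z‖ ^ p ∂(sphereUnifMeasure n z₀ r)
              ≤ C ^ p * ∫ z, |(f z).re| ^ p ∂(sphereUnifMeasure n z₀ r) := by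
  obtain ⟨K, hK, H⟩ := rs_disc p hp
  refine ⟨K ^ (1 / p), by positivity, fun n hn Ω hΩ z₀ r hr hsub f hf h0 => ?_⟩
  have hKp : (K ^ (1 / p)) ^ p = K := by
    rw [← Real.rpow_mul hK.le, one_div_mul_cancel (by linarith), Real.rpow_one]
  rw [hKp]
  have hfin : IsFiniteMeasure (sphereUnifMeasure n z₀ r) := ⟨by
    rw [sphereUnifMeasure, Measure.smul_apply, Measure.restrict_apply_univ, smul_eq_mul]
    exact (ENNReal.inv_mul_le_one _).trans_lt ENNReal.one_lt_top⟩
  refine rs_main p K hp H (sphereUnifMeasure n z₀ r) z₀ r ?_ ?_ Ω hΩ hsub f hf h0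
  · rw [sphereUnifMeasure, Measure.restrict_smul, Measure.restrict_restrict
      Metric.isClosed_sphere.measurableSet, inter_self]
  · exact fun θ => rs_map _ z₀ r _ θ
end

section
/- Let f = u + iv be holomorphic on the open unit disc 𝔻 ⊂ ℂ with |u| ≤ 1 on 𝔻 and v(0) = 0. Then for every α > 1 there exists a constant C_α > 0 depending only on α such that ∫₀^{2π} exp((π/2)·|f(r e^{iθ})|) / (1 + |f(r e^{iθ})|)^α dθ ≤ C_α for every 0 < r < 1. -/
open Real MeasureTheory Set

set_option maxHeartbeats 1000000 in
lemma zyg_pos (γ x y ψ P : ℝ) (hγ : 0 < γ) (hγ' : γ ≤ 1/2) (hx : 0 ≤ x) (hy : 0 ≤ y)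
    (hy' : y ≤ π/2) (hψ' : |ψ| ≤ π/2) (hP : 1 ≤ P) (hP' : P ≤ 7 + x^2)
    (hs : Real.sin ψ * P = 2 * x * y) :
    0 ≤ Real.cosh x * Real.cos y * Real.cos (γ*ψ) + Real.sinh x * Real.sin y * Real.sin (γ*ψ) ∧
    (1 ≤ x → Real.exp x ≤ 24/γ * (Real.sqrt P *
      (Real.cosh x * Real.cos y * Real.cos (γ*ψ) + Real.sinh x * Real.sin y * Real.sin (γ*ψ)))) := by
  have hpi := Real.pi_gt_three
  have hpi4 := Real.pi_le_four
  have hxy : 0 ≤ 2 * x * y := by positivity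
  have hψ2 := (abs_le.1 hψ').2
  have hψ1 := (abs_le.1 hψ').1
  have hψ : 0 ≤ ψ := by
    by_contra h
    push Not at h
    have := Real.sin_neg_of_neg_of_neg_pi_lt h (by linarith)
    nlinarith
  have hg : 0 ≤ γ * ψ := by positivity
  have hg1 : γ * ψ ≤ 1 := by nlinarith
  have hc : 1/2 ≤ Real.cos (γ*ψ) := by
    have := Real.one_sub_sq_div_two_le_cos (x := γ*ψ)
    nlinarith
  have hcy : 0 ≤ Real.cos y := Real.cos_nonneg_of_mem_Icc ⟨by linarith, hy'⟩
  have hsy : 0 ≤ Real.sin y := Real.sin_nonneg_of_nonneg_of_le_pi hy (by linarith)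
  have hsg : 0 ≤ Real.sin (γ*ψ) := Real.sin_nonneg_of_nonneg_of_le_pi hg (by linarith)
  have hsx : 0 ≤ Real.sinh x := Real.sinh_nonneg_iff.2 hx
  have hchx := Real.cosh_pos x
  have hA : 0 ≤ Real.cosh x * Real.cos y * Real.cos (γ*ψ) := by positivity
  have hB : 0 ≤ Real.sinh x * Real.sin y * Real.sin (γ*ψ) := by positivity
  refine ⟨by positivity, fun h1 => ?_⟩
  have hE := Real.exp_pos x
  have hsq1 : 1 ≤ Real.sqrt P := Real.one_le_sqrt.2 hP
  have key : γ / 24 * Real.exp x ≤ Real.sqrt P *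
      (Real.cosh x * Real.cos y * Real.cos (γ*ψ) + Real.sinh x * Real.sin y * Real.sin (γ*ψ)) := by
    rcases le_total y 1 with hy1 | hy1
    · have hcy2 : 1/2 ≤ Real.cos y := by
        have := Real.one_sub_sq_div_two_le_cos (x := y)
        nlinarith
      have hch : Real.exp x / 2 ≤ Real.cosh x := by
        rw [Real.cosh_eq]; have := Real.exp_pos (-x); linarith
      have : Real.exp x / 2 * (1/2) * (1/2) ≤ Real.cosh x * Real.cos y * Real.cos (γ*ψ) := by
        gcongr
      have h2 : γ / 24 * Real.exp x ≤ 1/8 * Real.exp x :=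
        mul_le_mul_of_nonneg_right (by linarith) hE.le
      nlinarith
    · have hsh : Real.exp x / 4 ≤ Real.sinh x := by
        rw [Real.sinh_eq]
        have h3 := Real.add_one_le_exp x
        have h4 : Real.exp (-x) ≤ 1 := Real.exp_le_one_iff.2 (by linarith)
        linarith
      have h2pi : 1/2 ≤ 2/π := by rw [div_le_div_iff₀ (by norm_num) (by linarith)]; linarith
      have hsy2 : 1/2 ≤ Real.sin y := by
        have := Real.mul_le_sin hy hy'
        nlinarith
      have hsg2 : 1/2 * (γ * ψ) ≤ Real.sin (γ*ψ) := by
        have := Real.mul_le_sin hg (by linarith)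
        nlinarith
      have hsp : Real.sqrt P * Real.sqrt P = P := Real.mul_self_sqrt (by linarith)
      have hs3 : Real.sqrt P ≤ 3 * x := by
        apply Real.sqrt_le_iff.2
        constructor
        · linarith
        · nlinarith
      have hψs : 2/3 ≤ ψ * Real.sqrt P := by
        have h5 : Real.sin ψ ≤ ψ := Real.sin_le hψ
        have h6 : 2 * x * y ≤ ψ * P := by
          rw [← hs]; exact mul_le_mul_of_nonneg_right h5 (by linarith)
        have h7 : 2 * x ≤ ψ * P :=
          le_trans (le_mul_of_one_le_right (by linarith) hy1) h6
        have h8 : 2/3 * Real.sqrt P ≤ ψ * Real.sqrt P * Real.sqrt P := by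
          rw [mul_assoc, hsp]; linarith
        exact le_of_mul_le_mul_right h8 (by linarith)
      have h9 : Real.exp x / 4 * (1/2) * (1/2 * (γ * ψ)) ≤
          Real.sinh x * Real.sin y * Real.sin (γ*ψ) := by gcongr
      have h10 : Real.sqrt P * (Real.exp x / 4 * (1/2) * (1/2 * (γ * ψ))) ≤ Real.sqrt P *
          (Real.cosh x * Real.cos y * Real.cos (γ*ψ)
            + Real.sinh x * Real.sin y * Real.sin (γ*ψ)) := by
        gcongr; linarith
      have h11 : Real.exp x * γ / 16 * (2/3) ≤ Real.exp x * γ / 16 * (ψ * Real.sqrt P) := by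
        gcongr
      linarith
  calc Real.exp x = 24/γ * (γ/24 * Real.exp x) := by field_simp
    _ ≤ _ := by gcongr

lemma zyg_all (γ x y ψ P : ℝ) (hγ : 0 < γ) (hγ' : γ ≤ 1/2)
    (hy' : |y| ≤ π/2) (hψ' : |ψ| ≤ π/2) (hP : 1 ≤ P) (hP' : P ≤ 7 + x^2)
    (hs : Real.sin ψ * P = 2 * x * y) :
    0 ≤ Real.cosh x * Real.cos y * Real.cos (γ*ψ) + Real.sinh x * Real.sin y * Real.sin (γ*ψ) ∧
    (1 ≤ |x| → Real.exp |x| ≤ 24/γ * (Real.sqrt P *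
      (Real.cosh x * Real.cos y * Real.cos (γ*ψ) + Real.sinh x * Real.sin y * Real.sin (γ*ψ)))) := by
  have hy1 := (abs_le.1 hy').1
  have hy2 := (abs_le.1 hy').2
  rcases le_total 0 x with hx | hx <;> rcases le_total 0 y with hy | hy
  · rw [abs_of_nonneg hx]
    exact zyg_pos γ x y ψ P hγ hγ' hx hy hy2 hψ' hP hP' hs
  · rw [abs_of_nonneg hx]
    have := zyg_pos γ x (-y) (-ψ) P hγ hγ' hx (by linarith) (by linarith) (by rwa [abs_neg]) hP hP'
      (by rw [Real.sin_neg]; linarith)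
    simpa using this
  · rw [abs_of_nonpos hx]
    have := zyg_pos γ (-x) y (-ψ) P hγ hγ' (by linarith) hy hy2 (by rwa [abs_neg]) hP (by simpa using hP')
      (by rw [Real.sin_neg]; linarith)
    simpa using this
  · rw [abs_of_nonpos hx]
    have := zyg_pos γ (-x) (-y) ψ P hγ hγ' (by linarith) (by linarith) (by linarith) hψ' hP
      (by simpa using hP') (by linarith)
    simpa using this

lemma zyg_p (s : ℂ) (h : |s.im| ≤ π/2) :
    1 ≤ (4 + s^2).re ∧ 1 ≤ ‖4 + s^2‖ ∧ ‖4 + s^2‖ ≤ 7 + s.re^2 ∧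
      (4 + s^2).im = 2 * s.re * s.im := by
  have hpi : π < 3.15 := Real.pi_lt_d2
  have h1 : s.im^2 ≤ 2.5 := by
    have h2 : s.im^2 ≤ (π/2)^2 := by
      rw [← sq_abs]; gcongr
    have := Real.pi_pos
    nlinarith
  have hre : (4 + s^2).re = 4 + s.re^2 - s.im^2 := by
    simp [pow_two]; ring
  have h3 : 1 ≤ (4 + s^2).re := by rw [hre]; nlinarith
  refine ⟨h3, h3.trans (Complex.re_le_norm _), ?_, by simp [pow_two]; ring⟩
  calc ‖4 + s^2‖ ≤ ‖(4:ℂ)‖ + ‖s^2‖ := norm_add_le _ _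
    _ = 4 + (s.re^2 + s.im^2) := by
      rw [norm_pow, Complex.sq_norm, Complex.normSq_apply]; simp; ring
    _ ≤ _ := by linarith

noncomputable def zygF (γ : ℝ) (s : ℂ) : ℂ := Complex.cosh s * (4 + s^2) ^ ((-γ : ℝ) : ℂ)

lemma zygF_re (γ : ℝ) (s : ℂ) : (zygF γ s).re = ‖4 + s^2‖ ^ (-γ) *
    (Real.cosh s.re * Real.cos s.im * Real.cos (γ * (4+s^2).arg) +
      Real.sinh s.re * Real.sin s.im * Real.sin (γ * (4+s^2).arg)) := by
  have h : Complex.cosh s = (Real.cosh s.re * Real.cos s.im : ℝ)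
      + (Real.sinh s.re * Real.sin s.im : ℝ) * Complex.I := by
    conv_lhs => rw [← Complex.re_add_im s]
    rw [Complex.cosh_add, Complex.cosh_mul_I, Complex.sinh_mul_I]
    push_cast; ring
  rw [zygF, Complex.mul_re, Complex.cpow_ofReal_re, Complex.cpow_ofReal_im, h]
  have h2 : (4+s^2).arg * -γ = -(γ * (4+s^2).arg) := by ring
  rw [h2, Real.cos_neg, Real.sin_neg]
  simp only [Complex.add_re, Complex.add_im, Complex.mul_re, Complex.mul_im, Complex.ofReal_re, Complex.ofReal_im, Complex.I_re, Complex.I_im]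
  ring

lemma zygF_bound (γ : ℝ) (hγ : 0 < γ) (hγ' : γ ≤ 1/2) (s : ℂ) (h : |s.im| ≤ π/2) :
    Real.exp |s.re| ≤ 24/γ * (7 + s.re^2) ^ (γ + 1/2) * (1 + (zygF γ s).re) := by
  obtain ⟨h1, h2, h3, h4⟩ := zyg_p s h
  have hP0 : 0 < ‖4 + s^2‖ := by linarith
  obtain ⟨hE, hE1⟩ := zyg_all γ s.re s.im (4+s^2).arg ‖4 + s^2‖ hγ hγ' h
    (Complex.abs_arg_le_pi_div_two_iff.2 (by linarith)) h2 h3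
    (by rw [Complex.sin_arg, h4]; field_simp)
  have hre := zygF_re γ s
  set E := (Real.cosh s.re * Real.cos s.im * Real.cos (γ * (4+s^2).arg) +
      Real.sinh s.re * Real.sin s.im * Real.sin (γ * (4+s^2).arg))
  have hre0 : 0 ≤ (zygF γ s).re := by rw [hre]; positivity
  have hK : 48 ≤ 24/γ := by rw [le_div_iff₀ hγ]; linarith
  have hmono : ‖4 + s^2‖ ^ (γ+1/2) ≤ (7 + s.re^2) ^ (γ + 1/2) := by gcongr
  rcases le_total |s.re| 1 with hx | hx
  · have : Real.exp |s.re| ≤ 3 := (Real.exp_le_exp.2 hx).trans (by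
      have := Real.exp_one_lt_d9; linarith)
    have h5 : 1 ≤ (7 + s.re^2) ^ (γ + 1/2) := Real.one_le_rpow (by nlinarith) (by linarith)
    have h6 : (48:ℝ) * 1 * 1 ≤ 24/γ * (7 + s.re^2) ^ (γ + 1/2) * (1 + (zygF γ s).re) := by
      gcongr; linarith
    linarith
  · have h7 : Real.sqrt ‖4 + s^2‖ * E = ‖4 + s^2‖ ^ (γ+1/2) * (zygF γ s).re := by
      rw [hre, ← mul_assoc, ← Real.rpow_add hP0, Real.sqrt_eq_rpow]; congr 2; ring
    calc Real.exp |s.re| ≤ 24/γ * (‖4 + s^2‖ ^ (γ+1/2) * (zygF γ s).re) := by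
          rw [← h7]; exact hE1 hx
      _ ≤ 24/γ * ((7 + s.re^2) ^ (γ + 1/2) * (1 + (zygF γ s).re)) := by
          gcongr; linarith
      _ = _ := by ring

lemma zygF_zero (γ : ℝ) (hγ : 0 < γ) (s : ℂ) (h : |s.im| ≤ π/2) (h0 : s.re = 0) :
    (zygF γ s).re ≤ 1 := by
  obtain ⟨h1, h2, h3, h4⟩ := zyg_p s h
  rw [zygF_re, h0]
  simp only [Real.cosh_zero, Real.sinh_zero, one_mul, zero_mul, add_zero]
  have h5 : ‖4 + s^2‖ ^ (-γ) ≤ 1 := Real.rpow_le_one_of_one_le_of_nonpos h2 (by linarith)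
  have h6 : 0 ≤ ‖4 + s^2‖ ^ (-γ) := by positivity
  have h7 : |Real.cos s.im * Real.cos (γ * (4+s^2).arg)| ≤ 1 := by
    rw [abs_mul]
    exact mul_le_one₀ (Real.abs_cos_le_one _) (abs_nonneg _) (Real.abs_cos_le_one _)
  have h8 := (abs_le.1 h7).2
  nlinarith

lemma zygF_diff (γ : ℝ) (s : ℂ) (h : |s.im| ≤ π/2) : DifferentiableAt ℂ (zygF γ) s := by
  obtain ⟨h1, -⟩ := zyg_p s h
  unfold zygF
  refine Complex.differentiable_cosh.differentiableAt.mul ?_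
  refine DifferentiableAt.cpow_const (by fun_prop) ?_
  exact Or.inl (by linarith)

/-- **Refined Zygmund theorem on the unit disc** (Theorem 1.6 for `𝔻`).
If `f = u + iv` is holomorphic on the unit disc with `|u| ≤ 1` and `v 0 = 0`, then for every
`α > 1` there is a constant `C_α > 0` depending only on `α` with
`∫₀^{2π} exp((π/2)·|f(r e^{iθ})|) / (1 + |f(r e^{iθ})|)^α dθ ≤ C_α` for all `0 < r < 1`. -/
theorem zygmund_refined_unit_disc (α : ℝ) (hα : 1 < α) :
    ∃ C : ℝ, 0 < C ∧
      ∀ f : ℂ → ℂ, DifferentiableOn ℂ f (Metric.ball 0 1) →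
        (∀ z ∈ Metric.ball (0:ℂ) 1, |(f z).re| ≤ 1) → (f 0).im = 0 →
        ∀ r : ℝ, 0 < r → r < 1 →
          ∫ θ in (0:ℝ)..(2 * π),
              Real.exp (π / 2 * ‖f ((r : ℂ) * Complex.exp (θ * Complex.I))‖) /
                (1 + ‖f ((r : ℂ) * Complex.exp (θ * Complex.I))‖) ^ α ≤ C := by
  obtain ⟨γ, hγ, hγ', hγα⟩ : ∃ γ : ℝ, 0 < γ ∧ γ ≤ 1/2 ∧ 2 * (γ + 1/2) ≤ α := by
    refine ⟨min ((α-1)/2) (1/2), lt_min (by linarith) (by norm_num), min_le_right _ _, ?_⟩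
    have := min_le_left ((α-1)/2) (1/2)
    linarith
  set M : ℝ := Real.exp (π/2) * (24/γ * 7 ^ (γ+1/2)) with hM
  have hM0 : 0 < M := by positivity
  refine ⟨M * (4 * π), by positivity, ?_⟩
  intro f hf hre him r hr0 hr1
  have hpi := Real.pi_pos
  set S : ℂ → ℂ := fun z => (π/2 : ℝ) * (-Complex.I * f z) with hS
  have hSre : ∀ z, (S z).re = π/2 * (f z).im := by
    intro z; simp only [hS, Complex.re_ofReal_mul]; simp
  have hSim : ∀ z, (S z).im = -(π/2 * (f z).re) := by
    intro z; simp only [hS, Complex.im_ofReal_mul]; simp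
  have hSb : ∀ z ∈ Metric.ball (0:ℂ) 1, |(S z).im| ≤ π/2 := by
    intro z hz
    rw [hSim, abs_neg, abs_mul, abs_of_pos (by positivity : 0 < π/2)]
    have := hre z hz
    nlinarith
  have hG : DifferentiableOn ℂ (fun z => zygF γ (S z)) (Metric.ball 0 1) := by
    intro z hz
    have h1 : DifferentiableWithinAt ℂ S (Metric.ball 0 1) z := by
      have := hf z hz
      fun_prop
    exact (zygF_diff γ (S z) (hSb z hz)).comp_differentiableWithinAt z h1
  have hmem : ∀ θ : ℝ, circleMap 0 r θ ∈ Metric.ball (0:ℂ) 1 := by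
    intro θ; simp [circleMap, abs_of_pos hr0, hr1]
  have hcm : Continuous (circleMap (0:ℂ) r) := continuous_circleMap 0 r
  have hfc : Continuous (fun θ => f (circleMap 0 r θ)) :=
    hf.continuousOn.comp_continuous hcm hmem
  have hGc : Continuous (fun θ => zygF γ (S (circleMap 0 r θ))) :=
    hG.continuousOn.comp_continuous hcm hmem
  have hmean : ∫ θ in (0:ℝ)..(2*π), zygF γ (S (circleMap 0 r θ)) = (2*π : ℝ) * zygF γ (S 0) := by
    have hd : DiffContOnCl ℂ (fun z => zygF γ (S z)) (Metric.ball 0 |r|) := by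
      apply DifferentiableOn.diffContOnCl
      apply hG.mono
      rw [abs_of_pos hr0]
      exact Metric.closure_ball_subset_closedBall.trans (Metric.closedBall_subset_ball hr1)
    have := hd.circleAverage
    rw [Real.circleAverage_def] at this
    rw [← this, Complex.real_smul, ← mul_assoc, ← Complex.ofReal_mul,
      mul_inv_cancel₀ (by positivity)]
    simp
  have hmeanre : ∫ θ in (0:ℝ)..(2*π), (zygF γ (S (circleMap 0 r θ))).re
      = (2*π) * (zygF γ (S 0)).re := by
    have h1 := Complex.reCLM.intervalIntegral_comp_comm
      (hGc.intervalIntegrable (μ := volume) 0 (2*π))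
    simp only [Complex.reCLM_apply] at h1
    rw [h1, hmean, Complex.re_ofReal_mul]
  have h0 : (zygF γ (S 0)).re ≤ 1 :=
    zygF_zero γ hγ _ (hSb 0 (by simp)) (by rw [hSre, him, mul_zero])
  have hpt : ∀ θ : ℝ, Real.exp (π / 2 * ‖f (circleMap 0 r θ)‖) /
      (1 + ‖f (circleMap 0 r θ)‖) ^ α ≤ M * (1 + (zygF γ (S (circleMap 0 r θ))).re) := by
    intro θ
    have hz := hmem θ
    generalize circleMap 0 r θ = z at hz
    have hb := zygF_bound γ hγ hγ' (S z) (hSb z hz)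
    have hn : ‖f z‖ ≤ 1 + |(f z).im| :=
      (Complex.norm_le_abs_re_add_abs_im _).trans (by have := hre z hz; linarith)
    have habs : |(S z).re| = π/2 * |(f z).im| := by
      rw [hSre, abs_mul, abs_of_pos (by positivity : 0 < π/2)]
    have he : Real.exp (π / 2 * ‖f z‖) ≤ Real.exp (π/2) * Real.exp |(S z).re| := by
      rw [← Real.exp_add, habs]
      apply Real.exp_le_exp.2
      nlinarith
    have hq : 7 + (S z).re^2 ≤ 7 * (1 + ‖f z‖)^2 := by
      have h1 := Complex.abs_im_le_norm (f z)
      rw [← sq_abs, habs]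
      have h2 : (π/2 * |(f z).im|)^2 ≤ (2 * ‖f z‖)^2 := by
        have := Real.pi_le_four
        gcongr; linarith
      nlinarith [norm_nonneg (f z)]
    have hpow : (7 + (S z).re^2) ^ (γ+1/2) ≤ 7 ^ (γ+1/2) * (1 + ‖f z‖) ^ α := by
      calc (7 + (S z).re^2) ^ (γ+1/2) ≤ (7 * (1 + ‖f z‖)^2) ^ (γ+1/2) := by gcongr
        _ = 7 ^ (γ+1/2) * (1 + ‖f z‖) ^ (2 * (γ+1/2)) := by
          rw [Real.mul_rpow (by norm_num) (by positivity), Real.rpow_mul (by positivity),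
            Real.rpow_two]
        _ ≤ _ := by
          gcongr
          linarith [norm_nonneg (f z)]
    have hpos : 0 < 1 + (zygF γ (S z)).re := by
      by_contra hneg
      push Not at hneg
      have h1 : 24/γ * (7 + (S z).re^2) ^ (γ + 1/2) * (1 + (zygF γ (S z)).re) ≤ 0 :=
        mul_nonpos_of_nonneg_of_nonpos (by positivity) hneg
      linarith [Real.exp_pos |(S z).re|]
    rw [div_le_iff₀ (by positivity)]
    calc Real.exp (π / 2 * ‖f z‖) ≤ Real.exp (π/2) * Real.exp |(S z).re| := he
      _ ≤ Real.exp (π/2) * (24/γ * (7 + (S z).re^2) ^ (γ + 1/2) * (1 + (zygF γ (S z)).re)) := by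
        gcongr
      _ ≤ Real.exp (π/2) * (24/γ * (7 ^ (γ+1/2) * (1 + ‖f z‖) ^ α)
          * (1 + (zygF γ (S z)).re)) := by gcongr
      _ = _ := by rw [hM]; ring
  have hci : ∀ θ : ℝ, (r : ℂ) * Complex.exp (θ * Complex.I) = circleMap 0 r θ := by
    intro θ; simp [circleMap]
  simp only [hci]
  have hGre : Continuous (fun θ => (zygF γ (S (circleMap 0 r θ))).re) :=
    Complex.continuous_re.comp hGc
  calc ∫ θ in (0:ℝ)..(2 * π), Real.exp (π / 2 * ‖f (circleMap 0 r θ)‖) /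
      (1 + ‖f (circleMap 0 r θ)‖) ^ α
      ≤ ∫ θ in (0:ℝ)..(2 * π), M * (1 + (zygF γ (S (circleMap 0 r θ))).re) := by
        apply intervalIntegral.integral_mono_on (by positivity)
        · apply Continuous.intervalIntegrable
          refine Continuous.div (Real.continuous_exp.comp (continuous_const.mul hfc.norm)) ?_ (fun θ => by positivity)
          exact Continuous.rpow_const (continuous_const.add hfc.norm) (fun θ => Or.inl (by positivity))
        · apply Continuous.intervalIntegrable
          fun_prop
        · intro θ _
          exact hpt θ
    _ = M * (2 * π + 2 * π * (zygF γ (S 0)).re) := by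
        rw [intervalIntegral.integral_const_mul, intervalIntegral.integral_add
          (by simp) (hGre.intervalIntegrable _ _), hmeanre]
        simp
    _ ≤ M * (4 * π) := by
        gcongr
        nlinarith
end

section
/- For every α > 1 there exists a constant C_α > 0 depending only on α such that the following holds: for every n ≥ 1, every open set Ω ⊆ ℂⁿ, every z₀ ∈ Ω and r > 0 with the closed ball {z : |z − z₀| ≤ r} contained in Ω, and every holomorphic f = u + iv on Ω with |u| ≤ 1 on Ω and v(z₀) = 0, one has ∫_{S(z₀,r)} exp((π/2)·|f|) / (1 + |f|)^α dσ_{z₀,r} ≤ C_α. -/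
open Real MeasureTheory Set

open scoped ENNReal

/-- Auxiliary kernel. -/
noncomputable def zP (t : ℝ) (w : ℂ) : ℝ :=
  Real.cos (π * t / 2 * w.re) * Real.cosh (π * t / 2 * w.im)

lemma zP_eq (t : ℝ) (w : ℂ) : zP t w = (Complex.cos (((π * t / 2 : ℝ) : ℂ) * w)).re := by
  have h : ((π * t / 2 : ℝ) : ℂ) * w
      = ((π * t / 2 * w.re : ℝ) : ℂ) + ((π * t / 2 * w.im : ℝ) : ℂ) * Complex.I := by
    conv_lhs => rw [← Complex.re_add_im w]
    push_cast; ring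
  rw [h, Complex.cos_add_mul_I, ← Complex.ofReal_cos, ← Complex.ofReal_cosh,
    ← Complex.ofReal_sin, ← Complex.ofReal_sinh, Complex.sub_re, ← Complex.ofReal_mul,
    ← Complex.ofReal_mul, Complex.re_ofReal_mul, Complex.ofReal_re, Complex.I_re, zP]
  ring

lemma zP_cos_lb {t u : ℝ} (ht0 : 0 ≤ t) (ht1 : t ≤ 1) (hu : |u| ≤ 1) :
    1 - t ≤ Real.cos (π * t / 2 * u) := by
  have hpi := Real.pi_pos
  have h1 : |π * t / 2 * u| ≤ π * t / 2 := by
    rw [abs_mul, abs_of_nonneg (by positivity)]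
    exact mul_le_of_le_one_right (by positivity) hu
  have h2 : π * t / 2 ≤ π / 2 := by nlinarith
  rw [← Real.cos_abs]
  calc 1 - t = 1 - 2 / π * (π * t / 2) := by field_simp
    _ ≤ Real.cos (π * t / 2) := Real.one_sub_mul_le_cos (by positivity) h2
    _ ≤ _ := Real.cos_le_cos_of_nonneg_of_le_pi (abs_nonneg _) (by linarith) h1

lemma zP_nonneg {t : ℝ} {w : ℂ} (ht0 : 0 ≤ t) (ht1 : t ≤ 1) (hu : |w.re| ≤ 1) :
    0 ≤ zP t w :=
  mul_nonneg (by linarith [zP_cos_lb ht0 ht1 hu]) (Real.cosh_pos _).le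

lemma zP_lb {t : ℝ} {w : ℂ} (ht0 : 0 ≤ t) (ht1 : t ≤ 1) (hu : |w.re| ≤ 1) :
    (1 - t) * (Real.exp (π * t / 2 * |w.im|) / 2) ≤ zP t w := by
  have h1 := zP_cos_lb ht0 ht1 hu
  unfold zP
  refine mul_le_mul h1 ?_ (by positivity) (by linarith)
  rw [← Real.cosh_abs, abs_mul, abs_of_nonneg (by positivity : 0 ≤ π * t / 2), Real.cosh_eq]
  have := Real.exp_pos (-(π * t / 2 * |w.im|))
  linarith

lemma zP_pointwise {α : ℝ} (hα : 1 < α) {w : ℂ} (hu : |w.re| ≤ 1) :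
    ENNReal.ofReal (Real.exp (π / 2 * ‖w‖) / (1 + ‖w‖) ^ α) ≤
      ENNReal.ofReal (Real.exp π * 2 ^ (α + 1)) *
        ∫⁻ t in Ioo (0 : ℝ) 1, ENNReal.ofReal ((1 - t) ^ (α - 2)) * ENNReal.ofReal (zP t w) := by
  have hpi := Real.pi_pos
  set v := |w.im| with hv
  have hv0 : 0 ≤ v := abs_nonneg _
  set δ : ℝ := 1 / (1 + v) with hδ
  have hδ0 : 0 < δ := by positivity
  have hδ1 : δ ≤ 1 := by rw [hδ, div_le_one (by positivity)]; linarith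
  have hδv : δ * v ≤ 1 := by rw [hδ, div_mul_eq_mul_div, div_le_one (by positivity)]; linarith
  have hw1 : ‖w‖ ≤ 1 + v := (Complex.norm_le_abs_re_add_abs_im w).trans (by linarith)
  have hw2 : v ≤ ‖w‖ := Complex.abs_im_le_norm w
  set c : ℝ := (δ / 2) ^ (α - 1) * (Real.exp (π / 2 * v) * Real.exp (-(π / 2)) / 2) with hc
  have hc0 : 0 ≤ c := by positivity
  have key : ENNReal.ofReal c * ENNReal.ofReal (δ / 2) ≤
      ∫⁻ t in Ioo (0 : ℝ) 1, ENNReal.ofReal ((1 - t) ^ (α - 2)) * ENNReal.ofReal (zP t w) := by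
    calc ENNReal.ofReal c * ENNReal.ofReal (δ / 2)
        = ∫⁻ t in Ioo (1 - δ) (1 - δ / 2), ENNReal.ofReal c := by
          rw [setLIntegral_const, Real.volume_Ioo]; congr 2; ring
      _ ≤ ∫⁻ t in Ioo (1 - δ) (1 - δ / 2),
            ENNReal.ofReal ((1 - t) ^ (α - 2)) * ENNReal.ofReal (zP t w) := by
          refine setLIntegral_mono' measurableSet_Ioo fun t ht => ?_
          have h0 : 0 ≤ t := by linarith [ht.1]
          have h1 : 0 < 1 - t := by linarith [ht.2]
          rw [← ENNReal.ofReal_mul (by positivity)]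
          refine ENNReal.ofReal_le_ofReal ?_
          refine le_trans ?_ (mul_le_mul_of_nonneg_left (zP_lb h0 (by linarith) hu)
            (by positivity))
          have e1 : (1 - t) ^ (α - 2) * ((1 - t) * (Real.exp (π * t / 2 * |w.im|) / 2))
              = (1 - t) ^ (α - 1) * (Real.exp (π * t / 2 * |w.im|) / 2) := by
            rw [← mul_assoc]
            congr 1
            rw [← Real.rpow_add_one h1.ne']; congr 1; ring
          rw [e1, hc]
          have e2 : (δ / 2) ^ (α - 1) ≤ (1 - t) ^ (α - 1) :=
            Real.rpow_le_rpow (by positivity) (by linarith [ht.2]) (by linarith)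
          have e3 : Real.exp (π / 2 * v) * Real.exp (-(π / 2)) ≤ Real.exp (π * t / 2 * |w.im|) := by
            rw [← Real.exp_add, Real.exp_le_exp, ← hv]
            have : (1 - t) * v ≤ 1 :=
              (mul_le_mul_of_nonneg_right (by linarith [ht.1] : 1 - t ≤ δ) hv0).trans hδv
            nlinarith
          gcongr
      _ ≤ _ := lintegral_mono_set (Ioo_subset_Ioo (by linarith) (by linarith))
  refine le_trans ?_ (mul_le_mul_right key _)
  rw [← ENNReal.ofReal_mul hc0, ← ENNReal.ofReal_mul (by positivity)]
  refine ENNReal.ofReal_le_ofReal ?_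
  have e1 : (δ / 2) ^ (α - 1) * (δ / 2) = δ ^ α / 2 ^ α := by
    rw [← Real.rpow_add_one (by positivity), Real.div_rpow hδ0.le (by norm_num)]
    congr 2 <;> ring
  have e2 : Real.exp π = Real.exp (π / 2) * Real.exp (π / 2) := by
    rw [← Real.exp_add]; congr 1; ring
  have e3 : Real.exp (π / 2) * Real.exp (-(π / 2)) = 1 := by
    rw [← Real.exp_add]; simp
  have e4 : (2 : ℝ) ^ (α + 1) = 2 ^ α * 2 := Real.rpow_add_one (by norm_num) _
  have e5 : (2 : ℝ) ^ α ≠ 0 := by positivity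
  have e6 : Real.exp π * 2 ^ (α + 1) * (c * (δ / 2))
      = Real.exp (π / 2) * Real.exp (π / 2 * v) * δ ^ α := by
    calc _ = (Real.exp π * Real.exp (-(π / 2))) * (2 ^ (α + 1)) *
          ((δ / 2) ^ (α - 1) * (δ / 2)) * Real.exp (π / 2 * v) / 2 := by rw [hc]; ring
      _ = _ := by
        rw [e1, e2, mul_assoc (Real.exp (π / 2)), e3, e4]; field_simp
  rw [e6, hδ, Real.div_rpow (by norm_num) (by positivity), Real.one_rpow, ← Real.exp_add,
    mul_one_div]
  gcongr
  nlinarith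

lemma zP_cont : Continuous (fun p : ℝ × ℂ => zP p.1 p.2) := by
  unfold zP; fun_prop

lemma weight_fin {α : ℝ} (hα : 1 < α) :
    ∫⁻ t in Ioo (0 : ℝ) 1, ENNReal.ofReal ((1 - t) ^ (α - 2)) < ∞ := by
  have h := (intervalIntegral.intervalIntegrable_rpow' (a := 0) (b := 1)
    (by linarith : -1 < α - 2)).comp_sub_left 1
  have h2 : IntegrableOn (fun t : ℝ => (1 - t) ^ (α - 2)) (Ioo 0 1) := by
    have h3 := h.symm
    simp only [sub_self, sub_zero] at h3
    rw [intervalIntegrable_iff_integrableOn_Ioc_of_le zero_le_one] at h3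
    exact h3.mono_set Ioo_subset_Ioc_self
  exact Integrable.lintegral_lt_top h2

lemma sphereUnif_le_one (n : ℕ) (z₀ : EuclideanSpace ℂ (Fin n)) (r : ℝ) :
    sphereUnifMeasure n z₀ r univ ≤ 1 := by
  unfold sphereUnifMeasure
  rw [Measure.smul_apply, Measure.restrict_apply_univ, smul_eq_mul]
  exact ENNReal.inv_mul_le_one _

lemma sphereUnif_ae (n : ℕ) (z₀ : EuclideanSpace ℂ (Fin n)) (r : ℝ) :
    ∀ᵐ z ∂(sphereUnifMeasure n z₀ r), z ∈ Metric.sphere z₀ r := by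
  unfold sphereUnifMeasure
  refine Measure.ae_smul_measure ?_ _
  exact ae_restrict_mem Metric.isClosed_sphere.measurableSet

lemma sphereUnif_inv (n : ℕ) (z₀ : EuclideanSpace ℂ (Fin n)) (r : ℝ) (c : ℂ) (hc : ‖c‖ = 1)
    (F : EuclideanSpace ℂ (Fin n) → ℝ≥0∞) (hF : Measurable F) :
    ∫⁻ z, F (z₀ + c • (z - z₀)) ∂(sphereUnifMeasure n z₀ r)
      = ∫⁻ z, F z ∂(sphereUnifMeasure n z₀ r) := by
  have hiso : Isometry (fun z : EuclideanSpace ℂ (Fin n) => z₀ + c • (z - z₀)) := by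
    refine Isometry.of_dist_eq fun x y => ?_
    rw [dist_add_left, dist_smul₀, hc, one_mul, dist_sub_right]
  have hc0 : c ≠ 0 := by intro h; simp [h] at hc
  have hsurj : Function.Surjective
      (fun z : EuclideanSpace ℂ (Fin n) => z₀ + c • (z - z₀)) := by
    intro y
    refine ⟨z₀ + c⁻¹ • (y - z₀), ?_⟩
    simp [smul_smul, hc0]
  have hmp : MeasurePreserving (fun z : EuclideanSpace ℂ (Fin n) => z₀ + c • (z - z₀))
      μH[2 * (n : ℝ) - 1] μH[2 * (n : ℝ) - 1] :=
    ⟨hiso.continuous.measurable, by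
      rw [hiso.map_hausdorffMeasure (Or.inr hsurj), hsurj.range_eq, Measure.restrict_univ]⟩
  have hpre : (fun z : EuclideanSpace ℂ (Fin n) => z₀ + c • (z - z₀)) ⁻¹' (Metric.sphere z₀ r)
      = Metric.sphere z₀ r := by
    ext z
    simp [dist_eq_norm, norm_smul, hc]
  have hmr := hmp.restrict_preimage
    (s := Metric.sphere z₀ r) Metric.isClosed_sphere.measurableSet
  rw [hpre] at hmr
  unfold sphereUnifMeasure
  exact (hmr.smul_measure _).lintegral_comp hF

lemma circle_mean {n : ℕ} {Ω : Set (EuclideanSpace ℂ (Fin n))} (hΩ : IsOpen Ω)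
    {z₀ : EuclideanSpace ℂ (Fin n)} {r : ℝ} (hb : Metric.closedBall z₀ r ⊆ Ω)
    {f : EuclideanSpace ℂ (Fin n) → ℂ} (hf : DifferentiableOn ℂ f Ω)
    (hu : ∀ z ∈ Ω, |(f z).re| ≤ 1) (hv : (f z₀).im = 0) {t : ℝ} (ht0 : 0 ≤ t) (ht1 : t ≤ 1)
    {z : EuclideanSpace ℂ (Fin n)} (hz : z ∈ Metric.sphere z₀ r) :
    ∫⁻ θ in Ioc 0 (2 * π), ENNReal.ofReal (zP t (f (z₀ + circleMap 0 1 θ • (z - z₀))))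
      ≤ ENNReal.ofReal (2 * π) := by
  set G : ℂ → ℂ := fun s => Complex.cos (((π * t / 2 : ℝ) : ℂ) * f (z₀ + s • (z - z₀))) with hG
  have hmem : ∀ s ∈ Metric.closedBall (0 : ℂ) 1, z₀ + s • (z - z₀) ∈ Ω := by
    intro s hs
    apply hb
    rw [mem_closedBall_zero_iff] at hs
    rw [mem_sphere_iff_norm] at hz
    rw [mem_closedBall_iff_norm, add_sub_cancel_left, norm_smul, hz]
    exact mul_le_of_le_one_left (hz ▸ norm_nonneg _) hs
  have hdiff : ∀ s ∈ Metric.closedBall (0 : ℂ) 1, DifferentiableAt ℂ G s := by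
    intro s hs
    have h1 : DifferentiableAt ℂ f (z₀ + s • (z - z₀)) :=
      hf.differentiableAt (hΩ.mem_nhds (hmem s hs))
    have h2 : DifferentiableAt ℂ (fun s : ℂ => z₀ + s • (z - z₀)) s := by fun_prop
    have h3 : DifferentiableAt ℂ (fun s : ℂ => f (z₀ + s • (z - z₀))) s :=
      DifferentiableAt.comp s h1 h2
    exact (h3.const_mul _).ccos
  have hcont : ContinuousOn G (Metric.closedBall 0 1) :=
    fun s hs => (hdiff s hs).continuousAt.continuousWithinAt
  have havg : Real.circleAverage G 0 1 = G 0 := by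
    refine circleAverage_of_differentiable_on_off_countable countable_empty ?_ ?_
    · simpa using hcont
    · intro s hs
      exact hdiff s (Metric.ball_subset_closedBall (by simpa using hs.1))
  have hcm : ∀ θ : ℝ, circleMap 0 1 θ ∈ Metric.closedBall (0 : ℂ) 1 := by
    intro θ; simp
  have hGc : Continuous (fun θ : ℝ => G (circleMap 0 1 θ)) :=
    hcont.comp_continuous (continuous_circleMap 0 1) hcm
  have hre : ∀ θ : ℝ, zP t (f (z₀ + circleMap 0 1 θ • (z - z₀))) = (G (circleMap 0 1 θ)).re :=
    fun θ => zP_eq _ _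
  have hnn : ∀ θ : ℝ, 0 ≤ (G (circleMap 0 1 θ)).re := fun θ => by
    rw [← hre]; exact zP_nonneg ht0 ht1 (hu _ (hmem _ (hcm θ)))
  have hint : IntegrableOn (fun θ : ℝ => G (circleMap 0 1 θ)) (Ioc 0 (2 * π)) :=
    (hGc.intervalIntegrable 0 (2 * π)).1
  simp_rw [hre]
  have hintre : Integrable (fun θ : ℝ => (G (circleMap 0 1 θ)).re)
      (volume.restrict (Ioc 0 (2 * π))) := hint.re
  rw [← ofReal_integral_eq_lintegral_ofReal hintre (Filter.Eventually.of_forall hnn)]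
  refine ENNReal.ofReal_le_ofReal ?_
  have hI : ∫ θ in Ioc 0 (2 * π), G (circleMap 0 1 θ) = ((2 * π : ℝ) : ℂ) * G 0 := by
    rw [← havg, Real.circleAverage_def, intervalIntegral.integral_of_le Real.two_pi_pos.le,
      Complex.real_smul, ← mul_assoc, ← Complex.ofReal_mul, mul_inv_cancel₀ Real.two_pi_pos.ne']
    simp
  have hI2 : ∫ θ in Ioc 0 (2 * π), (G (circleMap 0 1 θ)).re
      = (∫ θ in Ioc 0 (2 * π), G (circleMap 0 1 θ)).re := integral_re hint
  rw [hI2, hI, Complex.re_ofReal_mul]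
  have hG0 : (G 0).re ≤ 1 := by
    have : (G 0).re = zP t (f z₀) := by rw [zP_eq, hG]; simp
    rw [this, zP, hv]; simp [Real.cos_le_one]
  exact mul_le_of_le_one_right Real.two_pi_pos.le hG0

lemma sphere_mean {n : ℕ} {Ω : Set (EuclideanSpace ℂ (Fin n))} (hΩ : IsOpen Ω)
    {z₀ : EuclideanSpace ℂ (Fin n)} {r : ℝ} (hb : Metric.closedBall z₀ r ⊆ Ω)
    {f : EuclideanSpace ℂ (Fin n) → ℂ} (hf : DifferentiableOn ℂ f Ω)
    (hu : ∀ z ∈ Ω, |(f z).re| ≤ 1) (hv : (f z₀).im = 0) {t : ℝ} (ht0 : 0 ≤ t) (ht1 : t ≤ 1)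
    {g : EuclideanSpace ℂ (Fin n) → ℂ} (hg : Measurable g)
    (hgf : ∀ z ∈ Metric.sphere z₀ r, g z = f z) :
    ∫⁻ z, ENNReal.ofReal (zP t (g z)) ∂(sphereUnifMeasure n z₀ r) ≤ 1 := by
  set σ := sphereUnifMeasure n z₀ r with hσ
  have : IsFiniteMeasure σ := ⟨(sphereUnif_le_one n z₀ r).trans_lt ENNReal.one_lt_top⟩
  set F : EuclideanSpace ℂ (Fin n) → ℝ≥0∞ := fun z => ENNReal.ofReal (zP t (g z)) with hF
  have hFm : Measurable F :=
    (zP_cont.measurable.comp (measurable_const.prodMk hg)).ennreal_ofReal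
  have h2pi : ENNReal.ofReal (2 * π) ≠ 0 := by simp [Real.pi_pos]
  have hmain : ENNReal.ofReal (2 * π) * ∫⁻ z, F z ∂σ ≤ ENNReal.ofReal (2 * π) * 1 := by
    calc ENNReal.ofReal (2 * π) * ∫⁻ z, F z ∂σ
        = ∫⁻ θ in Ioc 0 (2 * π), ∫⁻ z, F z ∂σ := by
          rw [setLIntegral_const, Real.volume_Ioc, sub_zero, mul_comm]
      _ = ∫⁻ θ in Ioc 0 (2 * π), ∫⁻ z, F (z₀ + circleMap 0 1 θ • (z - z₀)) ∂σ := by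
          refine lintegral_congr fun θ => (sphereUnif_inv n z₀ r _ (by simp) F hFm).symm
      _ = ∫⁻ z, (∫⁻ θ in Ioc 0 (2 * π), F (z₀ + circleMap 0 1 θ • (z - z₀))) ∂σ := by
          refine lintegral_lintegral_swap (Measurable.aemeasurable ?_)
          refine hFm.comp (Continuous.measurable ?_)
          have := continuous_circleMap (0 : ℂ) 1
          fun_prop
      _ ≤ ∫⁻ z, ENNReal.ofReal (2 * π) ∂σ := by
          refine lintegral_mono_ae ?_
          filter_upwards [sphereUnif_ae n z₀ r] with z hz
          refine le_trans (le_of_eq ?_) (circle_mean hΩ hb hf hu hv ht0 ht1 hz)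
          refine lintegral_congr fun θ => ?_
          rw [hF]
          simp only
          rw [hgf]
          rw [mem_sphere_iff_norm] at hz ⊢
          simp [norm_smul, hz]
      _ ≤ _ := by
          rw [lintegral_const]
          exact mul_le_mul_right (sphereUnif_le_one n z₀ r) _
  exact (ENNReal.mul_le_mul_iff_right h2pi ENNReal.ofReal_ne_top).1 hmain

theorem zygmund_refined_sphere (α : ℝ) (hα : 1 < α) :
    ∃ C : ℝ, 0 < C ∧
      ∀ (n : ℕ), 1 ≤ n → ∀ (Ω : Set (EuclideanSpace ℂ (Fin n))), IsOpen Ω →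
        ∀ (z₀ : EuclideanSpace ℂ (Fin n)) (r : ℝ), 0 < r → Metric.closedBall z₀ r ⊆ Ω →
          ∀ f : EuclideanSpace ℂ (Fin n) → ℂ, DifferentiableOn ℂ f Ω →
            (∀ z ∈ Ω, |(f z).re| ≤ 1) → (f z₀).im = 0 →
            ∫ z, Real.exp (π / 2 * ‖f z‖) / (1 + ‖f z‖) ^ α
                ∂(sphereUnifMeasure n z₀ r) ≤ C := by
  set K : ℝ≥0∞ := ENNReal.ofReal (Real.exp π * 2 ^ (α + 1)) *
    ∫⁻ t in Ioo (0 : ℝ) 1, ENNReal.ofReal ((1 - t) ^ (α - 2)) with hK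
  have hKtop : K ≠ ∞ := ENNReal.mul_ne_top ENNReal.ofReal_ne_top (weight_fin hα).ne
  refine ⟨K.toReal + 1, by positivity, ?_⟩
  intro n _ Ω hΩ z₀ r _ hb f hf hu hv
  classical
  set σ := sphereUnifMeasure n z₀ r with hσ
  have : IsFiniteMeasure σ := ⟨(sphereUnif_le_one n z₀ r).trans_lt ENNReal.one_lt_top⟩
  set S := Metric.sphere z₀ r with hS
  have hSm : MeasurableSet S := Metric.isClosed_sphere.measurableSet
  have hSΩ : S ⊆ Ω := Metric.sphere_subset_closedBall.trans hb
  set g : EuclideanSpace ℂ (Fin n) → ℂ := S.piecewise f 0 with hg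
  have hgm : Measurable g :=
    ContinuousOn.measurable_piecewise (hf.continuousOn.mono hSΩ) continuousOn_const hSm
  have hgf : ∀ z ∈ S, g z = f z := fun z hz => piecewise_eq_of_mem _ _ _ hz
  have hgre : ∀ z, |(g z).re| ≤ 1 := by
    intro z
    by_cases hz : z ∈ S
    · rw [hgf z hz]; exact hu z (hSΩ hz)
    · rw [hg, piecewise_eq_of_notMem _ _ _ hz]; simp
  have hcongr : ∫ z, Real.exp (π / 2 * ‖f z‖) / (1 + ‖f z‖) ^ α ∂σ
      = ∫ z, Real.exp (π / 2 * ‖g z‖) / (1 + ‖g z‖) ^ α ∂σ := by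
    refine integral_congr_ae ?_
    filter_upwards [sphereUnif_ae n z₀ r] with z hz
    rw [hgf z hz]
  have hbound : ∫⁻ z, ENNReal.ofReal (Real.exp (π / 2 * ‖g z‖) / (1 + ‖g z‖) ^ α) ∂σ ≤ K := by
    have hjm : Measurable (fun p : EuclideanSpace ℂ (Fin n) × ℝ =>
        ENNReal.ofReal ((1 - p.2) ^ (α - 2)) * ENNReal.ofReal (zP p.2 (g p.1))) := by
      have m1 : Measurable (fun p : EuclideanSpace ℂ (Fin n) × ℝ =>
          ENNReal.ofReal ((1 - p.2) ^ (α - 2))) :=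
        ((measurable_const.sub measurable_snd).pow_const _).ennreal_ofReal
      have m2 : Measurable (fun p : EuclideanSpace ℂ (Fin n) × ℝ =>
          ENNReal.ofReal (zP p.2 (g p.1))) := (zP_cont.measurable.comp
          (measurable_snd.prodMk (hgm.comp measurable_fst))).ennreal_ofReal
      exact m1.mul m2
    calc _ ≤ ∫⁻ z, ENNReal.ofReal (Real.exp π * 2 ^ (α + 1)) *
        (∫⁻ t in Ioo (0 : ℝ) 1, ENNReal.ofReal ((1 - t) ^ (α - 2)) *
          ENNReal.ofReal (zP t (g z))) ∂σ := lintegral_mono fun z => zP_pointwise hα (hgre z)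
      _ = ENNReal.ofReal (Real.exp π * 2 ^ (α + 1)) * ∫⁻ z,
        (∫⁻ t in Ioo (0 : ℝ) 1, ENNReal.ofReal ((1 - t) ^ (α - 2)) *
          ENNReal.ofReal (zP t (g z))) ∂σ := lintegral_const_mul' _ _ ENNReal.ofReal_ne_top
      _ = ENNReal.ofReal (Real.exp π * 2 ^ (α + 1)) * ∫⁻ t in Ioo (0 : ℝ) 1,
        (∫⁻ z, ENNReal.ofReal ((1 - t) ^ (α - 2)) *
          ENNReal.ofReal (zP t (g z)) ∂σ) := by
          congr 1
          exact lintegral_lintegral_swap hjm.aemeasurable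
      _ ≤ K := by
          rw [hK]
          refine mul_le_mul_right (setLIntegral_mono' measurableSet_Ioo fun t ht => ?_) _
          rw [lintegral_const_mul' _ _ ENNReal.ofReal_ne_top]
          exact mul_le_of_le_one_right zero_le
            (sphere_mean hΩ hb hf hu hv ht.1.le ht.2.le hgm hgf)
  rw [hcongr, integral_eq_lintegral_of_nonneg_ae
    (Filter.Eventually.of_forall fun z => by positivity)
    (Measurable.aestronglyMeasurable ?_)]
  · exact (ENNReal.toReal_mono hKtop hbound).trans (by linarith)
  · have hn := hgm.norm
    exact (Real.measurable_exp.comp (hn.const_mul _)).div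
      ((hn.const_add 1).pow_const _)
end

section
/- Let Ω be an open subset of ℂⁿ, let z₀ ∈ Ω and r > 0 be such that the closed ball {z : |z − z₀| ≤ r} is contained in Ω, let f = u + iv be holomorphic on Ω with u > 0 on Ω, and let α > 1. Then ∫_{S(z₀,r)} |f + e^{α+1}| / (log |f + e^{α+1}|²)^α dσ_{z₀,r} < |f(z₀) + e^{α+1}| / (log |f(z₀) + e^{α+1}|²)^α + ((α+1)/(α−1)) · (u(z₀) + e^{α+1}) / (log (u(z₀) + e^{α+1})²)^{α−1}. -/
open Real MeasureTheory Set

lemma ks_param (k k' : ℝ → ℝ → ℝ) (b : ℝ)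
    (hk : ContinuousOn (Function.uncurry k) (Iio b ×ˢ univ))
    (hk' : ContinuousOn (Function.uncurry k') (Iio b ×ˢ univ))
    (hd : ∀ s < b, ∀ θ, HasDerivAt (fun s => k s θ) (k' s θ) s) (s : ℝ) (hs : s < b) :
    HasDerivAt (fun s => ∫ θ in (0:ℝ)..(2*π), k s θ) (∫ θ in (0:ℝ)..(2*π), k' s θ) s := by
  have hc : ∀ {k : ℝ → ℝ → ℝ}, ContinuousOn (Function.uncurry k) (Iio b ×ˢ univ) →
      ∀ x < b, Continuous (k x) := by
    intro k hk x hx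
    have : Continuous (fun θ : ℝ => (x, θ)) := by fun_prop
    rw [← continuousOn_univ] at this ⊢
    exact hk.comp this (fun θ _ => ⟨hx, mem_univ _⟩)
  obtain ⟨c, hsc, hcb⟩ := exists_between hs
  obtain ⟨M, hM⟩ := (isCompact_Icc.prod (isCompact_uIcc (a := (0:ℝ)) (b := 2*π))).exists_bound_of_continuousOn
    (hk'.mono (show Icc (s-1) c ×ˢ uIcc (0:ℝ) (2*π) ⊆ Iio b ×ˢ univ from
      fun p hp => ⟨lt_of_le_of_lt hp.1.2 hcb, mem_univ _⟩))
  refine (intervalIntegral.hasDerivAt_integral_of_dominated_loc_of_deriv_le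
    (F := k) (F' := k') (bound := fun _ => M) (s := Ioo (s-1) c) (x₀ := s)
    (Ioo_mem_nhds (by linarith) hsc) ?_ ?_ ?_ ?_ ?_ ?_).2
  · filter_upwards [Iio_mem_nhds hs] with x hx
    exact (hc hk x hx).aestronglyMeasurable
  · exact (hc hk s hs).intervalIntegrable _ _
  · exact (hc hk' s hs).aestronglyMeasurable
  · refine Filter.Eventually.of_forall fun θ hθ x hx => ?_
    exact hM (x, θ) ⟨⟨hx.1.le, hx.2.le⟩, uIoc_subset_uIcc hθ⟩
  · simp
  · exact Filter.Eventually.of_forall fun θ hθ x hx => hd x (hx.2.trans hcb) θ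

/-- Hardy identity. -/
lemma ks_hardy (A A' A'' : ℝ → ℝ) (c b : ℝ) (W : ℂ → ℂ)
    (hA : ∀ x > c, HasDerivAt A (A' x) x) (hA' : ∀ x > c, HasDerivAt A' (A'' x) x)
    (hA'' : ContinuousOn A'' (Ioi c))
    (hW : DifferentiableOn ℂ W {w | w.re < b}) (hWc : ∀ w : ℂ, w.re < b → c < (W w).re)
    (hper : ∀ w, W (w + 2 * π * Complex.I) = W w) :
    ∃ Q : ℝ → ℝ, ∀ s < b,
      HasDerivAt (fun s : ℝ => ∫ θ in (0:ℝ)..(2*π), A (W (s + θ * Complex.I)).re) (Q s) s ∧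
      HasDerivAt Q (∫ θ in (0:ℝ)..(2*π),
        A'' (W (s + θ * Complex.I)).re * ‖deriv W (s + θ * Complex.I)‖ ^ 2) s ∧
      Continuous (fun θ : ℝ => A (W (s + θ * Complex.I)).re) ∧
      Continuous (fun θ : ℝ => A'' (W (s + θ * Complex.I)).re *
        ‖deriv W (s + θ * Complex.I)‖ ^ 2) := by
  have ho : IsOpen {w : ℂ | w.re < b} := isOpen_lt Complex.continuous_re continuous_const
  have hW1 := hW.deriv ho
  have hW2 := hW1.deriv ho
  have hcA : ContinuousOn A (Ioi c) := fun x hx => (hA x hx).continuousAt.continuousWithinAt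
  have hcA' : ContinuousOn A' (Ioi c) := fun x hx => (hA' x hx).continuousAt.continuousWithinAt
  have hd : ∀ w : ℂ, w.re < b → HasDerivAt W (deriv W w) w := fun w hw =>
    (hW.differentiableAt (ho.mem_nhds hw)).hasDerivAt
  have hd1 : ∀ w : ℂ, w.re < b → HasDerivAt (deriv W) (deriv (deriv W) w) w := fun w hw =>
    (hW1.differentiableAt (ho.mem_nhds hw)).hasDerivAt
  have hre : ∀ s θ : ℝ, ((s : ℂ) + θ * Complex.I).re = s := by intro s θ; simp
  have hjc : Continuous (fun p : ℝ × ℝ => (p.1 : ℂ) + p.2 * Complex.I) := by fun_prop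
  have hmap : MapsTo (fun p : ℝ × ℝ => (p.1 : ℂ) + p.2 * Complex.I) (Iio b ×ˢ univ)
      {w : ℂ | w.re < b} := by
    rintro ⟨s, θ⟩ h; simpa using h.1
  have cW : ∀ {V : ℂ → ℂ}, DifferentiableOn ℂ V {w | w.re < b} →
      ContinuousOn (fun p : ℝ × ℝ => V ((p.1 : ℂ) + p.2 * Complex.I)) (Iio b ×ˢ univ) :=
    fun hV => hV.continuousOn.comp hjc.continuousOn hmap
  have cA : ∀ {B : ℝ → ℝ}, ContinuousOn B (Ioi c) →
      ContinuousOn (fun p : ℝ × ℝ => B (W ((p.1 : ℂ) + p.2 * Complex.I)).re) (Iio b ×ˢ univ) :=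
    fun hB => hB.comp (Complex.continuous_re.comp_continuousOn (cW hW))
      (fun p hp => hWc _ (hmap hp))
  have cre : ∀ {V : ℂ → ℂ}, DifferentiableOn ℂ V {w | w.re < b} →
      ContinuousOn (fun p : ℝ × ℝ => (V ((p.1 : ℂ) + p.2 * Complex.I)).re) (Iio b ×ˢ univ) :=
    fun hV => Complex.continuous_re.comp_continuousOn (cW hV)
  have cim : ∀ {V : ℂ → ℂ}, DifferentiableOn ℂ V {w | w.re < b} →
      ContinuousOn (fun p : ℝ × ℝ => (V ((p.1 : ℂ) + p.2 * Complex.I)).im) (Iio b ×ˢ univ) :=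
    fun hV => Complex.continuous_im.comp_continuousOn (cW hV)
  have hrow : ∀ {k : ℝ × ℝ → ℝ}, ContinuousOn k (Iio b ×ˢ univ) →
      ∀ x < b, Continuous (fun θ => k (x, θ)) := by
    intro k hk x hx
    have : Continuous (fun θ : ℝ => (x, θ)) := by fun_prop
    rw [← continuousOn_univ] at this ⊢
    exact hk.comp this (fun θ _ => ⟨hx, mem_univ _⟩)
  -- derivatives in s and θ
  have ds : ∀ (V : ℂ → ℂ) (V' : ℂ) (s θ : ℝ), HasDerivAt V V' ((s:ℂ) + θ * Complex.I) →
      HasDerivAt (fun s : ℝ => (V ((s:ℂ) + θ * Complex.I)).re) V'.re s := by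
    intro V V' s θ h
    have h1 : HasDerivAt (fun x : ℂ => x + θ * Complex.I) 1 (s : ℂ) :=
      (hasDerivAt_id _).add_const _
    have := (HasDerivAt.comp (s : ℂ) h h1).real_of_complex
    simpa using this
  have dt : ∀ (V : ℂ → ℂ) (V' : ℂ) (s θ : ℝ), HasDerivAt V V' ((s:ℂ) + θ * Complex.I) →
      HasDerivAt (fun θ : ℝ => (V ((s:ℂ) + θ * Complex.I)).re) (-V'.im) θ := by
    intro V V' s θ h
    have h1 : HasDerivAt (fun x : ℂ => (s:ℂ) + x * Complex.I) (Complex.I) (θ : ℂ) := by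
      simpa using ((hasDerivAt_id (θ:ℂ)).mul_const Complex.I).const_add (s:ℂ)
    have := (HasDerivAt.comp (θ : ℂ) h h1).real_of_complex
    simpa using this
  have dt' : ∀ (V : ℂ → ℂ) (V' : ℂ) (s θ : ℝ), HasDerivAt V V' ((s:ℂ) + θ * Complex.I) →
      HasDerivAt (fun θ : ℝ => (V ((s:ℂ) + θ * Complex.I)).im) (V'.re) θ := by
    intro V V' s θ h
    have := dt (fun w => -Complex.I * V w) (-Complex.I * V') s θ (h.const_mul _)
    simpa using this
  refine ⟨fun s => ∫ θ in (0:ℝ)..(2*π), A' (W (s + θ * Complex.I)).re *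
    (deriv W (s + θ * Complex.I)).re, fun s hs => ⟨?_, ?_,
    hrow (cA hcA) s hs, hrow ((cA hA'').mul ((cW hW1).norm.pow 2)) s hs⟩⟩
  · refine ks_param (fun s θ => A (W (s + θ * Complex.I)).re)
      (fun s θ => A' (W (s + θ * Complex.I)).re * (deriv W (s + θ * Complex.I)).re) b
      (cA hcA) ((cA hcA').mul (cre hW1)) ?_ s hs
    intro s hs θ
    have hs' : ((s : ℂ) + θ * Complex.I).re < b := by rw [hre]; exact hs
    exact HasDerivAt.comp s (hA _ (hWc _ hs')) (ds W _ s θ (hd _ hs'))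
  · have key := ks_param (fun s θ => A' (W (s + θ * Complex.I)).re *
        (deriv W (s + θ * Complex.I)).re)
      (fun s θ => A'' (W (s + θ * Complex.I)).re * (deriv W (s + θ * Complex.I)).re *
        (deriv W (s + θ * Complex.I)).re + A' (W (s + θ * Complex.I)).re *
        (deriv (deriv W) (s + θ * Complex.I)).re) b
      ((cA hcA').mul (cre hW1))
      ((((cA hA'').mul (cre hW1)).mul (cre hW1)).add ((cA hcA').mul (cre hW2))) ?_ s hs
    · convert key using 1
      have hzero : ∫ θ in (0:ℝ)..(2*π), (A'' (W (s + θ * Complex.I)).re *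
          (deriv W (s + θ * Complex.I)).im * (deriv W (s + θ * Complex.I)).im
          - A' (W (s + θ * Complex.I)).re * (deriv (deriv W) (s + θ * Complex.I)).re) = 0 := by
        rw [intervalIntegral.integral_eq_sub_of_hasDerivAt
          (f := fun θ : ℝ => - (A' (W (s + θ * Complex.I)).re * (deriv W (s + θ * Complex.I)).im))]
        · have hp1 : ∀ w, deriv W (w + 2 * π * Complex.I) = deriv W w := by
            intro w
            rw [← deriv_comp_add_const]
            congr 1; funext w; exact hper w
          have e1 := hper s
          have e2 := hp1 s
          push_cast
          rw [e1, e2]; simp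
        · intro θ _
          have hs' : ((s : ℂ) + θ * Complex.I).re < b := by rw [hre]; exact hs
          have := ((HasDerivAt.comp θ (hA' _ (hWc _ hs')) (dt W _ s θ (hd _ hs'))).mul
            (dt' _ _ s θ (hd1 _ hs'))).neg
          refine this.congr_deriv ?_
          simp only [Function.comp]; ring
        · exact ((hrow ((((cA hA'').mul (cim hW1)).mul (cim hW1)).sub
            ((cA hcA').mul (cre hW2))) s hs)).intervalIntegrable _ _
      have hsum : (∫ θ in (0:ℝ)..(2*π), (A'' (W (s + θ * Complex.I)).re *
          (deriv W (s + θ * Complex.I)).re * (deriv W (s + θ * Complex.I)).re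
          + A' (W (s + θ * Complex.I)).re * (deriv (deriv W) (s + θ * Complex.I)).re)) =
          (∫ θ in (0:ℝ)..(2*π), (A'' (W (s + θ * Complex.I)).re *
          (deriv W (s + θ * Complex.I)).re * (deriv W (s + θ * Complex.I)).re
          + A' (W (s + θ * Complex.I)).re * (deriv (deriv W) (s + θ * Complex.I)).re)) +
          ∫ θ in (0:ℝ)..(2*π), (A'' (W (s + θ * Complex.I)).re *
          (deriv W (s + θ * Complex.I)).im * (deriv W (s + θ * Complex.I)).im
          - A' (W (s + θ * Complex.I)).re * (deriv (deriv W) (s + θ * Complex.I)).re) := by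
        rw [hzero, add_zero]
      rw [hsum, ← intervalIntegral.integral_add]
      · refine intervalIntegral.integral_congr fun θ _ => ?_
        rw [Complex.sq_norm, Complex.normSq_apply]; ring
      · exact ((hrow ((((cA hA'').mul (cre hW1)).mul (cre hW1)).add
            ((cA hcA').mul (cre hW2))) s hs)).intervalIntegrable _ _
      · exact ((hrow ((((cA hA'').mul (cim hW1)).mul (cim hW1)).sub
            ((cA hcA').mul (cre hW2))) s hs)).intervalIntegrable _ _
    · intro s hs θ
      have hs' : ((s : ℂ) + θ * Complex.I).re < b := by rw [hre]; exact hs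
      exact (HasDerivAt.comp s (hA' _ (hWc _ hs')) (ds W _ s θ (hd _ hs'))).mul
        (ds _ _ s θ (hd1 _ hs'))

lemma ks_A1 (α a : ℝ) (ha : 0 < a) :
    HasDerivAt (fun a => exp a * (2 * a) ^ (-α))
      (exp a * ((2 * a) ^ (-α) - 2 * α * (2 * a) ^ (-α - 1))) a := by
  have h2 : HasDerivAt (fun a : ℝ => 2 * a) 2 a := by
    simpa using (hasDerivAt_id a).const_mul 2
  have h3 := h2.rpow_const (p := -α) (Or.inl (by positivity))
  refine ((Real.hasDerivAt_exp a).mul h3).congr_deriv ?_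
  ring

lemma ks_A1' (α a : ℝ) (ha : 0 < a) :
    HasDerivAt (fun a => exp a * ((2 * a) ^ (-α) - 2 * α * (2 * a) ^ (-α - 1)))
      (exp a * ((2 * a) ^ (-α) - 4 * α * (2 * a) ^ (-α - 1)
        + 4 * α * (α + 1) * (2 * a) ^ (-α - 2))) a := by
  have h2 : HasDerivAt (fun a : ℝ => 2 * a) 2 a := by
    simpa using (hasDerivAt_id a).const_mul 2
  have h3 := h2.rpow_const (p := -α) (Or.inl (by positivity))
  have h4 := h2.rpow_const (p := -α-1) (Or.inl (by positivity))
  refine ((Real.hasDerivAt_exp a).mul (h3.sub (h4.const_mul (2 * α)))).congr_deriv ?_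
  rw [show -α - 1 - 1 = -α - 2 by ring]
  simp only [Pi.sub_apply]
  ring

lemma ks_A2 (β x : ℝ) (hx : 1 < x) :
    HasDerivAt (fun x => x * (2 * log x) ^ (-β))
      ((2 * log x) ^ (-β) - 2 * β * (2 * log x) ^ (-β - 1)) x := by
  have hl := Real.log_pos hx
  have hx0 : x ≠ 0 := by positivity
  have h2 : HasDerivAt (fun a : ℝ => 2 * log a) (2 * x⁻¹) x :=
    (Real.hasDerivAt_log hx0).const_mul 2
  have h3 := h2.rpow_const (p := -β) (Or.inl (by positivity))
  refine ((hasDerivAt_id x).mul h3).congr_deriv ?_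
  simp only [id]; field_simp; ring

lemma ks_A2' (β x : ℝ) (hx : 1 < x) :
    HasDerivAt (fun x => (2 * log x) ^ (-β) - 2 * β * (2 * log x) ^ (-β - 1))
      (x⁻¹ * (-2 * β * (2 * log x) ^ (-β - 1) + 4 * β * (β + 1) * (2 * log x) ^ (-β - 2))) x := by
  have hl := Real.log_pos hx
  have hx0 : x ≠ 0 := by positivity
  have h2 : HasDerivAt (fun a : ℝ => 2 * log a) (2 * x⁻¹) x :=
    (Real.hasDerivAt_log hx0).const_mul 2
  have h3 := h2.rpow_const (p := -β) (Or.inl (by positivity))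
  have h4 := h2.rpow_const (p := -β-1) (Or.inl (by positivity))
  refine (h3.sub (h4.const_mul (2 * β))).congr_deriv ?_
  rw [show -β - 1 - 1 = -β - 2 by ring]
  ring

lemma ks_A1c (α : ℝ) : ContinuousOn (fun a => exp a * ((2 * a) ^ (-α) - 4 * α * (2 * a) ^ (-α - 1)
        + 4 * α * (α + 1) * (2 * a) ^ (-α - 2))) (Ioi 0) := by
  have h : ∀ p : ℝ, ContinuousOn (fun a : ℝ => (2 * a) ^ p) (Ioi 0) := fun p =>
    ContinuousOn.rpow_const (by fun_prop) fun a ha => Or.inl (mul_pos two_pos ha).ne'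
  exact Real.continuous_exp.continuousOn.mul
    (((h _).sub (continuousOn_const.mul (h _))).add (continuousOn_const.mul (h _)))

lemma ks_A2c (β : ℝ) : ContinuousOn (fun x => x⁻¹ * (-2 * β * (2 * log x) ^ (-β - 1)
    + 4 * β * (β + 1) * (2 * log x) ^ (-β - 2))) (Ioi 1) := by
  have h0 : ∀ x ∈ Ioi (1:ℝ), x ≠ 0 := fun x hx => (zero_lt_one.trans hx).ne'
  have h : ∀ p : ℝ, ContinuousOn (fun a : ℝ => (2 * log a) ^ p) (Ioi 1) := fun p =>
    ContinuousOn.rpow_const (continuousOn_const.mul (continuousOn_id.log h0))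
      fun a ha => Or.inl (mul_pos two_pos (Real.log_pos ha)).ne'
  exact (continuousOn_id.inv₀ h0).mul
    ((continuousOn_const.mul (h _)).add (continuousOn_const.mul (h _)))

/-- pointwise inequality -/
lemma ks_ineq (α x ρ d : ℝ) (hα : 1 < α) (hx : exp (α + 1) < x) (hρ : x ≤ ρ) :
    exp (log ρ) * ((2 * log ρ) ^ (-α) - 4 * α * (2 * log ρ) ^ (-α - 1)
        + 4 * α * (α + 1) * (2 * log ρ) ^ (-α - 2)) * (d / ρ) ^ 2 +
    (α + 1) / (α - 1) * (x⁻¹ * (-2 * (α - 1) * (2 * log x) ^ (-(α - 1) - 1)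
      + 4 * (α - 1) * ((α - 1) + 1) * (2 * log x) ^ (-(α - 1) - 2)) * d ^ 2) ≤ 0 := by
  have hx0 : 0 < x := (exp_pos _).trans hx
  have hρ0 : 0 < ρ := hx0.trans_le hρ
  have hlx : α + 1 < log x := (Real.lt_log_iff_exp_lt hx0).2 hx
  have hll : log x ≤ log ρ := Real.log_le_log hx0 hρ
  set l := 2 * log x with hl
  set L := 2 * log ρ with hL
  have hl0 : 0 < l := by linarith
  have hL0 : 0 < L := by linarith
  have e1 : ∀ y : ℝ, 0 < y → y ^ (-α - 1) = y ^ (-α) / y := fun y hy => by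
    rw [Real.rpow_sub hy, Real.rpow_one]
  have e2 : ∀ y : ℝ, 0 < y → y ^ (-α - 2) = y ^ (-α) / y ^ 2 := fun y hy => by
    rw [Real.rpow_sub hy]; norm_num
  rw [Real.exp_log hρ0, e1 L hL0, e2 L hL0, show -(α - 1) - 1 = -α by ring,
    show -(α - 1) - 2 = -α - 1 by ring, e1 l hl0]
  have hp : 0 < L ^ (-α) := Real.rpow_pos_of_pos hL0 _
  have hpl : 0 < l ^ (-α) := Real.rpow_pos_of_pos hl0 _
  have hmono : L ^ (-α) ≤ l ^ (-α) :=
    Real.rpow_le_rpow_of_nonpos hl0 (by linarith) (by linarith)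
  have b1 : L ^ (-α) - 4 * α * (L ^ (-α) / L) + 4 * α * (α + 1) * (L ^ (-α) / L ^ 2)
      ≤ L ^ (-α) := by
    have : 4 * α * (α + 1) * (L ^ (-α) / L ^ 2) ≤ 4 * α * (L ^ (-α) / L) := by
      have h : (α + 1) * (L ^ (-α) / L ^ 2) ≤ L ^ (-α) / L := by
        rw [mul_div_assoc', div_le_div_iff₀ (by positivity) hL0]
        have : (α + 1) ≤ L := by linarith
        calc (α + 1) * L ^ (-α) * L ≤ L * L ^ (-α) * L := by gcongr
          _ = L ^ (-α) * L ^ 2 := by ring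
      calc _ = 4 * α * ((α + 1) * (L ^ (-α) / L ^ 2)) := by ring
        _ ≤ _ := by gcongr
    linarith
  have b2 : (α + 1) / (α - 1) * (x⁻¹ * (-2 * (α - 1) * l ^ (-α)
      + 4 * (α - 1) * ((α - 1) + 1) * (l ^ (-α) / l)) * d ^ 2) ≤ - (x⁻¹ * l ^ (-α) * d ^ 2) := by
    have hne : α - 1 ≠ 0 := by linarith
    have : (α + 1) / (α - 1) * (x⁻¹ * (-2 * (α - 1) * l ^ (-α)
      + 4 * (α - 1) * ((α - 1) + 1) * (l ^ (-α) / l)) * d ^ 2) =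
      - (x⁻¹ * l ^ (-α) * d ^ 2) * (2 * (α + 1) * (1 - 2 * α / l)) := by
      field_simp; ring
    rw [this]
    have h1 : 1 ≤ 2 * (α + 1) * (1 - 2 * α / l) := by
      have : 2 * α / l ≤ α / (α + 1) := by
        rw [div_le_div_iff₀ hl0 (by linarith)]
        nlinarith
      have h3 : α / (α + 1) = 1 - 1 / (α + 1) := by
        have : α + 1 ≠ 0 := by linarith
        field_simp; ring
      have h4 : (α + 1) * (1 / (α + 1)) = 1 := by
        have : α + 1 ≠ 0 := by linarith
        field_simp
      nlinarith
    have h2 : 0 ≤ x⁻¹ * l ^ (-α) * d ^ 2 := by positivity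
    nlinarith
  have b3 : ρ * (L ^ (-α) - 4 * α * (L ^ (-α) / L) + 4 * α * (α + 1) * (L ^ (-α) / L ^ 2))
      * (d / ρ) ^ 2 ≤ x⁻¹ * l ^ (-α) * d ^ 2 := by
    calc _ ≤ ρ * L ^ (-α) * (d / ρ) ^ 2 := by gcongr
      _ = ρ⁻¹ * L ^ (-α) * d ^ 2 := by field_simp
      _ ≤ x⁻¹ * l ^ (-α) * d ^ 2 := by gcongr
  linarith

noncomputable def ksG (α : ℝ) (w : ℂ) : ℝ :=
  exp (log ‖w‖) * (2 * log ‖w‖) ^ (-α) +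
    (α + 1) / (α - 1) * (w.re * (2 * log w.re) ^ (-(α - 1)))

lemma ksG_cont (α : ℝ) (hα : 1 < α) : ContinuousOn (ksG α) {w | exp (α + 1) < w.re} := by
  have h1 : ∀ w ∈ {w : ℂ | exp (α + 1) < w.re}, 0 < w.re ∧ 0 < ‖w‖ ∧ 0 < log w.re
      ∧ 0 < log ‖w‖ := by
    intro w hw
    have h0 : 1 < w.re := lt_trans (by rw [Real.one_lt_exp_iff]; linarith) hw
    have h2 : w.re ≤ ‖w‖ := Complex.re_le_norm w
    exact ⟨by linarith, by linarith, Real.log_pos h0, Real.log_pos (by linarith)⟩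
  have c1 : ContinuousOn (fun w : ℂ => log ‖w‖) {w | exp (α + 1) < w.re} :=
    continuous_norm.continuousOn.log (fun w hw => (h1 w hw).2.1.ne')
  have c2 : ContinuousOn (fun w : ℂ => log w.re) {w | exp (α + 1) < w.re} :=
    Complex.continuous_re.continuousOn.log (fun w hw => (h1 w hw).1.ne')
  unfold ksG
  refine ((Real.continuous_exp.comp_continuousOn c1).mul
    ((continuousOn_const.mul c1).rpow_const fun w hw => Or.inl ?_)).add
    (continuousOn_const.mul (Complex.continuous_re.continuousOn.mul
    ((continuousOn_const.mul c2).rpow_const fun w hw => Or.inl ?_)))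
  · exact (mul_pos two_pos (h1 w hw).2.2.2).ne'
  · exact (mul_pos two_pos (h1 w hw).2.2.1).ne'

lemma ksG_nonneg (α : ℝ) (hα : 1 < α) (w : ℂ) (hw : exp (α + 1) < w.re) : 0 ≤ ksG α w := by
  have h0 : 1 < w.re := lt_trans (by rw [Real.one_lt_exp_iff]; linarith) hw
  have h2 : w.re ≤ ‖w‖ := Complex.re_le_norm w
  have := Real.log_pos h0
  have := Real.log_pos (h0.trans_le h2)
  have : 0 < α - 1 := by linarith
  unfold ksG
  positivity

lemma ks_disc (α R : ℝ) (hα : 1 < α) (hR : 1 < R) (F : ℂ → ℂ)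
    (hF : DifferentiableOn ℂ F (Metric.ball 0 R))
    (hFr : ∀ w ∈ Metric.ball (0:ℂ) R, exp (α + 1) < (F w).re) :
    ∫ θ in (0:ℝ)..(2*π), ksG α (F (Complex.exp (θ * Complex.I))) ≤ 2 * π * ksG α (F 0) := by
  set b := log R with hb
  have hb0 : 0 < b := Real.log_pos hR
  have hmem : ∀ w : ℂ, w.re < b → Complex.exp w ∈ Metric.ball (0:ℂ) R := by
    intro w hw
    rw [mem_ball_zero_iff, Complex.norm_exp]
    exact (Real.lt_log_iff_exp_lt (by linarith)).1 hw
  have ho : IsOpen {w : ℂ | w.re < b} := isOpen_lt Complex.continuous_re continuous_const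
  set V : ℂ → ℂ := fun w => F (Complex.exp w) with hV
  have hVr : ∀ w : ℂ, w.re < b → exp (α + 1) < (V w).re := fun w hw => hFr _ (hmem w hw)
  have hVd : DifferentiableOn ℂ V {w | w.re < b} :=
    hF.comp Complex.differentiable_exp.differentiableOn (fun w hw => hmem w hw)
  have hVper : ∀ w, V (w + 2 * π * Complex.I) = V w := by
    intro w; simp only [hV]; rw [Complex.exp_periodic w]
  have hVslit : ∀ w : ℂ, w.re < b → V w ∈ Complex.slitPlane := fun w hw =>
    Or.inl ((exp_pos _).trans (hVr w hw))
  set W : ℂ → ℂ := fun w => Complex.log (V w) with hW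
  have hWd : DifferentiableOn ℂ W {w | w.re < b} := hVd.clog hVslit
  have hWper : ∀ w, W (w + 2 * π * Complex.I) = W w := by
    intro w; simp only [hW, hVper]
  have hWre : ∀ w, (W w).re = log ‖V w‖ := fun w => Complex.log_re _
  have hWc : ∀ w : ℂ, w.re < b → 0 < (W w).re := by
    intro w hw
    rw [hWre]
    refine Real.log_pos (lt_of_lt_of_le (lt_trans ?_ (hVr w hw)) (Complex.re_le_norm _))
    rw [Real.one_lt_exp_iff]; linarith
  have hWder : ∀ w : ℂ, w.re < b → deriv W w = deriv V w / V w := fun w hw =>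
    (((hVd.differentiableAt (ho.mem_nhds hw)).hasDerivAt).clog (hVslit w hw)).deriv
  have hone : 1 < exp (α + 1) := by rw [Real.one_lt_exp_iff]; linarith
  obtain ⟨Q1, hQ1⟩ := ks_hardy _ _ _ 0 b W (ks_A1 α) (ks_A1' α) (ks_A1c α) hWd hWc hWper
  obtain ⟨Q2, hQ2⟩ := ks_hardy _ _ _ 1 b V (ks_A2 (α - 1)) (ks_A2' (α - 1)) (ks_A2c (α - 1)) hVd (fun w hw => hone.trans (hVr w hw)) hVper
  set C := (α + 1) / (α - 1) with hC
  set P : ℝ → ℝ := fun s => ∫ θ in (0:ℝ)..(2*π), ksG α (V (s + θ * Complex.I)) with hP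
  have hPeq : ∀ s < b, P s = (∫ θ in (0:ℝ)..(2*π), exp (W (s + θ * Complex.I)).re *
      (2 * (W (s + θ * Complex.I)).re) ^ (-α)) + C * ∫ θ in (0:ℝ)..(2*π),
      (V (s + θ * Complex.I)).re * (2 * log (V (s + θ * Complex.I)).re) ^ (-(α-1)) := by
    intro s hs
    obtain ⟨-, -, h1, -⟩ := hQ1 s hs
    obtain ⟨-, -, h2, -⟩ := hQ2 s hs
    rw [← intervalIntegral.integral_const_mul, ← intervalIntegral.integral_add
      (h1.intervalIntegrable _ _) ((h2.const_mul C).intervalIntegrable _ _)]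
    simp only [hP, ksG, hWre, hC]
  have hPd : ∀ s < b, HasDerivAt P (Q1 s + C * Q2 s) s := by
    intro s hs
    refine ((hQ1 s hs).1.add ((hQ2 s hs).1.const_mul C)).congr_of_eventuallyEq ?_
    filter_upwards [Iio_mem_nhds hs] with x hx
    exact hPeq x hx
  have hQanti : AntitoneOn (fun s => Q1 s + C * Q2 s) (Iio b) := by
    have hd := fun (s : ℝ) (hs : s < b) =>
      (hQ1 s hs).2.1.add ((hQ2 s hs).2.1.const_mul C)
    refine antitoneOn_of_deriv_nonpos (convex_Iio b)
      (fun s hs => (hd s hs).continuousAt.continuousWithinAt) ?_ ?_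
    · rw [interior_Iio]
      exact fun s hs => (hd s hs).differentiableAt.differentiableWithinAt
    · rw [interior_Iio]
      intro s hs
      refine le_trans (le_of_eq (hd s hs).deriv) ?_
      obtain ⟨-, -, -, h1⟩ := hQ1 s hs
      obtain ⟨-, -, -, h2⟩ := hQ2 s hs
      rw [← intervalIntegral.integral_const_mul, ← intervalIntegral.integral_add
        (h1.intervalIntegrable _ _) ((h2.const_mul C).intervalIntegrable _ _)]
      rw [← neg_nonneg, ← intervalIntegral.integral_neg]
      refine intervalIntegral.integral_nonneg_of_forall (by positivity) ?_
      intro θ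
      rw [neg_nonneg]
      have hs' : ((s : ℂ) + θ * Complex.I).re < b := by simpa using hs
      have := ks_ineq α (V (s + θ * Complex.I)).re ‖V (s + θ * Complex.I)‖
        ‖deriv V (s + θ * Complex.I)‖ hα (hVr _ hs') (Complex.re_le_norm _)
      rw [hWre, hWder _ hs', norm_div]
      exact this
  have hPnn : ∀ s < b, 0 ≤ P s := by
    intro s hs
    refine intervalIntegral.integral_nonneg_of_forall (by positivity) fun θ => ?_
    exact ksG_nonneg α hα _ (hVr _ (by simpa using hs))
  have hQneg : ∀ s < b, Q1 s + C * Q2 s ≤ 0 := by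
    intro s hs
    by_contra! hq
    set q := Q1 s + C * Q2 s with hqd
    set t := s - (P s + 1) / q with ht
    have hts : t < s := by
      have : 0 < (P s + 1) / q := by have := hPnn s hs; positivity
      linarith
    obtain ⟨c, hc, hcd⟩ := exists_hasDerivAt_eq_slope P (fun s => Q1 s + C * Q2 s) hts
      (fun x hx => (hPd x (hx.2.trans_lt hs)).continuousAt.continuousWithinAt)
      (fun x hx => hPd x (hx.2.trans hs))
    have h1 : q ≤ Q1 c + C * Q2 c := hQanti (hc.2.trans hs) hs hc.2.le
    rw [hcd, le_div_iff₀ (by linarith)] at h1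
    have h2 : q * (s - t) = P s + 1 := by rw [ht]; field_simp; ring
    have := hPnn t (hts.trans hs)
    linarith
  have hPanti : AntitoneOn P (Iio b) := by
    refine antitoneOn_of_deriv_nonpos (convex_Iio b)
      (fun s hs => (hPd s hs).continuousAt.continuousWithinAt) ?_ ?_
    · rw [interior_Iio]
      exact fun s hs => (hPd s hs).differentiableAt.differentiableWithinAt
    · rw [interior_Iio]
      intro s hs
      rw [(hPd s hs).deriv]; exact hQneg s hs
  have hgoal : (∫ θ in (0:ℝ)..(2*π), ksG α (F (Complex.exp (θ * Complex.I)))) = P 0 := by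
    simp [hP, hV]
  rw [hgoal]
  have h0R : (0:ℂ) ∈ Metric.ball (0:ℂ) R := Metric.mem_ball_self (by linarith)
  have hcont : ContinuousAt (fun ζ => ksG α (F ζ)) 0 := by
    have : ContinuousOn (fun ζ => ksG α (F ζ)) (Metric.ball 0 R) :=
      (ksG_cont α hα).comp hF.continuousOn hFr
    exact this.continuousAt (Metric.isOpen_ball.mem_nhds h0R)
  refine le_of_forall_pos_le_add fun ε hε => ?_
  obtain ⟨δ, hδ, hδ'⟩ := Metric.continuousAt_iff.1 hcont (ε / (2 * π)) (by positivity)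
  set s := min 0 (log (δ / 2)) with hs
  have hs0 : s < b := (min_le_left _ _).trans_lt hb0
  refine (hPanti hs0 hb0 (min_le_left _ _)).trans ?_
  have hI : P s ≤ ∫ θ in (0:ℝ)..(2*π), (ksG α (F 0) + ε / (2 * π)) := by
    refine intervalIntegral.integral_mono_on (by positivity) ?_ (by simp) ?_
    · obtain ⟨-, -, h1, -⟩ := hQ1 s hs0
      obtain ⟨-, -, h2, -⟩ := hQ2 s hs0
      have := h1.add (h2.const_mul C)
      simp only [hWre] at this
      exact Continuous.intervalIntegrable this _ _
    · intro θ _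
      have : dist (Complex.exp (s + θ * Complex.I)) 0 < δ := by
        rw [dist_zero_right, Complex.norm_exp]
        have h1 : ((s : ℂ) + θ * Complex.I).re = s := by simp
        rw [h1]
        calc exp s ≤ exp (log (δ / 2)) := by gcongr; exact min_le_right _ _
          _ = δ / 2 := Real.exp_log (by positivity)
          _ < δ := by linarith
      have := hδ' this
      rw [Real.dist_eq] at this
      have := (abs_lt.1 this).2
      simp only [hV]
      linarith
  refine hI.trans (le_of_eq ?_)
  rw [intervalIntegral.integral_const, smul_eq_mul]
  have := Real.pi_pos
  field_simp
  ring

lemma ks_rot {n : ℕ} (z₀ : EuclideanSpace ℂ (Fin n)) (r : ℝ) (c : ℂ) (hc : ‖c‖ = 1)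
    (g : EuclideanSpace ℂ (Fin n) → ℝ) :
    ∫ z, g (z₀ + c • (z - z₀)) ∂(sphereUnifMeasure n z₀ r) =
      ∫ z, g z ∂(sphereUnifMeasure n z₀ r) := by
  have hc0 : c ≠ 0 := by rw [← norm_ne_zero_iff, hc]; norm_num
  let e : EuclideanSpace ℂ (Fin n) ≃ᵢ EuclideanSpace ℂ (Fin n) :=
    IsometryEquiv.mk' (fun z => z₀ + c • (z - z₀)) (fun z => z₀ + c⁻¹ • (z - z₀))
      (fun z => by simp [smul_smul, hc0])
      (Isometry.of_dist_eq fun x y => by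
        rw [dist_eq_norm, dist_eq_norm, add_sub_add_left_eq_sub, ← smul_sub, norm_smul, hc]
        simp)
  have he : ∀ z, e z = z₀ + c • (z - z₀) := fun z => rfl
  have h1 := e.measurePreserving_hausdorffMeasure (2 * (n : ℝ) - 1)
  have hpre : e ⁻¹' Metric.sphere z₀ r = Metric.sphere z₀ r := by
    ext z
    rw [mem_preimage, mem_sphere_iff_norm, mem_sphere_iff_norm, he, add_sub_cancel_left,
      norm_smul, hc, one_mul]
  have h2 := h1.restrict_preimage (s := Metric.sphere z₀ r) Metric.isClosed_sphere.measurableSet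
  rw [hpre] at h2
  have h3 : MeasurePreserving e (sphereUnifMeasure n z₀ r) (sphereUnifMeasure n z₀ r) :=
    h2.smul_measure _
  exact h3.integral_comp e.toHomeomorph.measurableEmbedding g

lemma ks_mean (n : ℕ) (Ω : Set (EuclideanSpace ℂ (Fin n)))
    (hΩ : IsOpen Ω) (z₀ : EuclideanSpace ℂ (Fin n)) (r : ℝ) (hr : 0 < r)
    (hball : Metric.closedBall z₀ r ⊆ Ω) (F : EuclideanSpace ℂ (Fin n) → ℂ)
    (hf : DifferentiableOn ℂ F Ω) (α : ℝ) (hα : 1 < α) (hu : ∀ z ∈ Ω, exp (α + 1) < (F z).re)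
    [IsProbabilityMeasure (sphereUnifMeasure n z₀ r)]
    (hres : (sphereUnifMeasure n z₀ r).restrict (Metric.sphere z₀ r) = sphereUnifMeasure n z₀ r) :
    ∫ z, ksG α (F z) ∂(sphereUnifMeasure n z₀ r) ≤ ksG α (F z₀) := by
  set σ := sphereUnifMeasure n z₀ r with hσ
  have hgc : ContinuousOn (fun z => ksG α (F z)) Ω := (ksG_cont α hα).comp hf.continuousOn hu
  have hslice : ∀ z ∈ Metric.sphere z₀ r,
      ∫ θ in (0:ℝ)..(2*π), ksG α (F (z₀ + Complex.exp (θ * Complex.I) • (z - z₀))) ≤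
        2 * π * ksG α (F z₀) := by
    intro z hz
    have hz' : ‖z - z₀‖ = r := by rwa [mem_sphere_iff_norm] at hz
    obtain ⟨δ, hδ, hδ'⟩ := (isCompact_closedBall z₀ r).exists_thickening_subset_open hΩ hball
    rw [thickening_closedBall hδ hr.le] at hδ'
    have hm : ∀ w ∈ Metric.ball (0:ℂ) ((δ + r) / r), z₀ + w • (z - z₀) ∈ Ω := by
      intro w hw
      apply hδ'
      rw [mem_ball_zero_iff, lt_div_iff₀ hr] at hw
      rw [mem_ball_iff_norm, add_sub_cancel_left, norm_smul, hz']
      exact hw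
    have := ks_disc α ((δ + r) / r) hα (by rw [lt_div_iff₀ hr]; linarith)
      (fun w => F (z₀ + w • (z - z₀))) ?_ (fun w hw => hu _ (hm w hw))
    · simpa using this
    · refine hf.comp ?_ hm
      fun_prop
  have hjoint : Integrable (Function.uncurry fun (θ : ℝ) (z : EuclideanSpace ℂ (Fin n)) =>
      ksG α (F (z₀ + Complex.exp (θ * Complex.I) • (z - z₀))))
      ((volume.restrict (Ioc 0 (2 * π))).prod σ) := by
    have hsub : Icc (0:ℝ) (2 * π) ×ˢ Metric.sphere z₀ r ⊆ Icc (0:ℝ) (2 * π) ×ˢ Metric.sphere z₀ r :=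
      subset_rfl
    have : IntegrableOn (Function.uncurry fun (θ : ℝ) (z : EuclideanSpace ℂ (Fin n)) =>
      ksG α (F (z₀ + Complex.exp (θ * Complex.I) • (z - z₀))))
      (Icc (0:ℝ) (2 * π) ×ˢ Metric.sphere z₀ r) ((volume : Measure ℝ).prod σ) := by
      refine ContinuousOn.integrableOn_compact (isCompact_Icc.prod (isCompact_sphere z₀ r)) ?_
      refine hgc.comp (f := fun p : ℝ × EuclideanSpace ℂ (Fin n) =>
        z₀ + Complex.exp (p.1 * Complex.I) • (p.2 - z₀)) ?_ ?_
      · fun_prop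
      · rintro ⟨θ, z⟩ ⟨-, hz⟩
        apply hball
        have hz' : ‖z - z₀‖ = r := by simpa [mem_sphere_iff_norm] using hz
        rw [mem_closedBall_iff_norm, add_sub_cancel_left, norm_smul, hz',
          Complex.norm_exp_ofReal_mul_I, one_mul]
    rw [← hres, Measure.prod_restrict]
    exact this.mono_set (prod_mono Ioc_subset_Icc_self subset_rfl)
  have h2π : (0:ℝ) ≤ 2 * π := by positivity
  have hleft : ∫ θ in (0:ℝ)..(2*π), ∫ z, ksG α (F (z₀ + Complex.exp (θ * Complex.I) • (z - z₀))) ∂σ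
      = 2 * π * ∫ z, ksG α (F z) ∂σ := by
    have : ∀ θ : ℝ, ∫ z, ksG α (F (z₀ + Complex.exp (θ * Complex.I) • (z - z₀))) ∂σ
        = ∫ z, ksG α (F z) ∂σ := fun θ =>
      ks_rot z₀ r _ (Complex.norm_exp_ofReal_mul_I θ) (fun z => ksG α (F z))
    simp only [this, intervalIntegral.integral_const, smul_eq_mul, sub_zero]
  rw [intervalIntegral.integral_of_le h2π, integral_integral_swap hjoint] at hleft
  have hle : ∫ z, (∫ θ in Ioc (0:ℝ) (2*π),
      ksG α (F (z₀ + Complex.exp (θ * Complex.I) • (z - z₀)))) ∂σ ≤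
      ∫ z, 2 * π * ksG α (F z₀) ∂σ := by
    refine integral_mono_ae hjoint.integral_prod_right (integrable_const _) ?_
    have : ∀ᵐ z ∂σ, z ∈ Metric.sphere z₀ r := by
      rw [← hres]; exact ae_restrict_mem Metric.isClosed_sphere.measurableSet
    filter_upwards [this] with z hz
    have := hslice z hz
    rwa [intervalIntegral.integral_of_le h2π] at this
  rw [hleft] at hle
  simp only [integral_const, probReal_univ, one_smul] at hle
  exact le_of_mul_le_mul_left hle (by positivity)

/-- **Kolmogorov-type proposition on spheres** (Proposition 3.1): if `f = u + iv` is holomorphic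
on an open set `Ω ⊆ ℂⁿ` containing the closed ball of center `z₀` and radius `r`, with `u > 0`
on `Ω`, then for every `α > 1`,
`∫_{S(z₀,r)} |f + e^{α+1}| / (log |f + e^{α+1}|²)^α dσ
  < |f(z₀) + e^{α+1}| / (log |f(z₀) + e^{α+1}|²)^α
    + ((α+1)/(α−1)) · (u(z₀) + e^{α+1}) / (log (u(z₀) + e^{α+1})²)^{α−1}`. -/
theorem kolmogorov_sphere (n : ℕ) (hn : 1 ≤ n) (Ω : Set (EuclideanSpace ℂ (Fin n)))
    (hΩ : IsOpen Ω) (z₀ : EuclideanSpace ℂ (Fin n)) (hz₀ : z₀ ∈ Ω) (r : ℝ) (hr : 0 < r)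
    (hball : Metric.closedBall z₀ r ⊆ Ω) (f : EuclideanSpace ℂ (Fin n) → ℂ)
    (hf : DifferentiableOn ℂ f Ω) (hu : ∀ z ∈ Ω, 0 < (f z).re) (α : ℝ) (hα : 1 < α) :
    ∫ z, ‖f z + (Real.exp (α + 1) : ℂ)‖ /
          (Real.log ((‖f z + (Real.exp (α + 1) : ℂ)‖) ^ 2)) ^ α
        ∂(sphereUnifMeasure n z₀ r)
      < ‖f z₀ + (Real.exp (α + 1) : ℂ)‖ /
          (Real.log ((‖f z₀ + (Real.exp (α + 1) : ℂ)‖) ^ 2)) ^ α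
        + (α + 1) / (α - 1) *
            (((f z₀).re + Real.exp (α + 1)) /
              (Real.log (((f z₀).re + Real.exp (α + 1)) ^ 2)) ^ (α - 1)) := by
  set F : EuclideanSpace ℂ (Fin n) → ℂ := fun z => f z + (Real.exp (α + 1) : ℂ) with hF
  have hFd : DifferentiableOn ℂ F Ω := hf.add_const _
  have hFre : ∀ z, (F z).re = (f z).re + exp (α + 1) := by
    intro z; simp only [hF, Complex.add_re]; rw [Complex.ofReal_re]
  have hFr : ∀ z ∈ Ω, exp (α + 1) < (F z).re := by
    intro z hz; rw [hFre]; have := hu z hz; linarith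
  have hone : 1 < exp (α + 1) := by rw [Real.one_lt_exp_iff]; linarith
  have hα0 : 0 < α - 1 := by linarith
  have hGeq : ∀ z ∈ Ω, ksG α (F z) = ‖F z‖ / (Real.log (‖F z‖ ^ 2)) ^ α +
      (α + 1) / (α - 1) * ((F z).re / (Real.log ((F z).re ^ 2)) ^ (α - 1)) := by
    intro z hz
    have h0 : 1 < (F z).re := hone.trans (hFr z hz)
    have h1 : 1 < ‖F z‖ := h0.trans_le (Complex.re_le_norm _)
    have l0 := Real.log_pos h0
    have l1 := Real.log_pos h1
    unfold ksG
    rw [Real.exp_log (by linarith), Real.rpow_neg (by positivity), Real.rpow_neg (by positivity),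
      Real.log_pow, Real.log_pow]
    simp only [div_eq_mul_inv, Nat.cast_ofNat]
  have hpos : ∀ z ∈ Ω, 0 < (α + 1) / (α - 1) *
      ((F z).re / (Real.log ((F z).re ^ 2)) ^ (α - 1)) := by
    intro z hz
    have h0 : 1 < (F z).re := hone.trans (hFr z hz)
    have l0 := Real.log_pos (one_lt_pow₀ h0 two_ne_zero)
    positivity
  have hrhs : ‖f z₀ + (Real.exp (α + 1) : ℂ)‖ /
          (Real.log ((‖f z₀ + (Real.exp (α + 1) : ℂ)‖) ^ 2)) ^ α
        + (α + 1) / (α - 1) *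
            (((f z₀).re + Real.exp (α + 1)) /
              (Real.log (((f z₀).re + Real.exp (α + 1)) ^ 2)) ^ (α - 1)) = ksG α (F z₀) := by
    rw [hGeq z₀ hz₀, hFre]
  rw [hrhs]
  change ∫ z, ‖F z‖ / (Real.log (‖F z‖ ^ 2)) ^ α ∂(sphereUnifMeasure n z₀ r) < _
  have hφ0 : ∀ z ∈ Ω, 0 ≤ ‖F z‖ / (Real.log (‖F z‖ ^ 2)) ^ α := by
    intro z hz
    have h0 : 1 < (F z).re := hone.trans (hFr z hz)
    have h1 : 1 < ‖F z‖ := h0.trans_le (Complex.re_le_norm _)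
    have l0 := Real.log_pos (one_lt_pow₀ h1 two_ne_zero)
    positivity
  have hG0 : 0 < ksG α (F z₀) := by
    rw [hGeq z₀ hz₀]; exact add_pos_of_nonneg_of_pos (hφ0 z₀ hz₀) (hpos z₀ hz₀)
  by_cases hm : (μH[2 * (n : ℝ) - 1] : Measure (EuclideanSpace ℂ (Fin n))) (Metric.sphere z₀ r) = 0
      ∨ (μH[2 * (n : ℝ) - 1] : Measure (EuclideanSpace ℂ (Fin n))) (Metric.sphere z₀ r) = ⊤
  · have hz : sphereUnifMeasure n z₀ r = 0 := by
      unfold sphereUnifMeasure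
      rcases hm with hm | hm
      · rw [Measure.restrict_eq_zero.2 hm, smul_zero]
      · rw [hm, ENNReal.inv_top, zero_smul]
    rw [hz, integral_zero_measure]
    exact hG0
  push Not at hm
  have hprob : IsProbabilityMeasure (sphereUnifMeasure n z₀ r) := by
    constructor
    unfold sphereUnifMeasure
    rw [Measure.smul_apply, Measure.restrict_apply_univ, smul_eq_mul]
    exact ENNReal.inv_mul_cancel hm.1 hm.2
  have hres : (sphereUnifMeasure n z₀ r).restrict (Metric.sphere z₀ r)
      = sphereUnifMeasure n z₀ r := by
    unfold sphereUnifMeasure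
    rw [Measure.restrict_smul, Measure.restrict_restrict Metric.isClosed_sphere.measurableSet,
      inter_self]
  refine lt_of_lt_of_le ?_ (ks_mean n Ω hΩ z₀ r hr hball F hFd α hα hFr hres)
  set σ := sphereUnifMeasure n z₀ r with hσ
  have hSΩ : Metric.sphere z₀ r ⊆ Ω := Metric.sphere_subset_closedBall.trans hball
  have hae : ∀ᵐ z ∂σ, z ∈ Metric.sphere z₀ r := by
    rw [← hres]; exact ae_restrict_mem Metric.isClosed_sphere.measurableSet
  have hint : ∀ k : EuclideanSpace ℂ (Fin n) → ℝ, ContinuousOn k Ω → Integrable k σ := by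
    intro k hk
    rw [← hres]
    exact (hk.mono hSΩ).integrableOn_compact (isCompact_sphere z₀ r)
  have i1 : Integrable (fun z => ksG α (F z)) σ :=
    hint _ ((ksG_cont α hα).comp hFd.continuousOn hFr)
  have i2 : Integrable (fun z => ‖F z‖ / (Real.log (‖F z‖ ^ 2)) ^ α) σ := by
    apply hint
    have h1 : ∀ z ∈ Ω, 1 < ‖F z‖ := fun z hz =>
      (hone.trans (hFr z hz)).trans_le (Complex.re_le_norm _)
    have hl : ∀ z ∈ Ω, 0 < Real.log (‖F z‖ ^ 2) := fun z hz =>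
      Real.log_pos (one_lt_pow₀ (h1 z hz) two_ne_zero)
    have cF := hFd.continuousOn.norm
    refine cF.div (((cF.pow 2).log fun z hz => ?_).rpow_const fun z hz => Or.inl (hl z hz).ne') ?_
    · have := h1 z hz; exact (pow_pos (by linarith) 2).ne'
    · intro z hz; exact (Real.rpow_pos_of_pos (hl z hz) _).ne'
  rw [← sub_pos, ← integral_sub i1 i2]
  have hd : ∀ z ∈ Ω, 0 < ksG α (F z) - ‖F z‖ / (Real.log (‖F z‖ ^ 2)) ^ α := by
    intro z hz
    rw [hGeq z hz, add_sub_cancel_left]; exact hpos z hz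
  refine (integral_pos_iff_support_of_nonneg_ae ?_ (i1.sub i2)).2 ?_
  rotate_left
  · have hone' : σ (Function.support fun z =>
        ksG α (F z) - ‖F z‖ / (Real.log (‖F z‖ ^ 2)) ^ α) = 1 := by
      rw [← measure_univ (μ := σ)]
      refine measure_congr ?_
      filter_upwards [hae] with z hz
      exact propext ⟨fun _ => trivial, fun _ => (hd z (hSΩ hz)).ne'⟩
    exact lt_of_lt_of_eq one_pos hone'.symm
  · filter_upwards [hae] with z hz
    exact (hd z (hSΩ hz)).le
end

section
/- Let α > 1 and let Ω ⊆ ℂⁿ be open. Let f be holomorphic on Ω with u := Re f satisfying u ≥ e^{α+1} on Ω (so that also |f| ≥ u ≥ e^{α+1}). Then the function φ(z) := −((α+1)/(α−1)) · u(z)/(log u(z)²)^{α−1} − |f(z)|/(log |f(z)|²)^α is plurisubharmonic on Ω. -/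
noncomputable def MM (β x : ℝ) : ℝ := √x * (Real.log x) ^ (-β)
noncomputable def KK (β x : ℝ) : ℝ := x⁻¹ * (1 / 2 - β * (Real.log x)⁻¹)
noncomputable def KK' (β x : ℝ) : ℝ :=
  x⁻¹ ^ 2 * (-(1 / 2 - β * (Real.log x)⁻¹) + β * (Real.log x)⁻¹ ^ 2)

lemma MM_deriv (β x : ℝ) (hx : 1 < x) : HasDerivAt (MM β) (MM β x * KK β x) x := by
  have h0 : 0 < x := by linarith
  have hL : 0 < Real.log x := Real.log_pos hx
  have h1 := (Real.hasDerivAt_sqrt h0.ne').mul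
    ((Real.hasDerivAt_log h0.ne').rpow_const (p := -β) (Or.inl hL.ne'))
  refine h1.congr_deriv ?_
  have hs : 0 < √x := Real.sqrt_pos.mpr h0
  have hsq : √x ^ 2 = x := Real.sq_sqrt h0.le
  have e : x⁻¹ = (√x)⁻¹ ^ 2 := by rw [inv_pow, hsq]
  simp only [MM, KK]
  rw [Real.rpow_sub_one hL.ne']
  rw [e]
  field_simp
  ring

lemma KK_deriv (β x : ℝ) (hx : 1 < x) : HasDerivAt (KK β) (KK' β x) x := by
  have h0 : 0 < x := by linarith
  have hL : 0 < Real.log x := Real.log_pos hx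
  have h1 := (hasDerivAt_inv h0.ne').mul
    ((((Real.hasDerivAt_log h0.ne').inv hL.ne').const_mul β).const_sub (1/2))
  refine h1.congr_deriv ?_
  simp only [KK']
  simp
  field_simp
  ring

/-- second derivative of a composition -/
lemma MM_comp (β : ℝ) (q q1 : ℝ → ℝ) (q2 : ℝ) (h : ∀ᶠ t in nhds 0, HasDerivAt q (q1 t) t)
    (h2 : HasDerivAt q1 q2 0) (hq : ∀ᶠ t in nhds (0:ℝ), 1 < q t) :
    (∀ᶠ t in nhds 0, HasDerivAt (fun t => MM β (q t)) (MM β (q t) * KK β (q t) * q1 t) t) ∧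
    HasDerivAt (fun t => MM β (q t) * KK β (q t) * q1 t)
      (MM β (q 0) * ((KK β (q 0) ^ 2 + KK' β (q 0)) * q1 0 ^ 2 + KK β (q 0) * q2)) 0 := by
  constructor
  · filter_upwards [h, hq] with t ht hqt
    exact (MM_deriv β _ hqt).comp t ht
  · have a := (MM_deriv β _ hq.self_of_nhds).comp 0 h.self_of_nhds
    have b := (KK_deriv β _ hq.self_of_nhds).comp 0 h.self_of_nhds
    refine ((a.mul b).mul h2).congr_deriv ?_
    simp only [Function.comp]
    simp
    ring

lemma second_line {E : Type*} [NormedAddCommGroup E] [NormedSpace ℝ E] (g : E → ℝ) (z w : E)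
    (hg : ∀ᶠ y in nhds z, DifferentiableAt ℝ g y) (h2 : DifferentiableAt ℝ (fderiv ℝ g) z)
    (p : ℝ → ℝ) (d : ℝ) (hp : ∀ᶠ t in nhds (0:ℝ), HasDerivAt (fun t : ℝ => g (z + t • w)) (p t) t)
    (hd : HasDerivAt p d 0) : fderiv ℝ (fderiv ℝ g) z w w = d := by
  have hl : ∀ t : ℝ, HasDerivAt (fun t : ℝ => z + t • w) w t := fun t => by
    simpa using ((hasDerivAt_id t).smul_const w).const_add z
  have hc : Filter.Tendsto (fun t : ℝ => z + t • w) (nhds 0) (nhds z) := by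
    simpa [ContinuousAt] using (hl 0).continuousAt
  have e : p =ᶠ[nhds 0] fun t => fderiv ℝ g (z + t • w) w := by
    filter_upwards [hp, hc.eventually hg] with t ht hgt
    exact ht.unique (hgt.hasFDerivAt.comp_hasDerivAt t (hl t))
  have h3 : HasFDerivAt (fderiv ℝ g) (fderiv ℝ (fderiv ℝ g) z) (z + (0:ℝ) • w) := by
    simpa using h2.hasFDerivAt
  have h4 : HasDerivAt (fun t : ℝ => fderiv ℝ g (z + t • w) w)
      (fderiv ℝ (fderiv ℝ g) z w w) 0 :=
    (ContinuousLinearMap.apply ℝ ℝ w).hasFDerivAt.comp_hasDerivAt (0:ℝ)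
      (h3.comp_hasDerivAt (0:ℝ) (hl 0))
  have h5 := h4.congr_of_eventuallyEq e
  exact h5.unique hd

lemma key_ineq (α : ℝ) (hα : 1 < α) (u r N : ℝ) (hu : Real.exp (α + 1) ≤ u) (hr : u ≤ r)
    (hN : 0 ≤ N) :
    0 ≤ -((α + 1) / (α - 1) * (MM (α - 1) (u ^ 2) * N * (4 * u ^ 2 * (KK (α - 1) (u ^ 2) ^ 2
        + KK' (α - 1) (u ^ 2)) + 2 * KK (α - 1) (u ^ 2))))
      - MM α (r ^ 2) * N * (4 * r ^ 2 * (KK α (r ^ 2) ^ 2 + KK' α (r ^ 2)) + 4 * KK α (r ^ 2)) := by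
  have hu0 : 0 < u := (Real.exp_pos _).trans_le hu
  have hr0 : 0 < r := hu0.trans_le hr
  have hlu : 2 * (α + 1) ≤ Real.log (u ^ 2) := by
    rw [Real.log_pow]; push_cast
    have := (Real.le_log_iff_exp_le hu0).2 hu
    linarith
  have hlr : Real.log (u ^ 2) ≤ Real.log (r ^ 2) := Real.log_le_log (by positivity) (by gcongr)
  simp only [MM, KK, KK', Real.sqrt_sq hu0.le, Real.sqrt_sq hr0.le]
  generalize Real.log (u ^ 2) = s at *
  generalize Real.log (r ^ 2) = t at *
  have hs : 0 < s := by linarith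
  have ht : 0 < t := by linarith
  have e1 : s ^ (-(α - 1)) = s * s ^ (-α) := by
    rw [show -(α - 1) = 1 + -α by ring, Real.rpow_add hs, Real.rpow_one]
  rw [e1]
  have hB : t ^ (-α) ≤ s ^ (-α) := Real.rpow_le_rpow_of_nonpos hs hlr (by linarith)
  have hA0 : 0 < s ^ (-α) := Real.rpow_pos_of_pos hs _
  have hB0 : 0 < t ^ (-α) := Real.rpow_pos_of_pos ht _
  generalize s ^ (-α) = A at *
  generalize t ^ (-α) = B at *
  have ha : α - 1 ≠ 0 := by linarith
  have E : -((α + 1) / (α - 1) * (u * (s * A) * N * (4 * u ^ 2 * (((u ^ 2)⁻¹ * (1 / 2 - (α - 1) * s⁻¹)) ^ 2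
        + (u ^ 2)⁻¹ ^ 2 * (-(1 / 2 - (α - 1) * s⁻¹) + (α - 1) * s⁻¹ ^ 2)) + 2 * ((u ^ 2)⁻¹ * (1 / 2 - (α - 1) * s⁻¹)))))
      - r * B * N * (4 * r ^ 2 * (((r ^ 2)⁻¹ * (1 / 2 - α * t⁻¹)) ^ 2 +
        (r ^ 2)⁻¹ ^ 2 * (-(1 / 2 - α * t⁻¹) + α * t⁻¹ ^ 2)) + 4 * ((r ^ 2)⁻¹ * (1 / 2 - α * t⁻¹)))
      = N * (A * u⁻¹ * (2 * (α + 1) * (1 - 2 * α * s⁻¹))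
        - B * r⁻¹ * (1 - 4 * α * t⁻¹ + 4 * α * (α + 1) * t⁻¹ ^ 2)) := by
    field_simp
    ring
  rw [E]
  apply mul_nonneg hN
  have hAB : B * r⁻¹ ≤ A * u⁻¹ := by gcongr
  have hBr : 0 ≤ B * r⁻¹ := by positivity
  have i1 : 2 ≤ 2 * (α + 1) * (1 - 2 * α * s⁻¹) := by
    have : (α + 1) * s⁻¹ * 2 ≤ 1 := by
      rw [← div_eq_mul_inv, div_mul_eq_mul_div, div_le_one hs]; linarith
    nlinarith
  have i2 : 1 - 4 * α * t⁻¹ + 4 * α * (α + 1) * t⁻¹ ^ 2 ≤ 1 := by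
    have h1 : (α + 1) * t⁻¹ * 2 ≤ 1 := by
      rw [← div_eq_mul_inv, div_mul_eq_mul_div, div_le_one ht]; linarith
    have h2 : 0 ≤ α * t⁻¹ := by positivity
    nlinarith
  nlinarith [mul_le_mul_of_nonneg_left i1 (hBr.trans hAB), mul_le_mul_of_nonneg_left i2 hBr]

noncomputable def PP (α : ℝ) (c : ℂ) : ℝ :=
  -((α + 1) / (α - 1) * MM (α - 1) (c.re ^ 2)) - MM α (c.re ^ 2 + c.im ^ 2)

lemma PP_eq (α : ℝ) (c : ℂ) (h : Real.exp (α + 1) ≤ c.re) (hα : 1 < α) :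
    -((α + 1) / (α - 1) * (c.re / (Real.log (c.re ^ 2)) ^ (α - 1)))
        - ‖c‖ / (Real.log (‖c‖ ^ 2)) ^ α = PP α c := by
  have h1 : 1 < c.re := (Real.one_lt_exp_iff.2 (by linarith)).trans_le h
  have e : c.re ^ 2 + c.im ^ 2 = ‖c‖ ^ 2 := by
    rw [← Complex.normSq_eq_norm_sq, Complex.normSq_apply]; ring
  have h2 : c.re ≤ ‖c‖ := Complex.re_le_norm c
  have l1 : 0 ≤ Real.log (c.re ^ 2) := Real.log_nonneg (by nlinarith)
  have l2 : 0 ≤ Real.log (‖c‖ ^ 2) := Real.log_nonneg (by nlinarith)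
  simp only [PP, MM]
  rw [e, Real.sqrt_sq (by linarith), Real.sqrt_sq (by linarith), Real.rpow_neg l1,
    Real.rpow_neg l2]
  rfl

lemma PP_line (α : ℝ) (F : ℂ → ℂ) (hF : ∀ᶠ ζ in nhds (0:ℂ), DifferentiableAt ℂ F ζ)
    (h1 : 1 < (F 0).re) (c : ℂ) : ∃ p : ℝ → ℝ,
    (∀ᶠ t in nhds (0:ℝ), HasDerivAt (fun t : ℝ => PP α (F (t * c))) (p t) t) ∧
    HasDerivAt p (-((α + 1) / (α - 1) * (MM (α - 1) ((F 0).re ^ 2) *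
      ((KK (α - 1) ((F 0).re ^ 2) ^ 2 + KK' (α - 1) ((F 0).re ^ 2)) *
        (2 * (F 0).re * (c * deriv F 0).re) ^ 2 + KK (α - 1) ((F 0).re ^ 2) *
        (2 * (c * deriv F 0).re ^ 2 + 2 * (F 0).re * (c ^ 2 * deriv (deriv F) 0).re))))
      - MM α ((F 0).re ^ 2 + (F 0).im ^ 2) *
      ((KK α ((F 0).re ^ 2 + (F 0).im ^ 2) ^ 2 + KK' α ((F 0).re ^ 2 + (F 0).im ^ 2)) *
        (2 * (F 0).re * (c * deriv F 0).re + 2 * (F 0).im * (c * deriv F 0).im) ^ 2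
        + KK α ((F 0).re ^ 2 + (F 0).im ^ 2) *
        (2 * (c * deriv F 0).re ^ 2 + 2 * (F 0).re * (c ^ 2 * deriv (deriv F) 0).re
        + (2 * (c * deriv F 0).im ^ 2 + 2 * (F 0).im * (c ^ 2 * deriv (deriv F) 0).im)))) 0 := by
  have hl : ∀ t : ℝ, HasDerivAt (fun t : ℝ => (t : ℂ) * c) c t := fun t => by
    simpa using (Complex.ofRealCLM.hasDerivAt (x := t)).mul_const c
  have hc : Filter.Tendsto (fun t : ℝ => (t : ℂ) * c) (nhds 0) (nhds 0) := by
    simpa [ContinuousAt] using (hl 0).continuousAt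
  have hF2 : DifferentiableAt ℂ (deriv F) 0 := by
    have : AnalyticAt ℂ F 0 := Complex.analyticAt_iff_eventually_differentiableAt.2 hF
    exact this.deriv.differentiableAt
  have hG : ∀ᶠ t : ℝ in nhds (0:ℝ),
      HasDerivAt (fun t : ℝ => F (t * c)) (c * deriv F (t * c)) t := by
    filter_upwards [hc.eventually hF] with t ht
    have := ht.hasDerivAt.scomp t (hl t)
    simpa [smul_eq_mul, Function.comp_def] using this
  have hG2 : HasDerivAt (fun t : ℝ => c * deriv F (t * c)) (c ^ 2 * deriv (deriv F) 0) 0 := by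
    have h0 : HasDerivAt (deriv F) (deriv (deriv F) 0) (((0:ℝ):ℂ) * c) := by
      simpa using hF2.hasDerivAt
    have := (h0.scomp (0:ℝ) (hl 0)).const_mul c
    refine this.congr_deriv ?_
    simp only [smul_eq_mul]; ring
  have re : ∀ (G : ℝ → ℂ) (G' : ℂ) (t : ℝ), HasDerivAt G G' t →
      HasDerivAt (fun t => (G t).re) G'.re t := fun G G' t h =>
    (Complex.reCLM.hasFDerivAt.comp_hasDerivAt t h)
  have im : ∀ (G : ℝ → ℂ) (G' : ℂ) (t : ℝ), HasDerivAt G G' t →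
      HasDerivAt (fun t => (G t).im) G'.im t := fun G G' t h =>
    (Complex.imCLM.hasFDerivAt.comp_hasDerivAt t h)
  have sq : ∀ (x : ℝ → ℝ) (x' t : ℝ), HasDerivAt x x' t →
      HasDerivAt (fun t => x t ^ 2) (2 * x t * x') t := fun x x' t h => by
    
    refine (h.pow 2).congr_deriv ?_
    simp
  have sq2 : ∀ (x y : ℝ → ℝ) (x' y' t : ℝ), HasDerivAt x x' t → HasDerivAt y y' t →
      HasDerivAt (fun t => 2 * x t * y t) (2 * x' * y t + 2 * x t * y') t :=
    fun x y x' y' t h h' => (h.const_mul 2).mul h'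
  have a1 := hG.mono fun t ht => sq _ _ t (re _ _ t ht)
  have b1 := hG.mono fun t ht => (sq _ _ t (re _ _ t ht)).add (sq _ _ t (im _ _ t ht))
  have a2 := sq2 _ _ _ _ 0 (re _ _ 0 hG.self_of_nhds) (re _ _ 0 hG2)
  have b2 := a2.add (sq2 _ _ _ _ 0 (im _ _ 0 hG.self_of_nhds) (im _ _ 0 hG2))
  have hq : ∀ᶠ t : ℝ in nhds (0:ℝ), 1 < (F (t * c)).re := by
    have : ContinuousAt (fun t : ℝ => (F (t * c)).re) 0 :=
      (re _ _ 0 hG.self_of_nhds).continuousAt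
    exact this.eventually_const_lt (by simpa using h1)
  obtain ⟨A1, A2⟩ := MM_comp (α - 1) _ _ _ a1 a2 (hq.mono fun t ht => by nlinarith)
  obtain ⟨B1, B2⟩ := MM_comp α _ _ _ b1 b2 (hq.mono fun t ht => by
    simp only [Pi.add_apply]; nlinarith [sq_nonneg (F (t * c)).im])
  refine ⟨_, ?_, (((A2.const_mul ((α + 1) / (α - 1))).neg.sub B2)).congr_deriv ?_⟩
  · filter_upwards [A1, B1] with t hA hB
    exact (hA.const_mul ((α + 1) / (α - 1))).neg.sub hB
  · simp
    ring

lemma PP_diff (α : ℝ) (c : ℂ) (h : 1 < c.re) : DifferentiableAt ℝ (PP α) c := by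
  have r : DifferentiableAt ℝ (fun c : ℂ => c.re) c := Complex.reCLM.differentiableAt
  have i : DifferentiableAt ℝ (fun c : ℂ => c.im) c := Complex.imCLM.differentiableAt
  have h1 := (MM_deriv (α - 1) (c.re ^ 2) (by nlinarith)).differentiableAt.comp c (r.pow 2)
  have h2 := (MM_deriv α (c.re ^ 2 + c.im ^ 2) (by nlinarith [sq_nonneg c.im])).differentiableAt.comp c
    ((r.pow 2).add (i.pow 2))
  exact (h1.const_mul ((α + 1) / (α - 1))).neg.sub h2


open Real Set

/-- A `C²` real-valued function on an open set `Ω ⊆ ℂⁿ` is plurisubharmonic iff its complex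
Hessian is positive semidefinite at each point; equivalently, for every `z ∈ Ω` and `w ∈ ℂⁿ`
the Laplacian at `0` of `ζ ↦ g (z + ζ • w)` is nonnegative, i.e.
`D²g(z)(w,w) + D²g(z)(i•w, i•w) ≥ 0`. -/
def PshOnCn {n : ℕ} (g : EuclideanSpace ℂ (Fin n) → ℝ)
    (Ω : Set (EuclideanSpace ℂ (Fin n))) : Prop :=
  ∀ z ∈ Ω, ∀ w : EuclideanSpace ℂ (Fin n),
    0 ≤ fderiv ℝ (fderiv ℝ g) z w w +
        fderiv ℝ (fderiv ℝ g) z (Complex.I • w) (Complex.I • w)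

/-- **The key plurisubharmonicity in the proof of Proposition 3.1**: for `α > 1` and `f`
holomorphic on an open `Ω ⊆ ℂⁿ` with `u := Re f ≥ e^{α+1}` on `Ω`, the function
`φ := −((α+1)/(α−1)) · u/(log u²)^{α−1} − |f|/(log |f|²)^α` is plurisubharmonic on `Ω`. -/
theorem psh_kolmogorov_lemma (α : ℝ) (hα : 1 < α) (n : ℕ)
    (Ω : Set (EuclideanSpace ℂ (Fin n))) (hΩ : IsOpen Ω)
    (f : EuclideanSpace ℂ (Fin n) → ℂ) (hf : DifferentiableOn ℂ f Ω)
    (hu : ∀ z ∈ Ω, Real.exp (α + 1) ≤ (f z).re) :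
    PshOnCn (fun z =>
      -((α + 1) / (α - 1) * ((f z).re / (Real.log (((f z).re) ^ 2)) ^ (α - 1)))
        - ‖f z‖ / (Real.log (‖f z‖ ^ 2)) ^ α) Ω := by
  intro z hz w
  set g : EuclideanSpace ℂ (Fin n) → ℝ := fun z =>
      -((α + 1) / (α - 1) * ((f z).re / (Real.log (((f z).re) ^ 2)) ^ (α - 1)))
        - ‖f z‖ / (Real.log (‖f z‖ ^ 2)) ^ α with hgdef
  by_cases h2 : DifferentiableAt ℝ (fderiv ℝ g) z
  swap
  · rw [fderiv_zero_of_not_differentiableAt h2]; simp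
  have hone : ∀ y ∈ Ω, 1 < (f y).re := fun y hy =>
    (Real.one_lt_exp_iff.2 (by linarith)).trans_le (hu y hy)
  have hgP : ∀ y ∈ Ω, g y = PP α (f y) := fun y hy => PP_eq α (f y) (hu y hy) hα
  have hgd : ∀ᶠ y in nhds z, DifferentiableAt ℝ g y := by
    filter_upwards [hΩ.mem_nhds hz] with y hy
    have e : g =ᶠ[nhds y] fun y => PP α (f y) := by
      filter_upwards [hΩ.mem_nhds hy] with x hx using hgP x hx
    refine DifferentiableAt.congr_of_eventuallyEq ?_ e
    exact (PP_diff α (f y) (hone y hy)).comp y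
      ((hf.differentiableAt (hΩ.mem_nhds hy)).restrictScalars ℝ)
  let F : ℂ → ℂ := fun ζ => f (z + ζ • w)
  have hlc : Filter.Tendsto (fun ζ : ℂ => z + ζ • w) (nhds 0) (nhds z) := by
    have : Continuous (fun ζ : ℂ => z + ζ • w) := by fun_prop
    simpa using this.tendsto 0
  have hF : ∀ᶠ ζ in nhds (0:ℂ), DifferentiableAt ℂ F ζ := by
    filter_upwards [hlc.eventually (hΩ.mem_nhds hz)] with ζ hζ
    have hd : DifferentiableAt ℂ f (z + ζ • w) := hf.differentiableAt (hΩ.mem_nhds hζ)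
    exact hd.comp ζ (by fun_prop)
  have hF0 : F 0 = f z := by simp [F]
  have hval : ∀ c : ℂ, ∀ d : ℝ, (∃ p : ℝ → ℝ,
      (∀ᶠ t in nhds (0:ℝ), HasDerivAt (fun t : ℝ => PP α (F (t * c))) (p t) t) ∧
      HasDerivAt p d 0) → fderiv ℝ (fderiv ℝ g) z (c • w) (c • w) = d := by
    rintro c d ⟨p, hp, hd⟩
    refine second_line g z (c • w) hgd h2 p d ?_ hd
    have hc : Filter.Tendsto (fun t : ℝ => z + t • (c • w)) (nhds 0) (nhds z) := by
      have : Continuous (fun t : ℝ => z + t • (c • w)) := by fun_prop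
      simpa using this.tendsto 0
    filter_upwards [hp, (hc.eventually (hΩ.mem_nhds hz)).eventually_nhds] with t ht hΩt
    refine ht.congr_of_eventuallyEq ?_
    filter_upwards [hΩt] with s hs
    rw [hgP _ hs]
    simp [F, mul_smul]
  have v1 := hval 1 _ (PP_line α F hF (by rw [hF0]; exact hone z hz) 1)
  have v2 := hval Complex.I _ (PP_line α F hF (by rw [hF0]; exact hone z hz) Complex.I)
  rw [one_smul] at v1
  rw [v1, v2, hF0]
  have K := key_ineq α hα (f z).re ‖f z‖ ((deriv F 0).re ^ 2 + (deriv F 0).im ^ 2) (hu z hz)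
    (Complex.re_le_norm _) (by positivity)
  have e : ‖f z‖ ^ 2 = (f z).re ^ 2 + (f z).im ^ 2 := by
    rw [← Complex.normSq_eq_norm_sq, Complex.normSq_apply]; ring
  rw [e] at K
  refine K.trans_eq ?_
  simp
  ring
end

section
/- Let f(z) := (2/(π i)) · Log((1+z)/(1−z)), where Log is the principal branch of the complex logarithm. Then f is holomorphic on the open unit disc 𝔻 with |Re f| ≤ 1 on 𝔻, and the boundary integral ∫₀^{2π} exp((π/2)·|f(e^{iθ})|) / log(|f(e^{iθ})| + 1) dθ diverges to ∞, where for e^{iθ} ≠ ±1 the boundary value f(e^{iθ}) is given by the same formula (2/(π i)) · Log((1+e^{iθ})/(1−e^{iθ})). -/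
open Real MeasureTheory Set

lemma zyg_re_pos (z : ℂ) (hz : z ∈ Metric.ball (0:ℂ) 1) : 0 < ((1 + z) / (1 - z)).re := by
  have h1 : ‖z‖ < 1 := by simpa using hz
  have h2 : Complex.normSq z < 1 := by
    rw [Complex.normSq_eq_norm_sq]; nlinarith [norm_nonneg z]
  have hne : (1 - z) ≠ 0 := by
    intro h
    have : z = 1 := by linear_combination -h
    rw [this] at h1; simp at h1
  have h3 : 0 < Complex.normSq (1 - z) := Complex.normSq_pos.2 hne
  rw [Complex.div_re, ← add_div]
  apply div_pos _ h3
  rw [Complex.normSq_apply] at h2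
  simp
  nlinarith

lemma zyg_const (w : ℂ) : 2 / (π * Complex.I) * w = ((2 / π : ℝ) : ℂ) * (-Complex.I * w) := by
  have : (π : ℂ) ≠ 0 := by exact_mod_cast pi_ne_zero
  push_cast
  field_simp
  simp

lemma zyg_re (w : ℂ) : (2 / (π * Complex.I) * Complex.log w).re = 2 / π * w.arg := by
  rw [zyg_const, Complex.re_ofReal_mul]
  simp [Complex.log_im]

lemma zyg_norm (w : ℂ) : ‖2 / (π * Complex.I) * w‖ = 2 / π * ‖w‖ := by
  rw [zyg_const, norm_mul, norm_mul, Complex.norm_real, Real.norm_of_nonneg (by positivity)]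
  simp

lemma zyg_expdiv {M L : ℝ} (hM : 1 ≤ M) (h : M ≤ L) : rexp M / M ≤ rexp L / L := by
  have hM0 : 0 < M := by linarith
  rw [div_le_div_iff₀ hM0 (by linarith)]
  have h1 := Real.add_one_le_exp (L - M)
  have h2 : rexp L = rexp M * rexp (L - M) := by rw [← Real.exp_add]; congr 1; ring
  rw [h2, mul_assoc]
  apply mul_le_mul_of_nonneg_left _ (exp_pos M).le
  nlinarith

lemma zyg_log_lower {θ : ℝ} (h0 : 0 < θ) (h1 : θ ≤ 1) :
    - Real.log θ ≤ ‖Complex.log ((1 + Complex.exp (θ * Complex.I)) /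
                  (1 - Complex.exp (θ * Complex.I)))‖ := by
  set w := Complex.exp (θ * Complex.I) with hw
  have hre : w.re = Real.cos θ := by rw [hw, Complex.exp_ofReal_mul_I_re]
  have him : w.im = Real.sin θ := by rw [hw, Complex.exp_ofReal_mul_I_im]
  have hsin : 0 < Real.sin θ := Real.sin_pos_of_pos_of_lt_pi h0 (by linarith [pi_gt_three])
  have hcos : 0 < Real.cos θ := Real.cos_pos_of_le_one (by rw [abs_of_pos h0]; exact h1)
  have hne : 0 < ‖1 - w‖ := by
    rw [norm_pos_iff]
    intro h
    have := congrArg Complex.im h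
    simp [him] at this
    exact hsin.ne' this
  have hup : ‖1 - w‖ ≤ θ := by
    rw [norm_sub_rev, hw, mul_comm]
    simpa [abs_of_pos h0] using Real.norm_exp_I_mul_ofReal_sub_one_le (x := θ)
  have hlow : 1 ≤ ‖1 + w‖ := by
    refine le_trans ?_ (Complex.re_le_norm _)
    simp [hre, hcos.le]
  refine le_trans ?_ (Complex.re_le_norm _)
  rw [Complex.log_re, norm_div, ← Real.log_inv]
  apply Real.log_le_log (by positivity)
  rw [inv_eq_one_div]
  gcongr

lemma zyg_point {θ : ℝ} (h0 : 0 < θ) (h1 : θ ≤ rexp (-1)) :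
    1 / (θ * (- Real.log θ)) ≤ (Real.exp (π / 2 * norm
              (2 / (π * Complex.I) *
                Complex.log ((1 + Complex.exp (θ * Complex.I)) /
                  (1 - Complex.exp (θ * Complex.I))))) /
            Real.log (norm
              (2 / (π * Complex.I) *
                Complex.log ((1 + Complex.exp (θ * Complex.I)) /
                  (1 - Complex.exp (θ * Complex.I)))) + 1)) := by
  have hθ1 : θ ≤ 1 := h1.trans (Real.exp_le_one_iff.2 (by norm_num))
  have hL := zyg_log_lower h0 hθ1
  have hM : 1 ≤ - Real.log θ := by
    have := Real.log_le_log h0 h1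
    rw [Real.log_exp] at this
    linarith
  rw [zyg_norm]
  set L := ‖Complex.log ((1 + Complex.exp (θ * Complex.I)) /
                  (1 - Complex.exp (θ * Complex.I)))‖
  have hLpos : 0 < L := by linarith
  have e1 : π / 2 * (2 / π * L) = L := by field_simp
  have e2 : rexp (-Real.log θ) = 1 / θ := by
    rw [Real.exp_neg, Real.exp_log h0, one_div]
  rw [e1]
  have hpos : 0 < 2 / π * L := by positivity
  have hlogpos : 0 < Real.log (2 / π * L + 1) := Real.log_pos (by linarith)
  have hle : Real.log (2 / π * L + 1) ≤ L := by
    have := Real.log_le_sub_one_of_pos (x := 2 / π * L + 1) (by linarith)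
    have h2 : 2 / π ≤ 1 := by
      rw [div_le_one pi_pos]; linarith [pi_gt_three]
    nlinarith
  calc 1 / (θ * (- Real.log θ)) = rexp (-Real.log θ) / (-Real.log θ) := by
        rw [e2, div_div]
    _ ≤ rexp L / L := zyg_expdiv hM hL
    _ ≤ _ := by gcongr

lemma zyg_not_int :
    ¬ IntegrableOn (fun θ : ℝ => 1 / (θ * (- Real.log θ))) (Ioc 0 (rexp (-1))) := by
  have hev : ∀ᶠ x : ℝ in nhdsWithin 0 (Ioi 0), 0 < x ∧ x < rexp (-1) :=
    Ioo_mem_nhdsGT (exp_pos _)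
  have hd : ∀ x : ℝ, 0 < x ∧ x < rexp (-1) →
      HasDerivAt (fun x => Real.log (- Real.log x)) (-(1 / (x * (- Real.log x)))) x := by
    rintro x ⟨h0, h1⟩
    have hl : Real.log x < 0 := Real.log_neg h0 (h1.trans (by rw [← Real.exp_zero]; exact Real.exp_lt_exp.2 (by norm_num)))
    have h2 : HasDerivAt (fun x => - Real.log x) (-x⁻¹) x := (Real.hasDerivAt_log h0.ne').neg
    have h3 : - Real.log x ≠ 0 := (neg_pos.2 hl).ne'
    have h4 := h2.log h3
    convert h4 using 1
    rw [one_div, mul_inv, div_eq_mul_inv, neg_mul]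
  refine not_integrableOn_of_tendsto_norm_atTop_of_deriv_isBigO_filter (nhdsWithin (0:ℝ) (Ioi 0)) 
    (f := fun x => Real.log (- Real.log x)) (Ioc_mem_nhdsGT (exp_pos _)) ?_ ?_ ?_
  · filter_upwards [hev] with x hx using (hd x hx).differentiableAt
  · refine tendsto_norm_atTop_atTop.comp (Real.tendsto_log_atTop.comp ?_)
    exact Filter.tendsto_neg_atBot_atTop.comp Real.tendsto_log_nhdsGT_zero
  · refine Asymptotics.IsBigO.of_bound 1 ?_
    filter_upwards [hev] with x hx
    rw [(hd x hx).deriv]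
    simp

/-- **Sharpness example for Zygmund's theorem** (Remark after Theorem 1.6).
The function `f(z) = (2/(πi)) Log((1+z)/(1−z))` is holomorphic on the unit disc with
`|Re f| ≤ 1` there, but the boundary integral
`∫₀^{2π} exp((π/2)|f(e^{iθ})|) / log(|f(e^{iθ})| + 1) dθ` diverges to `∞`. -/
theorem zygmund_sharpness_example :
    DifferentiableOn ℂ
        (fun z : ℂ => 2 / (π * Complex.I) * Complex.log ((1 + z) / (1 - z)))
        (Metric.ball 0 1) ∧
    (∀ z ∈ Metric.ball (0:ℂ) 1,
      |((2 / (π * Complex.I) * Complex.log ((1 + z) / (1 - z))).re)| ≤ 1) ∧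
    ∫⁻ θ in Ioc (0:ℝ) (2 * π),
        ENNReal.ofReal
          (Real.exp (π / 2 * norm
              (2 / (π * Complex.I) *
                Complex.log ((1 + Complex.exp (θ * Complex.I)) /
                  (1 - Complex.exp (θ * Complex.I))))) /
            Real.log (norm
              (2 / (π * Complex.I) *
                Complex.log ((1 + Complex.exp (θ * Complex.I)) /
                  (1 - Complex.exp (θ * Complex.I)))) + 1)) = ⊤ := by
  refine ⟨?_, ?_, ?_⟩
  · intro z hz
    have h := zyg_re_pos z hz
    have hne : (1 - z) ≠ 0 := by
      intro h'
      rw [h'] at h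
      simp at h
    apply DifferentiableAt.differentiableWithinAt
    apply DifferentiableAt.const_mul
    apply DifferentiableAt.clog
    · exact DifferentiableAt.div (by fun_prop) (by fun_prop) hne
    · exact Or.inl h
  · intro z hz
    have h := zyg_re_pos z hz
    rw [zyg_re, abs_mul, abs_of_pos (by positivity)]
    have := Complex.abs_arg_le_pi_div_two_iff.2 h.le
    calc _ ≤ 2 / π * (π / 2) := by gcongr
      _ = 1 := by field_simp
  · have hsub : Ioc (0:ℝ) (rexp (-1)) ⊆ Ioc 0 (2 * π) := by
      apply Ioc_subset_Ioc_right
      have : rexp (-1) ≤ 1 := Real.exp_le_one_iff.2 (by norm_num)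
      linarith [pi_gt_three]
    rw [eq_top_iff]
    refine le_trans ?_ (lintegral_mono_set hsub)
    refine le_trans ?_ (setLIntegral_mono' measurableSet_Ioc
      (fun θ hθ => ENNReal.ofReal_le_ofReal (zyg_point hθ.1 hθ.2)))
    by_contra hcon
    rw [not_le] at hcon
    apply zyg_not_int
    refine ⟨(by fun_prop : Measurable fun θ : ℝ => 1 / (θ * (- Real.log θ))).aestronglyMeasurable, ?_⟩
    rw [hasFiniteIntegral_iff_ofReal]
    · exact hcon
    · filter_upwards [ae_restrict_mem measurableSet_Ioc] with θ hθ
      have : Real.log θ ≤ 0 := Real.log_nonpos hθ.1.le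
        (hθ.2.trans (Real.exp_le_one_iff.2 (by norm_num)))
      have h1 := hθ.1
      have h2 : 0 ≤ - Real.log θ := by linarith
      show 0 ≤ 1 / (θ * (- Real.log θ))
      positivity
end
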